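/- Let g be a root-reductive Lie algebra with splitting maximal toral subalgebra h and Dynkin Borel subalgebra b ⊇ h. For every λ ∈ h*, the Verma module M(λ) has at most one simple submodule, and if this submodule exists, it is itself a Verma module. -/

import Mathlib

noncomputable section
namespace Paper

variable (K : Type) [Field K] [IsAlgClosed K] [CharZero K]
variable (g : Type) [LieRing g] [LieAlgebra K g]

def adWeightSpace (h : LieSubalgebra K g) (α : Module.Dual K h) : Submodule K g where
  carrier := {x | ∀ H : h, ⁅(H : g), x⁆ = α H • x}
  add_mem' := by intro a b ha hb H; rw [lie_add, ha H, hb H, smul_add]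
  zero_mem' := by intro H; rw [lie_zero, smul_zero]
  smul_mem' := by intro c x hx H; rw [lie_smul, hx H, smul_comm]

def IsRootOf (h : LieSubalgebra K g) (α : Module.Dual K h) : Prop :=
  α ≠ 0 ∧ adWeightSpace K g h α ≠ ⊥

def IsToralIn (s t : LieSubalgebra K g) : Prop :=
  t ≤ s ∧ IsLieAbelian t ∧
    s.toSubmodule ≤ ⨆ α : Module.Dual K t, s.toSubmodule ⊓ adWeightSpace K g t α

def IsMaxToralIn (s t : LieSubalgebra K g) : Prop :=
  IsToralIn K g s t ∧ ∀ t' : LieSubalgebra K g, IsToralIn K g s t' → t ≤ t' → t' = t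

/-- A root-reductive Lie algebra `g` together with a splitting maximal toral subalgebra `h`
and a splitting Borel subalgebra `b ⊇ h` determined by a set `pos` of positive roots. -/
structure Setup where
  /-- the exhausting chain of finite-dimensional reductive subalgebras -/
  F : ℕ → LieSubalgebra K g
  F_mono : Monotone F
  F_exhaust : ∀ x : g, ∃ n, x ∈ F n
  F_findim : ∀ n, FiniteDimensional K (F n)
  /-- each `F n` is reductive: every abelian ideal is central -/
  F_reductive : ∀ n, ∀ I : LieIdeal K (F n), IsLieAbelian I → I ≤ LieAlgebra.center K (F n)
  /-- the nested chain of Cartan subalgebras witnessing the root inclusions -/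
  C : ℕ → LieSubalgebra K g
  C_mono : Monotone C
  C_le : ∀ n, C n ≤ F n
  C_cartan : ∀ n, (LieSubalgebra.comap (F n).incl (C n)).IsCartanSubalgebra
  /-- each inclusion `F n ↪ F (n+1)` is a root inclusion with respect to `C (n+1)`:
  every root space of `F n` relative to `C n` is a root space of `F (n+1)` -/
  C_rootIncl : ∀ n, ∀ α : Module.Dual K (C n), α ≠ 0 →
    (F n).toSubmodule ⊓ adWeightSpace K g (C n) α ≠ ⊥ →
    ∃ β : Module.Dual K (C (n + 1)),
      (F n).toSubmodule ⊓ adWeightSpace K g (C n) α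
        = (F (n + 1)).toSubmodule ⊓ adWeightSpace K g (C (n + 1)) β
  /-- the splitting maximal toral subalgebra -/
  h : LieSubalgebra K g
  h_maxToral : ∀ n, IsMaxToralIn K g (F n) (h ⊓ F n)
  /-- `g` is the direct sum of its `h`-weight spaces -/
  h_indep : iSupIndep fun α : Module.Dual K h => adWeightSpace K g h α
  h_span : (⨆ α : Module.Dual K h, adWeightSpace K g h α) = ⊤
  /-- the set `Δ⁺` of positive roots -/
  pos : Set (Module.Dual K h)
  pos_root : ∀ α ∈ pos, IsRootOf K g h α
  pos_add : ∀ α ∈ pos, ∀ β ∈ pos, IsRootOf K g h (α + β) → α + β ∈ pos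
  pos_polar : ∀ α : Module.Dual K h, IsRootOf K g h α → (α ∈ pos ↔ ¬(-α ∈ pos))
  neg_add : ∀ α β : Module.Dual K h, IsRootOf K g h α → IsRootOf K g h β →
    α ∉ pos → β ∉ pos → IsRootOf K g h (α + β) → α + β ∉ pos
  /-- the splitting Borel subalgebra -/
  b : LieSubalgebra K g
  b_eq : b.toSubmodule = h.toSubmodule ⊔ ⨆ α ∈ pos, adWeightSpace K g h α


variable {K g}

namespace Setup

variable (S : Setup K g)

/-- `h ∩ g_n`. -/
def hn (n : ℕ) : LieSubalgebra K g := S.h ⊓ S.F n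

/-- restriction of a functional on `h` to `h ∩ g_n`. -/
def resDual (n : ℕ) (lam : Module.Dual K S.h) : Module.Dual K (S.hn n) :=
  lam.comp (LieSubalgebra.inclusion (inf_le_left : S.hn n ≤ S.h)).toLinearMap

/-- the `α`-root space of `g_n` relative to `h ∩ g_n`. -/
def rootSpaceN (n : ℕ) (α : Module.Dual K (S.hn n)) : Submodule K g :=
  (S.F n).toSubmodule ⊓ adWeightSpace K g (S.hn n) α

/-- the set of `b`-positive roots of `g_n`. -/
def posRootsN (n : ℕ) : Set (Module.Dual K (S.hn n)) :=
  {α | α ≠ 0 ∧ S.rootSpaceN n α ≠ ⊥ ∧ S.rootSpaceN n α ≤ S.b.toSubmodule}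

/-- `ρ_n`, the half sum of the positive roots of `g_n` with respect to `b ∩ g_n`. -/
def rhoN (n : ℕ) : Module.Dual K (S.hn n) :=
  (2 : K)⁻¹ • ∑ᶠ α ∈ S.posRootsN n, α

/-- `α` is a simple `b`-positive root: it is positive and cannot be written as a sum of
two or more positive roots. -/
def IsSimpleRoot (α : Module.Dual K S.h) : Prop :=
  α ∈ S.pos ∧ ¬∃ s : Multiset (Module.Dual K S.h),
    2 ≤ Multiset.card s ∧ (∀ β ∈ s, β ∈ S.pos) ∧ s.sum = α

/-- `b` is a Dynkin Borel subalgebra: it is generated, as a Lie subalgebra, by `h` together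
with the simple root spaces. -/
def IsDynkin : Prop :=
  S.b = LieSubalgebra.lieSpan K g
    ((S.h : Set g) ∪ ⋃ α ∈ {α | S.IsSimpleRoot α}, (adWeightSpace K g S.h α : Set g))

/-- the partial order `≼` on `h^*`: `lam ≼ mu` iff `mu - lam` is a `ℤ≥0`-linear combination
of positive roots. -/
def wle (lam mu : Module.Dual K S.h) : Prop :=
  ∃ s : Multiset (Module.Dual K S.h), (∀ β ∈ s, β ∈ S.pos) ∧ mu - lam = s.sum

/-- `g` is locally semisimple: each `g_n` is a semisimple Lie algebra. -/
def IsLocallySemisimple : Prop := ∀ n, LieAlgebra.IsSemisimple K (S.F n)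

end Setup


/-- the universal enveloping algebra of `g`. -/
abbrev Env (K g : Type) [Field K] [LieRing g] [LieAlgebra K g] : Type :=
  UniversalEnvelopingAlgebra K g

namespace Setup

variable {K : Type} [Field K] [IsAlgClosed K] [CharZero K]
variable {g : Type} [LieRing g] [LieAlgebra K g]
variable (S : Setup K g)

/-- the nilpotent radical `n⁺ = ⨁_{α ∈ Δ⁺} g^α` of `b`, as a subspace of `g`. -/
def nplus : Submodule K g := ⨆ α ∈ S.pos, adWeightSpace K g S.h α

/-- the left ideal of `U(g)` generated by `n⁺` and the elements `H - lam(H)`, `H ∈ h`. -/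
def vermaIdeal (lam : Module.Dual K S.h) : Submodule (Env K g) (Env K g) :=
  Submodule.span (Env K g)
    ((UniversalEnvelopingAlgebra.ι K '' (S.nplus : Set g)) ∪
      Set.range fun H : S.h =>
        UniversalEnvelopingAlgebra.ι K (H : g) - algebraMap K (Env K g) (lam H))

/-- the Verma module `M(lam) = U(g)/I`. -/
abbrev Verma (lam : Module.Dual K S.h) : Type := Env K g ⧸ S.vermaIdeal lam

/-- the maximal proper submodule of the Verma module `M(lam)`,
i.e. the sum of all proper submodules. -/
def maxSub (lam : Module.Dual K S.h) : Submodule (Env K g) (S.Verma lam) :=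
  sSup {N : Submodule (Env K g) (S.Verma lam) | N ≠ ⊤}

/-- the simple module `L(lam)`, the unique simple quotient of `M(lam)`. -/
abbrev SimpleL (lam : Module.Dual K S.h) : Type := S.Verma lam ⧸ S.maxSub lam

/-- `H` is the coroot `h_α` of the root `α`:  `α(H) = 2` and `H ∈ [g^α, g^{-α}]`. -/
def IsCoroot (α : Module.Dual K S.h) (H : S.h) : Prop :=
  α H = 2 ∧ ∃ x ∈ adWeightSpace K g S.h α, ∃ y ∈ adWeightSpace K g S.h (-α),
    (H : g) = ⁅x, y⁆

/-- the dot-reflection `s_α · mu = mu - (mu + ρ)(h_α) α` associated to a root `α`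
with coroot `Hα`, relative to the half sum `ρ` of positive roots. -/
def dotReflect (ρ α : Module.Dual K S.h) (Hα : S.h) (mu : Module.Dual K S.h) :
    Module.Dual K S.h :=
  mu - ((mu + ρ) Hα) • α

/-- `ρ` is the global half sum of positive roots: its restriction to each `h ∩ g_n`
is the half sum `ρ_n` of positive roots of `g_n`. -/
def IsGlobalRho (ρ : Module.Dual K S.h) : Prop := ∀ n : ℕ, S.resDual n ρ = S.rhoN n

/-- `lam` is strongly linked to `mu` (relative to `ρ`). -/
inductive StronglyLinked (ρ : Module.Dual K S.h) :
    Module.Dual K S.h → Module.Dual K S.h → Prop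
  | refl (mu : Module.Dual K S.h) : StronglyLinked ρ mu mu
  | step {lam mu : Module.Dual K S.h} (α : Module.Dual K S.h) (Hα : S.h) :
      α ∈ S.pos → S.IsCoroot α Hα →
      S.wle (S.dotReflect ρ α Hα mu) mu →
      StronglyLinked ρ lam (S.dotReflect ρ α Hα mu) →
      StronglyLinked ρ lam mu

/-- `lam` is antidominant: `(lam + ρ)(h_α)` is not a positive integer
for any positive root `α`. -/
def IsAntidominant (ρ lam : Module.Dual K S.h) : Prop :=
  ∀ α ∈ S.pos, ∀ Hα : S.h, S.IsCoroot α Hα → ¬∃ k : ℕ, 0 < k ∧ (lam + ρ) Hα = (k : K)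

/-- `lam` is almost antidominant: `(lam + ρ)(h_α)` is a positive integer
for only finitely many positive roots `α`. -/
def IsAlmostAntidominant (ρ lam : Module.Dual K S.h) : Prop :=
  {α | α ∈ S.pos ∧ ∃ Hα : S.h, S.IsCoroot α Hα ∧
    ∃ k : ℕ, 0 < k ∧ (lam + ρ) Hα = (k : K)}.Finite

end Setup

set_option linter.unusedSectionVars false

namespace PBW
open MvPolynomial

variable {K g ι : Type} [Field K] [LieRing g] [LieAlgebra K g] [LinearOrder ι]
variable (x : ι → g) (c : g →ₗ[K] (ι →₀ K)) (χ : g →ₗ[K] K)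

/-- The symbol of `z`: the linear form `∑ cᵢ(z) Xᵢ`. -/
def sym : g →ₗ[K] MvPolynomial ι K := Finsupp.linearCombination K (X : ι → MvPolynomial ι K) ∘ₗ c

/-- Removes from `z` its components along `x i` for `i ≤ j`. -/
def trunc (j : ι) : g →ₗ[K] g :=
  LinearMap.id - Finsupp.linearCombination K (fun i => if i ≤ j then x i else 0) ∘ₗ c

/-- The action of `g` on monomials of degree at most `n`. -/
def actAux : ℕ → (ι →₀ ℕ) → (g →ₗ[K] MvPolynomial ι K)
  | 0, _ => sym c + (Algebra.linearMap K (MvPolynomial ι K)) ∘ₗ χ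
  | n + 1, M => if h : M.degree ≤ n then actAux n M else
      let j := M.support.min' (Finsupp.support_nonempty_iff.2 (by rintro rfl; simp at h))
      let T := M - Finsupp.single j 1
      LinearMap.mulRight K (monomial M 1) ∘ₗ sym c
        + ((basisMonomials ι K).constr K (actAux n)).flip (x j) ∘ₗ
            (actAux n T - LinearMap.mulRight K (monomial T 1) ∘ₗ sym c) ∘ₗ trunc x c j
        - actAux n T ∘ₗ (LieAlgebra.ad K g (x j)) ∘ₗ trunc x c j

/-- The action of `g` on the polynomial model of the induced module. -/
def act : g →ₗ[K] MvPolynomial ι K →ₗ[K] MvPolynomial ι K :=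
  ((basisMonomials ι K).constr K (fun M => actAux x c χ M.degree M)).flip

lemma actAux_of_le {n : ℕ} {M : ι →₀ ℕ} (h : M.degree ≤ n) :
    actAux x c χ n M = actAux x c χ M.degree M := by
  induction n with
  | zero =>
    have : M.degree = 0 := by omega
    rw [this]
  | succ n ih =>
    rcases Nat.lt_or_ge n M.degree with h' | h'
    · have : M.degree = n + 1 := by omega
      rw [this]
    · rw [actAux, dif_pos h', ih h']

lemma act_monomial (z : g) (M : ι →₀ ℕ) :
    act x c χ z (monomial M 1) = actAux x c χ M.degree M z := by
  have := (basisMonomials ι K).constr_basis K (fun M => actAux x c χ M.degree M) M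
  rw [coe_basisMonomials] at this
  simp [act, this]

/-- Polynomials of total degree at most `n`. -/
abbrev D (n : ℕ) : Submodule K (MvPolynomial ι K) := restrictTotalDegree ι K n

lemma D_mono {m n : ℕ} (h : m ≤ n) : (D m : Submodule K (MvPolynomial ι K)) ≤ D n := by
  intro p hp
  rw [mem_restrictTotalDegree] at *
  omega

lemma mul_mem_D {m n : ℕ} {p q : MvPolynomial ι K} (hp : p ∈ D m) (hq : q ∈ D n) :
    p * q ∈ D (m + n) := by
  rw [mem_restrictTotalDegree] at *
  exact (totalDegree_mul p q).trans (by omega)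

lemma monomial_mem_D {n : ℕ} {M : ι →₀ ℕ} (h : M.degree ≤ n) :
    (monomial M 1 : MvPolynomial ι K) ∈ D n := by
  rw [mem_restrictTotalDegree, totalDegree_monomial _ one_ne_zero]
  exact h

lemma sym_mem_D (z : g) : sym c z ∈ D 1 := by
  simp only [sym, LinearMap.comp_apply, Finsupp.linearCombination_apply]
  refine Submodule.sum_mem _ fun i _ => Submodule.smul_mem _ _ ?_
  rw [mem_restrictTotalDegree]; simp

lemma D_induction {n : ℕ} (S : Submodule K (MvPolynomial ι K))
    (h : ∀ M : ι →₀ ℕ, M.degree ≤ n → (monomial M 1 : MvPolynomial ι K) ∈ S) : D n ≤ S := by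
  intro p hp
  rw [mem_restrictTotalDegree] at hp
  rw [p.as_sum]
  refine Submodule.sum_mem _ fun M hM => ?_
  have : monomial M (coeff M p) = coeff M p • (monomial M 1 : MvPolynomial ι K) := by
    rw [smul_monomial, smul_eq_mul, mul_one]
  rw [this]
  exact Submodule.smul_mem _ _ (h M ((le_totalDegree hM).trans hp))

lemma constr_actAux {n : ℕ} {w : MvPolynomial ι K} (hw : w ∈ D n) (z : g) :
    (basisMonomials ι K).constr K (actAux x c χ n) w z = act x c χ z w := by
  have : D n ≤ LinearMap.eqLocus
      (((basisMonomials ι K).constr K (actAux x c χ n)).flip z) (act x c χ z) := by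
    refine D_induction _ fun M hM => ?_
    rw [LinearMap.mem_eqLocus, act_monomial, ← actAux_of_le x c χ hM]
    have := (basisMonomials ι K).constr_basis K (actAux x c χ n) M
    rw [coe_basisMonomials] at this
    simp [this]
  exact this hw

end PBW

namespace PBW
open MvPolynomial

variable {K g ι : Type} [Field K] [LieRing g] [LieAlgebra K g] [LinearOrder ι]
variable (x : ι → g) (c : g →ₗ[K] (ι →₀ K)) (χ : g →ₗ[K] K)

lemma act_one (z : g) : act x c χ z 1 = sym c z + C (χ z) := by
  have := act_monomial x c χ z 0
  rw [show (monomial 0 1 : MvPolynomial ι K) = 1 from rfl] at this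
  rw [this]
  simp [actAux, algebraMap_eq]

lemma monomial_single_add_one (j : ι) (T : ι →₀ ℕ) :
    (monomial (Finsupp.single j 1 + T) 1 : MvPolynomial ι K) = X j * monomial T 1 := by
  rw [X, monomial_mul, one_mul]

/-- Every nonconstant monomial is its smallest variable times the rest. -/
lemma exists_min_add {M : ι →₀ ℕ} (hM : M ≠ 0) :
    ∃ j T, M = Finsupp.single j 1 + T ∧ (∀ i ∈ T.support, j ≤ i) ∧ M.degree = T.degree + 1 := by
  have hne := Finsupp.support_nonempty_iff.2 hM
  set j := M.support.min' hne with hj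
  have hjM : j ∈ M.support := M.support.min'_mem hne
  have hle : Finsupp.single j 1 ≤ M := by
    rw [Finsupp.single_le_iff]
    exact Nat.one_le_iff_ne_zero.2 (Finsupp.mem_support_iff.1 hjM)
  refine ⟨j, M - Finsupp.single j 1, (add_tsub_cancel_of_le hle).symm, fun i hi => ?_, ?_⟩
  · refine M.support.min'_le i ?_
    rw [Finsupp.mem_support_iff] at hi ⊢
    intro h0
    exact hi (by simp [h0])
  · conv_lhs => rw [← add_tsub_cancel_of_le hle]
    rw [map_add, Finsupp.degree_single, add_comm]

lemma min'_single_add {j : ι} {T : ι →₀ ℕ} (hT : ∀ i ∈ T.support, j ≤ i)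
    (hne : (Finsupp.single j 1 + T).support.Nonempty) :
    (Finsupp.single j 1 + T).support.min' hne = j := by
  have hmem : j ∈ (Finsupp.single j 1 + T).support := by
    rw [Finsupp.mem_support_iff]; simp
  refine le_antisymm (Finset.min'_le _ _ hmem) ?_
  refine Finset.le_min' _ _ _ fun i hi => ?_
  rcases Finset.mem_union.1 (Finsupp.support_add hi) with h | h
  · have := Finsupp.support_single_subset h
    rw [Finset.mem_singleton] at this
    exact this.ge
  · exact hT i h

lemma actAux_succ {j : ι} {T : ι →₀ ℕ} (hT : ∀ i ∈ T.support, j ≤ i) (z : g) :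
    act x c χ z (X j * monomial T 1) = sym c z * (X j * monomial T 1)
      + (basisMonomials ι K).constr K (actAux x c χ T.degree)
        (act x c χ (trunc x c j z) (monomial T 1) - sym c (trunc x c j z) * monomial T 1) (x j)
      + act x c χ ⁅trunc x c j z, x j⁆ (monomial T 1) := by
  have hd : (Finsupp.single j 1 + T).degree = T.degree + 1 := by
    rw [map_add, Finsupp.degree_single, add_comm]
  rw [← monomial_single_add_one, act_monomial, hd, actAux, dif_neg (by omega)]
  have hne : (Finsupp.single j 1 + T).support.Nonempty :=
    Finsupp.support_nonempty_iff.2 (by intro h; rw [h] at hd; simp at hd)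
  have e1 := min'_single_add hT hne
  simp only [e1, add_tsub_cancel_left]
  simp only [LinearMap.add_apply, LinearMap.sub_apply, LinearMap.comp_apply, act_monomial,
    LinearMap.mulRight_apply, LinearMap.flip_apply, LieAlgebra.ad_apply]
  rw [← lie_skew (x j), map_neg, sub_neg_eq_add]

/-- `z` acts on the symbol level as multiplication by `sym z`. -/
lemma act_sub_mem_D (z : g) {n : ℕ} {w : MvPolynomial ι K} (hw : w ∈ D n) :
    act x c χ z w - sym c z * w ∈ D n := by
  induction n using Nat.strong_induction_on generalizing z w with
  | _ n ih =>
  have : D n ≤ (D n).comap (act x c χ z - LinearMap.mulLeft K (sym c z)) := by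
    refine D_induction _ fun M hM => ?_
    rw [Submodule.mem_comap, LinearMap.sub_apply, LinearMap.mulLeft_apply]
    refine D_mono hM ?_
    by_cases h0 : M = 0
    · subst h0
      rw [show (monomial 0 1 : MvPolynomial ι K) = 1 from rfl, act_one, mul_one,
        add_sub_cancel_left, mem_restrictTotalDegree]
      simp
    obtain ⟨j, T, rfl, hT, hd⟩ := exists_min_add h0
    rw [monomial_single_add_one, actAux_succ x c χ hT, add_assoc, add_sub_cancel_left, hd]
    have ihT : ∀ y : g, act x c χ y (monomial T 1) - sym c y * monomial T 1 ∈ D T.degree :=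
      fun y => ih T.degree (by omega) y (monomial_mem_D le_rfl)
    have key : ∀ y : g, ∀ w ∈ (D T.degree : Submodule K (MvPolynomial ι K)),
        act x c χ y w ∈ D (T.degree + 1) := by
      intro y w hw
      have h1 := D_mono (Nat.le_succ _) (ih T.degree (by omega) y hw)
      have h2 := mul_mem_D (sym_mem_D c y) hw
      rw [add_comm 1] at h2
      simpa using add_mem h1 h2
    refine add_mem ?_ ?_
    · rw [constr_actAux x c χ (ihT _)]
      exact key _ _ (ihT _)
    · exact key _ _ (monomial_mem_D le_rfl)
  simpa using this hw

lemma act_X_mul {j : ι} {T : ι →₀ ℕ} (hT : ∀ i ∈ T.support, j ≤ i) (z : g) :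
    act x c χ z (X j * monomial T 1) = sym c z * (X j * monomial T 1)
      + act x c χ (x j)
        (act x c χ (trunc x c j z) (monomial T 1) - sym c (trunc x c j z) * monomial T 1)
      + act x c χ ⁅trunc x c j z, x j⁆ (monomial T 1) := by
  rw [actAux_succ x c χ hT, constr_actAux]
  exact act_sub_mem_D x c χ _ (monomial_mem_D le_rfl)

section

variable {x c χ} (hx : ∀ i, c (x i) = Finsupp.single i 1) (hχx : ∀ i, χ (x i) = 0)
include hx

lemma c_linearCombination (j : ι) (v : ι →₀ K) (k : ι) :
    c (Finsupp.linearCombination K (fun i => if i ≤ j then x i else 0) v) k =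
      if k ≤ j then v k else 0 := by
  induction v using Finsupp.induction_linear with
  | zero => simp
  | add f g hf hg => rw [map_add, map_add, Finsupp.add_apply, hf, hg]; split_ifs <;> simp
  | single i a =>
    rw [Finsupp.linearCombination_single, map_smul, Finsupp.smul_apply]
    rcases eq_or_ne i k with rfl | hik
    · by_cases h : i ≤ j <;> simp [h, hx]
    · by_cases h : i ≤ j <;> simp [h, hx, hik]

lemma c_trunc (j : ι) (z : g) (i : ι) : c (trunc x c j z) i = if i ≤ j then 0 else c z i := by
  simp only [trunc, LinearMap.sub_apply, LinearMap.id_apply, LinearMap.comp_apply, map_sub,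
    c_linearCombination hx, Finsupp.sub_apply]
  split_ifs <;> simp

lemma trunc_x_of_le {i j : ι} (h : i ≤ j) : trunc x c j (x i) = 0 := by
  simp [trunc, hx, h]

lemma trunc_eq_self {j : ι} {z : g} (h : ∀ i ≤ j, c z i = 0) : trunc x c j z = z := by
  simp only [trunc, LinearMap.sub_apply, LinearMap.id_apply, LinearMap.comp_apply]
  rw [Finsupp.linearCombination_apply, Finsupp.sum, Finset.sum_eq_zero, sub_zero]
  intro i _
  by_cases hi : i ≤ j
  · simp [h i hi]
  · simp [hi]

lemma sym_x (i : ι) : sym c (x i) = X i := by simp [sym, hx]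

include hχx

lemma act_x_monomial {j : ι} {M : ι →₀ ℕ} (h : ∀ i ∈ M.support, j ≤ i) :
    act x c χ (x j) (monomial M 1) = X j * monomial M 1 := by
  by_cases h0 : M = 0
  · subst h0
    rw [show (monomial 0 1 : MvPolynomial ι K) = 1 from rfl, act_one, hχx, sym_x hx]; simp
  obtain ⟨k, T, rfl, hT, hd⟩ := exists_min_add h0
  have hjk : j ≤ k := h k (by rw [Finsupp.mem_support_iff]; simp)
  rw [monomial_single_add_one, act_X_mul x c χ hT, trunc_x_of_le hx hjk, sym_x hx]
  simp

lemma act_x_sym_mul {j : ι} {T : ι →₀ ℕ} (hT : ∀ i ∈ T.support, j ≤ i) {z : g}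
    (hz : ∀ i ≤ j, c z i = 0) :
    act x c χ (x j) (sym c z * monomial T 1) = X j * (sym c z * monomial T 1) := by
  simp only [sym, LinearMap.comp_apply, Finsupp.linearCombination_apply, Finsupp.sum,
    Finset.sum_mul, Finset.mul_sum, map_sum]
  refine Finset.sum_congr rfl fun i hi => ?_
  rw [smul_mul_assoc, map_smul, mul_smul_comm, ← monomial_single_add_one, act_x_monomial hx hχx]
  intro k hk
  rcases Finset.mem_union.1 (Finsupp.support_add hk) with h | h
  · have := Finsupp.support_single_subset h
    rw [Finset.mem_singleton] at this
    subst this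
    by_contra hlt
    exact (Finsupp.mem_support_iff.1 hi) (hz k (le_of_not_ge hlt))
  · exact hT k h

end

end PBW

namespace PBW
open MvPolynomial

variable {K g ι : Type} [Field K] [LieRing g] [LieAlgebra K g] [LinearOrder ι]
variable (x : ι → g) (c : g →ₗ[K] (ι →₀ K)) (χ : g →ₗ[K] K)

/-- The failure of `act` to respect brackets. -/
def defect : g →ₗ[K] g →ₗ[K] MvPolynomial ι K →ₗ[K] MvPolynomial ι K :=
  LinearMap.mk₂ K (fun z y => act x c χ z ∘ₗ act x c χ y - act x c χ y ∘ₗ act x c χ z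
      - act x c χ ⁅z, y⁆)
    (fun z z' y => by
      simp only [map_add, add_lie, LinearMap.add_comp, LinearMap.comp_add]; abel)
    (fun a z y => by
      simp only [map_smul, smul_lie, LinearMap.smul_comp, LinearMap.comp_smul, smul_sub])
    (fun z y y' => by
      simp only [map_add, lie_add, LinearMap.add_comp, LinearMap.comp_add]; abel)
    (fun a z y => by
      simp only [map_smul, lie_smul, LinearMap.smul_comp, LinearMap.comp_smul, smul_sub])

lemma defect_apply (z y : g) (w : MvPolynomial ι K) : defect x c χ z y w =
    act x c χ z (act x c χ y w) - act x c χ y (act x c χ z w) - act x c χ ⁅z, y⁆ w := rfl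

lemma defect_swap (z y : g) (w : MvPolynomial ι K) :
    defect x c χ z y w = - defect x c χ y z w := by
  rw [defect_apply, defect_apply, ← lie_skew z y, map_neg, LinearMap.neg_apply]; abel

variable {x c χ} (hx : ∀ i, c (x i) = Finsupp.single i 1) (hχx : ∀ i, χ (x i) = 0)

include hx in
lemma trunc_add (j : ι) (z : g) :
    z = trunc x c j z + Finsupp.linearCombination K (fun i => if i ≤ j then x i else 0) (c z) := by
  simp [trunc]

include hx in
lemma mem_of_trunc_mem (S : Submodule K g) (j : ι) {z : g} (h1 : trunc x c j z ∈ S)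
    (h2 : ∀ i ≤ j, x i ∈ S) : z ∈ S := by
  rw [trunc_add hx j z]
  refine add_mem h1 ?_
  rw [Finsupp.linearCombination_apply]
  refine Submodule.sum_mem _ fun i _ => Submodule.smul_mem _ _ ?_
  split_ifs with h
  · exact h2 i h
  · exact zero_mem _

include hx in
lemma c_linearCombination_x (v : ι →₀ K) : c (Finsupp.linearCombination K x v) = v := by
  induction v using Finsupp.induction_linear with
  | zero => simp
  | add f g hf hg => rw [map_add, map_add, hf, hg]
  | single i a => rw [Finsupp.linearCombination_single, map_smul, hx]; simp

include hx hχx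

lemma defect_x_of_trunc {j : ι} {T : ι →₀ ℕ} (hT : ∀ i ∈ T.support, j ≤ i) {z : g}
    (hz : ∀ i ≤ j, c z i = 0) : defect x c χ z (x j) (monomial T 1) = 0 := by
  rw [defect_apply, act_x_monomial hx hχx hT, act_X_mul x c χ hT, trunc_eq_self hx hz, map_sub,
    act_x_sym_mul hx hχx hT hz]
  ring

lemma defect_x {j : ι} {T : ι →₀ ℕ} (hT : ∀ i ∈ T.support, j ≤ i) (z : g) :
    defect x c χ z (x j) (monomial T 1) = 0 := by
  let S : Submodule K g := LinearMap.ker ((defect x c χ).flip (x j) |>.flip (monomial T 1))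
  suffices z ∈ S from this
  refine mem_of_trunc_mem hx S j ?_ fun i hi => ?_
  · refine defect_x_of_trunc hx hχx hT fun i hi => ?_
    rw [c_trunc hx, if_pos hi]
  · rcases hi.eq_or_lt with rfl | hlt
    · change defect x c χ (x i) (x i) _ = 0
      simp [defect_apply]
    · change defect x c χ (x i) (x j) _ = 0
      rw [defect_swap, neg_eq_zero]
      refine defect_x_of_trunc hx hχx (fun k hk => hi.trans (hT k hk)) fun k hk => ?_
      rw [hx, Finsupp.single_apply, if_neg]
      rintro rfl
      exact absurd hk (not_le.2 hlt)

variable (hχ : ∀ y y' : g, c y = 0 → c y' = 0 → χ ⁅y, y'⁆ = 0 ∧ c ⁅y, y'⁆ = 0)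
include hχ

lemma defect_one (z y : g) : defect x c χ z y 1 = 0 := by
  have hd : ∀ (z : g) (i : ι), defect x c χ z (x i) 1 = 0 := fun z i =>
    defect_x hx hχx (T := 0) (by simp) z
  have hd' : ∀ (z : g) (i : ι), defect x c χ (x i) z 1 = 0 := fun z i => by
    rw [defect_swap, hd, neg_zero]
  have split : ∀ z : g, ∃ z₀, c z₀ = 0 ∧ z = z₀ + Finsupp.linearCombination K x (c z) := by
    intro z
    refine ⟨z - Finsupp.linearCombination K x (c z), ?_, by simp⟩
    rw [map_sub, sub_eq_zero]
    rw [c_linearCombination_x hx]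
  obtain ⟨z₀, hz₀, hz⟩ := split z
  obtain ⟨y₀, hy₀, hy⟩ := split y
  rw [hz, hy]
  generalize c z = v
  generalize c y = u
  have h1 : ∀ (z : g) (u : ι →₀ K), defect x c χ z (Finsupp.linearCombination K x u) 1 = 0 := by
    intro z u
    rw [Finsupp.linearCombination_apply, Finsupp.sum, map_sum, LinearMap.sum_apply]
    exact Finset.sum_eq_zero fun i _ => by rw [map_smul, LinearMap.smul_apply, hd, smul_zero]
  rw [map_add, LinearMap.add_apply, h1, add_zero, map_add, LinearMap.add_apply,
    LinearMap.add_apply, defect_swap x c χ (Finsupp.linearCombination K x v), h1, neg_zero,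
    add_zero, defect_apply, act_one, act_one, act_one]
  obtain ⟨e1, e2⟩ := hχ z₀ y₀ hz₀ hy₀
  have hb : ∀ (y : g) (a : K), c y = 0 → act x c χ y (C a) = a • C (χ y) := by
    intro y a hy
    rw [C_eq_smul_one, map_smul, act_one]
    simp [sym, hy]
  simp only [sym, LinearMap.comp_apply, hz₀, hy₀, e2, e1, map_zero, zero_add, hb _ _ hz₀, hb _ _ hy₀,
    sub_zero, smul_eq_C_mul]
  ring

lemma defect_eq_zero (z y : g) (w : MvPolynomial ι K) : defect x c χ z y w = 0 := by
  suffices H : ∀ (n : ℕ) (z y : g) (M : ι →₀ ℕ), M.degree = n →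
      defect x c χ z y (monomial M 1) = 0 by
    have : defect x c χ z y = 0 := by
      refine (basisMonomials ι K).ext fun M => ?_
      rw [coe_basisMonomials]
      exact H _ z y M rfl
    rw [this, LinearMap.zero_apply]
  intro n
  induction n using Nat.strong_induction_on with
  | _ n ih =>
  intro z y M hM
  by_cases h0 : M = 0
  · subst h0
    exact defect_one hx hχx hχ z y
  obtain ⟨k, T, rfl, hT, hd⟩ := exists_min_add h0
  have hkM : ∀ i ∈ (Finsupp.single k 1 + T).support, k ≤ i := by
    intro i hi
    rcases Finset.mem_union.1 (Finsupp.support_add hi) with h | h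
    · exact (Finset.mem_singleton.1 (Finsupp.support_single_subset h)).ge
    · exact hT i h
  have hsmall : ∀ (z y : g) (w : MvPolynomial ι K), w ∈ D T.degree → defect x c χ z y w = 0 := by
    intro z y w hw
    have : D T.degree ≤ LinearMap.ker (defect x c χ z y) := by
      refine D_induction _ fun M hM => ?_
      exact ih _ (by omega) z y M rfl
    exact this hw
  -- reduce to `z`, `y` without components along `x i`, `i ≤ k`
  have red : ∀ (z y : g), (∀ i ≤ k, c y i = 0) → defect x c χ z y
      (monomial (Finsupp.single k 1 + T) 1) = 0 := by
    intro z y hy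
    let S : Submodule K g := LinearMap.ker ((defect x c χ).flip y |>.flip
      (monomial (Finsupp.single k 1 + T) 1))
    suffices z ∈ S from this
    refine mem_of_trunc_mem hx S k ?_ fun i hi => ?_
    swap
    · change defect x c χ (x i) y _ = 0
      rw [defect_swap, neg_eq_zero]
      exact defect_x hx hχx (fun j hj => hi.trans (hkM j hj)) y
    have hz : ∀ i ≤ k, c (trunc x c k z) i = 0 := fun i hi => by rw [c_trunc hx, if_pos hi]
    generalize trunc x c k z = z at hz
    change defect x c χ z y _ = 0
    -- the interchange of `z` and `x k` after applying `y`
    have hone : ∀ z y : g, (∀ i ≤ k, c y i = 0) →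
        defect x c χ z (x k) (act x c χ y (monomial T 1)) = 0 := by
      intro z y hy
      have h1 : act x c χ y (monomial T 1) = (act x c χ y (monomial T 1) - sym c y * monomial T 1)
        + sym c y * monomial T 1 := by ring
      rw [h1, map_add, hsmall _ _ _ (act_sub_mem_D x c χ y (monomial_mem_D le_rfl)), zero_add]
      simp only [sym, LinearMap.comp_apply, Finsupp.linearCombination_apply, Finsupp.sum,
        Finset.sum_mul, map_sum]
      refine Finset.sum_eq_zero fun i hi => ?_
      rw [smul_mul_assoc, map_smul, ← monomial_single_add_one, defect_x hx hχx, smul_zero]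
      intro j hj
      rcases Finset.mem_union.1 (Finsupp.support_add hj) with h | h
      · rw [Finset.mem_singleton.1 (Finsupp.support_single_subset h)]
        by_contra hlt
        exact (Finsupp.mem_support_iff.1 hi) (hy i (le_of_not_ge hlt))
      · exact hT j h
    have hT0 : ∀ z y : g, defect x c χ z y (monomial T 1) = 0 := fun z y =>
      hsmall z y _ (monomial_mem_D le_rfl)
    rw [monomial_single_add_one, ← act_x_monomial hx hχx hT]
    have a1 := hone z y hy
    have a2 := hone y z hz
    have a3 := hT0 y (x k)
    have a4 := hT0 z (x k)
    have a5 := hT0 z ⁅y, x k⁆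
    have a6 := hT0 y ⁅z, x k⁆
    have a7 := hT0 z y
    have a8 := hT0 ⁅z, y⁆ (x k)
    simp only [defect_apply, sub_eq_zero] at a1 a2 a3 a4 a5 a6 a7 a8 ⊢
    rw [sub_eq_iff_eq_add] at a1 a2 a3 a4 a5 a6 a8
    have jac : act x c χ ⁅⁅z, y⁆, x k⁆ (monomial T 1) =
      act x c χ ⁅z, ⁅y, x k⁆⁆ (monomial T 1) - act x c χ ⁅y, ⁅z, x k⁆⁆ (monomial T 1) := by
      rw [lie_lie, map_sub, LinearMap.sub_apply]
    rw [a3, a4, map_add, map_add, a1, a2, a5, a6, a8, jac, ← a7, map_sub]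
    abel
  let S : Submodule K g := LinearMap.ker ((defect x c χ z).flip
      (monomial (Finsupp.single k 1 + T) 1))
  suffices y ∈ S from this
  refine mem_of_trunc_mem hx S k ?_ fun i hi => ?_
  · refine red z _ fun i hi => ?_
    rw [c_trunc hx, if_pos hi]
  · exact defect_x hx hχx (fun j hj => hi.trans (hkM j hj)) z

end PBW

namespace PBW
open MvPolynomial
attribute [local instance] LieRing.ofAssociativeRing

variable {K g ι : Type} [Field K] [LieRing g] [LieAlgebra K g] [LinearOrder ι]
variable (x : ι → g) (c : g →ₗ[K] (ι →₀ K)) (χ : g →ₗ[K] K)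

local notation "U" => UniversalEnvelopingAlgebra K g
local notation "ιU" => UniversalEnvelopingAlgebra.ι K (L := g)

/-- The left ideal generated by `y - χ y` for `y ∈ ker c`. -/
def indIdeal : Submodule U U :=
  Submodule.span U {u | ∃ y, c y = 0 ∧ u = ιU y - algebraMap K U (χ y)}

/-- Ordered monomials in the enveloping algebra. -/
def theta : MvPolynomial ι K →ₗ[K] U :=
  (basisMonomials ι K).constr K fun M => ((M.toMultiset.sort (· ≤ ·)).map (fun i => ιU (x i))).prod

lemma theta_monomial (M : ι →₀ ℕ) : theta (K := K) x (monomial M 1) =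
    ((M.toMultiset.sort (· ≤ ·)).map (fun i => ιU (x i))).prod := by
  have := (basisMonomials ι K).constr_basis K
    (fun M => ((M.toMultiset.sort (· ≤ ·)).map (fun i => ιU (x i))).prod) M
  rw [coe_basisMonomials] at this
  exact this

lemma theta_one : theta (K := K) x 1 = 1 := by
  rw [show (1 : MvPolynomial ι K) = monomial 0 1 from rfl, theta_monomial]; simp

lemma theta_X_mul {j : ι} {T : ι →₀ ℕ} (hT : ∀ i ∈ T.support, j ≤ i) :
    theta (K := K) x (X j * monomial T 1) = ιU (x j) * theta x (monomial T 1) := by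
  rw [← monomial_single_add_one, theta_monomial, theta_monomial, map_add,
    Finsupp.toMultiset_single, one_smul, Multiset.singleton_add, Multiset.sort_cons]
  · simp
  · intro i hi
    rw [Finsupp.mem_toMultiset] at hi
    exact hT i hi

lemma theta_X (j : ι) : theta (K := K) x (X j) = ιU (x j) := by
  have := theta_X_mul (K := K) x (j := j) (T := 0) (by simp)
  rwa [show (monomial 0 1 : MvPolynomial ι K) = 1 from rfl, mul_one, theta_one, mul_one] at this

lemma theta_X_mul_sym {j : ι} {T : ι →₀ ℕ} (hT : ∀ i ∈ T.support, j ≤ i) {z : g}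
    (hz : ∀ i ≤ j, c z i = 0) :
    theta (K := K) x (X j * (sym c z * monomial T 1)) =
      ιU (x j) * theta x (sym c z * monomial T 1) := by
  simp only [sym, LinearMap.comp_apply, Finsupp.linearCombination_apply, Finsupp.sum,
    Finset.sum_mul, Finset.mul_sum, map_sum]
  refine Finset.sum_congr rfl fun i hi => ?_
  rw [smul_mul_assoc, map_smul, mul_smul_comm, map_smul, mul_smul_comm,
    ← monomial_single_add_one, theta_X_mul]
  intro k hk
  rcases Finset.mem_union.1 (Finsupp.support_add hk) with h | h
  · have := Finsupp.support_single_subset h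
    rw [Finset.mem_singleton] at this
    subst this
    by_contra hlt
    exact (Finsupp.mem_support_iff.1 hi) (hz k (le_of_not_ge hlt))
  · exact hT k h

variable {x c χ}
variable (hx : ∀ i, c (x i) = Finsupp.single i 1) (hχx : ∀ i, χ (x i) = 0)
variable (hχ : ∀ y y' : g, c y = 0 → c y' = 0 → χ ⁅y, y'⁆ = 0 ∧ c ⁅y, y'⁆ = 0)
include hx hχx

lemma theta_act (z : g) (w : MvPolynomial ι K) :
    theta x (act x c χ z w) - ιU z * theta x w ∈ indIdeal c χ := by
  let Φ : g →ₗ[K] MvPolynomial ι K →ₗ[K] U :=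
    (act x c χ).compr₂ (theta x) - ((LinearMap.mul K U).compl₁₂ (ιU : g →ₗ[K] U) (theta x))
  have hΦ : ∀ z w, Φ z w = theta x (act x c χ z w) - ιU z * theta x w := fun z w => rfl
  let IK : Submodule K U := (indIdeal c χ).restrictScalars K
  have hmul : ∀ (a : U) {b : U}, b ∈ IK → a * b ∈ IK := fun a b hb =>
    (indIdeal c χ).smul_mem a hb
  suffices H : ∀ (n : ℕ) (M : ι →₀ ℕ), M.degree = n → ∀ z, Φ z (monomial M 1) ∈ IK by
    have : (⊤ : Submodule K (MvPolynomial ι K)) ≤ IK.comap (Φ z) := by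
      rw [← (basisMonomials ι K).span_eq, Submodule.span_le]
      rintro _ ⟨M, rfl⟩
      rw [coe_basisMonomials]
      exact H _ M rfl z
    exact this (Submodule.mem_top (x := w))
  intro n
  induction n using Nat.strong_induction_on with
  | _ n ih =>
  intro M hM z
  by_cases h0 : M = 0
  · subst h0
    rw [hΦ, show (monomial 0 1 : MvPolynomial ι K) = 1 from rfl, act_one, theta_one, mul_one,
      map_add, sym, LinearMap.comp_apply, Finsupp.linearCombination_apply, map_finsuppSum]
    have e1 : ((c z).sum fun i a => theta (K := K) x (a • X i)) =
        ιU (Finsupp.linearCombination K x (c z)) := by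
      rw [Finsupp.linearCombination_apply, map_finsuppSum]
      exact Finsupp.sum_congr fun i _ => by rw [map_smul, theta_X, map_smul]
    rw [e1, C_eq_smul_one, map_smul, theta_one]
    have e2 : ιU (Finsupp.linearCombination K x (c z)) + χ z • (1 : U) - ιU z =
        -(ιU (z - Finsupp.linearCombination K x (c z)) -
          algebraMap K U (χ (z - Finsupp.linearCombination K x (c z)))) := by
      have : χ (Finsupp.linearCombination K x (c z)) = 0 := by
        rw [Finsupp.linearCombination_apply, map_finsuppSum]
        exact Finset.sum_eq_zero fun i _ => by
          change χ (_ • _) = 0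
          rw [map_smul, hχx, smul_zero]
      rw [map_sub, map_sub χ, this, sub_zero, Algebra.algebraMap_eq_smul_one]
      abel
    rw [e2]
    refine neg_mem (Submodule.subset_span ⟨_, ?_, rfl⟩)
    rw [map_sub, c_linearCombination_x hx, sub_self]
  obtain ⟨j, T, rfl, hT, hd⟩ := exists_min_add h0
  have hjM : ∀ i ∈ (Finsupp.single j 1 + T).support, j ≤ i := by
    intro i hi
    rcases Finset.mem_union.1 (Finsupp.support_add hi) with h | h
    · exact (Finset.mem_singleton.1 (Finsupp.support_single_subset h)).ge
    · exact hT i h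
  have hsmall : ∀ (z : g) (w : MvPolynomial ι K), w ∈ D T.degree → Φ z w ∈ IK := by
    intro z w hw
    have : D T.degree ≤ IK.comap (Φ z) :=
      D_induction _ fun M hM => ih _ (by omega) M rfl z
    exact this hw
  suffices z ∈ IK.comap (Φ.flip (monomial (Finsupp.single j 1 + T) 1)) from this
  refine mem_of_trunc_mem hx _ j ?_ fun i hi => ?_
  swap
  · have hiM := fun k hk => hi.trans (hjM k hk)
    change Φ (x i) _ ∈ IK
    rw [hΦ, act_x_monomial hx hχx hiM, theta_X_mul x hiM, sub_self]
    exact zero_mem _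
  have hz : ∀ i ≤ j, c (trunc x c j z) i = 0 := fun i hi => by rw [c_trunc hx, if_pos hi]
  generalize trunc x c j z = z at hz
  change Φ z _ ∈ IK
  have m1 := hsmall (x j) _ (act_sub_mem_D x c χ z (monomial_mem_D (M := T) le_rfl))
  have m2 := hmul (ιU (x j)) (hsmall z _ (monomial_mem_D (M := T) le_rfl))
  have m3 := hsmall ⁅z, x j⁆ _ (monomial_mem_D (M := T) le_rfl)
  have e : Φ z (monomial (Finsupp.single j 1 + T) 1) =
      Φ (x j) (act x c χ z (monomial T 1) - sym c z * monomial T 1)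
      + ιU (x j) * Φ z (monomial T 1) + Φ ⁅z, x j⁆ (monomial T 1) := by
    have e3 : sym c z * (X j * monomial T 1) = X j * (sym c z * monomial T 1) := by ring
    rw [monomial_single_add_one, hΦ, hΦ, hΦ, hΦ, act_X_mul x c χ hT, trunc_eq_self hx hz, map_add,
      map_add, e3, theta_X_mul_sym x c hT hz, theta_X_mul x hT, map_sub (theta x), LieHom.map_lie,
      LieRing.of_associative_ring_bracket]
    noncomm_ring
  rw [e]
  exact add_mem (add_mem m1 m2) m3

include hχ

variable (x c χ) in
omit hx hχx hχ in
/-- The multiplication action on the polynomial model. -/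
def rep (hx : ∀ i, c (x i) = Finsupp.single i 1) (hχx : ∀ i, χ (x i) = 0)
    (hχ : ∀ y y' : g, c y = 0 → c y' = 0 → χ ⁅y, y'⁆ = 0 ∧ c ⁅y, y'⁆ = 0) :
    U →ₐ[K] Module.End K (MvPolynomial ι K) :=
  UniversalEnvelopingAlgebra.lift K
    { act x c χ with
      map_lie' := by
        intro z y
        refine LinearMap.ext fun w => ?_
        have := defect_eq_zero hx hχx hχ z y w
        rw [defect_apply, sub_eq_zero] at this
        exact this.symm }

lemma rep_ι (z : g) : rep x c χ hx hχx hχ (ιU z) = act x c χ z :=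
  UniversalEnvelopingAlgebra.lift_ι_apply _ _ _

omit hx hχx hχ in
lemma mem_of_ι_mem (A : Subalgebra K U) (h : ∀ z, ιU z ∈ A) (u : U) : u ∈ A := by
  let f : g →ₗ⁅K⁆ A :=
    { toFun := fun z => ⟨ιU z, h z⟩
      map_add' := fun a b => Subtype.ext (map_add _ a b)
      map_smul' := fun k a => Subtype.ext (map_smul _ k a)
      map_lie' := fun {a b} => Subtype.ext (LieHom.map_lie _ a b) }
  have : A.val.comp (UniversalEnvelopingAlgebra.lift K f) = AlgHom.id K U := by
    ext z
    simp [f]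
  have h2 := congrArg (fun F => F u) this
  simp only [AlgHom.comp_apply, AlgHom.id_apply] at h2
  rw [← h2]
  exact Subtype.mem _

lemma rep_one_of_mem {u : U} (hu : u ∈ indIdeal c χ) : rep x c χ hx hχx hχ u 1 = 0 := by
  induction hu using Submodule.span_induction with
  | mem u hu =>
    obtain ⟨y, hy, rfl⟩ := hu
    rw [map_sub, LinearMap.sub_apply, rep_ι, act_one, AlgHom.commutes]
    simp [sym, hy, Algebra.algebraMap_eq_smul_one, C_eq_smul_one]
  | zero => simp
  | add a b _ _ ha hb => rw [map_add, LinearMap.add_apply, ha, hb, add_zero]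
  | smul a b _ hb => rw [smul_eq_mul, map_mul, Module.End.mul_apply, hb, map_zero]

lemma theta_rep (u : U) (w : MvPolynomial ι K) :
    theta x (rep x c χ hx hχx hχ u w) - u * theta x w ∈ indIdeal c χ := by
  let A : Subalgebra K U :=
    { carrier := {u | ∀ w, theta x (rep x c χ hx hχx hχ u w) - u * theta x w ∈ indIdeal c χ}
      mul_mem' := by
        intro a b ha hb w
        have h1 := ha (rep x c χ hx hχx hχ b w)
        have h2 := (indIdeal c χ).smul_mem a (hb w)
        rw [smul_eq_mul] at h2
        convert add_mem h1 h2 using 1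
        rw [map_mul, Module.End.mul_apply]
        noncomm_ring
      add_mem' := by
        intro a b ha hb w
        convert add_mem (ha w) (hb w) using 1
        rw [map_add, LinearMap.add_apply, map_add]
        noncomm_ring
      algebraMap_mem' := by
        intro r w
        rw [AlgHom.commutes, Module.algebraMap_end_apply, map_smul, Algebra.smul_def, sub_self]
        exact zero_mem _ }
  refine mem_of_ι_mem A (fun z w => ?_) u w
  rw [rep_ι]
  exact theta_act hx hχx z w

lemma mem_indIdeal_iff {u : U} : u ∈ indIdeal c χ ↔ rep x c χ hx hχx hχ u 1 = 0 := by
  refine ⟨rep_one_of_mem hx hχx hχ, fun h => ?_⟩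
  have := theta_rep hx hχx hχ u 1
  rw [h, theta_one, map_zero, mul_one, zero_sub, neg_mem_iff] at this
  exact this

lemma rep_theta_one (q : MvPolynomial ι K) : rep x c χ hx hχx hχ (theta x q) 1 = q := by
  suffices H : ∀ (n : ℕ) (M : ι →₀ ℕ), M.degree = n →
      rep x c χ hx hχx hχ (theta x (monomial M 1)) 1 = monomial M 1 by
    have : (rep x c χ hx hχx hχ).toLinearMap.flip 1 ∘ₗ theta x = LinearMap.id := by
      refine (basisMonomials ι K).ext fun M => ?_
      rw [coe_basisMonomials]
      exact H _ M rfl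
    exact congrArg (fun F => F q) this
  intro n
  induction n with
  | zero =>
    intro M hM
    rw [Finsupp.degree_eq_zero_iff] at hM
    subst hM
    rw [show (monomial 0 1 : MvPolynomial ι K) = 1 from rfl, theta_one, map_one (rep x c χ hx hχx hχ)]; rfl
  | succ n ih =>
    intro M hM
    have h0 : M ≠ 0 := by rintro rfl; simp at hM
    obtain ⟨j, T, rfl, hT, hd⟩ := exists_min_add h0
    rw [monomial_single_add_one, theta_X_mul x hT, map_mul, Module.End.mul_apply,
      ih T (by omega), rep_ι, act_x_monomial hx hχx hT]

lemma rep_theta_monomial_mem (M : ι →₀ ℕ) {d : ℕ} {w : MvPolynomial ι K} (hw : w ∈ D d) :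
    rep x c χ hx hχx hχ (theta x (monomial M 1)) w - monomial M 1 * w ∈ D (M.degree + d - 1) := by
  obtain ⟨n, hn⟩ : ∃ n, M.degree = n := ⟨_, rfl⟩
  induction n generalizing M with
  | zero =>
    rw [Finsupp.degree_eq_zero_iff] at hn
    subst hn
    rw [show (monomial 0 1 : MvPolynomial ι K) = 1 from rfl, theta_one, map_one]
    simp
  | succ n ih =>
    have h0 : M ≠ 0 := by rintro rfl; simp at hn
    obtain ⟨j, T, rfl, hT, hd⟩ := exists_min_add h0
    have ih := ih T (by omega)
    have hTn : T.degree = n := by omega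
    rw [hTn] at ih
    rw [hn, monomial_single_add_one, theta_X_mul x hT, map_mul, Module.End.mul_apply, rep_ι]
    set r := rep x c χ hx hχx hχ (theta x (monomial T 1)) w with hr
    have hr' : r ∈ D (n + d) := by
      have h1 := mul_mem_D (monomial_mem_D (K := K) (M := T) hTn.le) hw
      have := add_mem h1 (D_mono (Nat.sub_le _ _) ih)
      simpa using this
    have h1 : act x c χ (x j) r - sym c (x j) * r ∈ D (n + d) := act_sub_mem_D x c χ _ hr'
    have h2 : X j * (r - monomial T 1 * w) ∈ D (n + d) := by
      rcases Nat.eq_zero_or_pos (n + d) with h | h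
      · have : n = 0 := by omega
        rw [this, Finsupp.degree_eq_zero_iff] at hTn
        subst hTn
        have : r - monomial 0 1 * w = 0 := by
          rw [hr, show (monomial 0 1 : MvPolynomial ι K) = 1 from rfl, theta_one, map_one]; simp
        rw [this, mul_zero]; exact zero_mem _
      · have := mul_mem_D (sym_mem_D c (x j)) ih
        rw [sym_x hx] at this
        exact D_mono (by omega) this
    rw [sym_x hx] at h1
    have h3 := add_mem h1 h2
    rw [show n + 1 + d - 1 = n + d by omega]
    convert h3 using 1
    ring

lemma rep_theta_mem {e d : ℕ} {q w : MvPolynomial ι K} (hq : q ∈ D e) (hw : w ∈ D d) :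
    rep x c χ hx hχx hχ (theta x q) w - q * w ∈ D (e + d - 1) := by
  have : D e ≤ (D (e + d - 1)).comap
      ((rep x c χ hx hχx hχ).toLinearMap.flip w ∘ₗ theta x - LinearMap.mulRight K w) := by
    refine D_induction _ fun M hM => ?_
    exact D_mono (by omega) (rep_theta_monomial_mem hx hχx hχ M hw)
  exact this hq

lemma rep_theta_mem_D {e d : ℕ} {q w : MvPolynomial ι K} (hq : q ∈ D e) (hw : w ∈ D d) :
    rep x c χ hx hχx hχ (theta x q) w ∈ D (e + d) := by
  have h1 := D_mono (Nat.sub_le _ _) (rep_theta_mem hx hχx hχ hq hw)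
  simpa using add_mem h1 (mul_mem_D hq hw)

lemma eq_zero_of_rep_theta {q w : MvPolynomial ι K} (hw : w ≠ 0)
    (h : rep x c χ hx hχx hχ (theta x q) w = 0) : q = 0 := by
  by_contra hq
  have hqe : q ∈ D q.totalDegree := by rw [mem_restrictTotalDegree]
  have hwd : w ∈ D w.totalDegree := by rw [mem_restrictTotalDegree]
  have := rep_theta_mem hx hχx hχ hqe hwd
  rw [h, zero_sub, neg_mem_iff, mem_restrictTotalDegree, totalDegree_mul_of_isDomain hq hw] at this
  have h0 : q.totalDegree = 0 := by omega
  rw [totalDegree_eq_zero_iff_eq_C] at h0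
  rw [h0, C_eq_smul_one, map_smul, theta_one, map_smul, map_one, LinearMap.smul_apply,
    Module.End.one_apply, smul_eq_zero] at h
  rcases h with h | h
  · rw [h, map_zero] at h0; exact hq h0
  · exact hw h

end PBW

namespace PBW
open MvPolynomial
attribute [local instance] LieRing.ofAssociativeRing

variable {K g ι : Type} [Field K] [LieRing g] [LieAlgebra K g] [LinearOrder ι]
variable {x : ι → g} {c : g →ₗ[K] (ι →₀ K)} {χ : g →ₗ[K] K}

local notation "U" => UniversalEnvelopingAlgebra K g
local notation "ιU" => UniversalEnvelopingAlgebra.ι K (L := g)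

/-- Polynomials in the variables from `J`. -/
abbrev PJ (K : Type) [Field K] (J : Finset ι) : Submodule K (MvPolynomial ι K) :=
  restrictSupport K {M | M.support ⊆ J}

/-- Polynomials of degree at most `n` in the variables from `J`. -/
abbrev PJD (K : Type) [Field K] (J : Finset ι) (n : ℕ) : Submodule K (MvPolynomial ι K) :=
  restrictSupport K {M | M.support ⊆ J ∧ M.degree ≤ n}

lemma PJD_eq (J : Finset ι) (n : ℕ) : PJD K J n = PJ K J ⊓ D n := by
  ext p
  rw [Submodule.mem_inf, mem_restrictTotalDegree, mem_restrictSupport_iff, mem_restrictSupport_iff]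
  constructor
  · intro h
    exact ⟨fun M hM => (h hM).1, Finset.sup_le fun M hM => (h hM).2⟩
  · rintro ⟨h1, h2⟩ M hM
    exact ⟨h1 hM, (le_totalDegree hM).trans h2⟩

lemma PJ_le {J : Finset ι} {S : Submodule K (MvPolynomial ι K)}
    (h : ∀ M : ι →₀ ℕ, M.support ⊆ J → monomial M 1 ∈ S) : PJ K J ≤ S := by
  rw [PJ, restrictSupport_eq_span, Submodule.span_le]
  rintro _ ⟨M, hM, rfl⟩
  exact h M hM

lemma PJD_le {J : Finset ι} {n : ℕ} {S : Submodule K (MvPolynomial ι K)}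
    (h : ∀ M : ι →₀ ℕ, M.support ⊆ J → M.degree ≤ n → monomial M 1 ∈ S) : PJD K J n ≤ S := by
  rw [PJD, restrictSupport_eq_span, Submodule.span_le]
  rintro _ ⟨M, hM, rfl⟩
  exact h M hM.1 hM.2

lemma X_mul_mem_PJ {J : Finset ι} {i : ι} (hi : i ∈ J) {p : MvPolynomial ι K} (hp : p ∈ PJ K J) :
    X i * p ∈ PJ K J := by
  have : PJ K J ≤ (PJ K J).comap (LinearMap.mulLeft K (X i)) := PJ_le fun M hM => by
    rw [Submodule.mem_comap, LinearMap.mulLeft_apply, ← monomial_single_add_one,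
      monomial_mem_restrictSupport]
    left
    intro k hk
    rcases Finset.mem_union.1 (Finsupp.support_add hk) with h | h
    · rwa [Finset.mem_singleton.1 (Finsupp.support_single_subset h)]
    · exact hM h
  exact this hp

lemma sym_mul_mem_PJ {J : Finset ι} {z : g} (hz : ∀ i ∉ J, c z i = 0) {p : MvPolynomial ι K}
    (hp : p ∈ PJ K J) : sym c z * p ∈ PJ K J := by
  simp only [sym, LinearMap.comp_apply, Finsupp.linearCombination_apply, Finsupp.sum,
    Finset.sum_mul]
  refine Submodule.sum_mem _ fun i hi => ?_
  rw [smul_mul_assoc]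
  refine Submodule.smul_mem _ _ (X_mul_mem_PJ ?_ hp)
  by_contra h
  exact (Finsupp.mem_support_iff.1 hi) (hz i h)

variable (hx : ∀ i, c (x i) = Finsupp.single i 1) (hχx : ∀ i, χ (x i) = 0)
variable (hχ : ∀ y y' : g, c y = 0 → c y' = 0 → χ ⁅y, y'⁆ = 0 ∧ c ⁅y, y'⁆ = 0)

section adapted

variable {J : Finset ι} {F : LieSubalgebra K g} (hJ : ∀ i ∈ J, x i ∈ F)
  (hF : ∀ z ∈ F, ∀ i ∉ J, c z i = 0)
include hx hχx hJ hF

lemma act_mem_PJ {z : g} (hz : z ∈ F) {p : MvPolynomial ι K} (hp : p ∈ PJ K J) :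
    act x c χ z p ∈ PJ K J := by
  suffices H : ∀ (n : ℕ) (z : g), z ∈ F → ∀ M : ι →₀ ℕ, M.support ⊆ J → M.degree = n →
      act x c χ z (monomial M 1) ∈ PJ K J by
    have : PJ K J ≤ (PJ K J).comap (act x c χ z) := PJ_le fun M hM => H _ z hz M hM rfl
    exact this hp
  intro n
  induction n using Nat.strong_induction_on with
  | _ n ih =>
  intro z hz M hM hMn
  have h1 : (1 : MvPolynomial ι K) ∈ PJ K J := by
    rw [show (1 : MvPolynomial ι K) = monomial 0 1 from rfl, monomial_mem_restrictSupport]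
    left; simp
  by_cases h0 : M = 0
  · subst h0
    rw [show (monomial 0 1 : MvPolynomial ι K) = 1 from rfl, act_one, C_eq_smul_one]
    refine add_mem ?_ (Submodule.smul_mem _ _ h1)
    simpa using sym_mul_mem_PJ (hF z hz) h1
  obtain ⟨j, T, rfl, hT, hd⟩ := exists_min_add h0
  have hjJ : j ∈ J := hM (by rw [Finsupp.mem_support_iff]; simp)
  have hTJ : T.support ⊆ J := by
    refine fun i hi => hM ?_
    rw [Finsupp.mem_support_iff] at hi ⊢
    simp [hi]
  have hTm : monomial T (1 : K) ∈ PJ K J := by rw [monomial_mem_restrictSupport]; left; exact hTJ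
  have htr : trunc x c j z ∈ F := by
    have : trunc x c j z = z - ∑ i ∈ J, if i ≤ j then c z i • x i else 0 := by
      simp only [trunc, LinearMap.sub_apply, LinearMap.id_apply, LinearMap.comp_apply]
      rw [Finsupp.linearCombination_apply, Finsupp.sum_of_support_subset (s := J)]
      · simp
      · intro i hi
        by_contra h
        exact (Finsupp.mem_support_iff.1 hi) (hF z hz i h)
      · simp
    rw [this]
    refine sub_mem hz (sum_mem fun i hi => ?_)
    split_ifs
    · exact F.smul_mem _ (hJ i hi)
    · exact zero_mem _
  rw [monomial_single_add_one, act_X_mul x c χ hT]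
  have ih' : ∀ z ∈ F, act x c χ z (monomial T 1) ∈ PJ K J := fun z hz =>
    ih _ (by omega) z hz T hTJ rfl
  refine add_mem (add_mem ?_ ?_) ?_
  · exact sym_mul_mem_PJ (hF z hz) (X_mul_mem_PJ hjJ hTm)
  · have hw : act x c χ (trunc x c j z) (monomial T 1) - sym c (trunc x c j z) * monomial T 1 ∈
        PJD K J T.degree := by
      rw [PJD_eq]
      exact ⟨sub_mem (ih' _ htr) (sym_mul_mem_PJ (hF _ htr) hTm),
        act_sub_mem_D x c χ _ (monomial_mem_D le_rfl)⟩
    have : PJD K J T.degree ≤ (PJ K J).comap (act x c χ (x j)) := PJD_le fun M hM hd' =>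
      ih _ (by omega) _ (hJ j hjJ) M hM rfl
    exact this hw
  · exact ih' _ (F.lie_mem htr (hJ j hjJ))

lemma rep_mem_PJ {u : U} (hu : u ∈ Algebra.adjoin K (ιU '' F)) {p : MvPolynomial ι K}
    (hp : p ∈ PJ K J) : rep x c χ hx hχx hχ u p ∈ PJ K J := by
  induction hu using Algebra.adjoin_induction generalizing p with
  | mem u hu =>
    obtain ⟨z, hz, rfl⟩ := hu
    rw [rep_ι]
    exact act_mem_PJ hx hχx hJ hF hz hp
  | algebraMap r =>
    rw [AlgHom.commutes, Module.algebraMap_end_apply]; exact Submodule.smul_mem _ _ hp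
  | add a b _ _ ha hb => rw [map_add]; exact add_mem (ha hp) (hb hp)
  | mul a b _ _ ha hb => rw [map_mul]; exact ha (hb hp)

omit hx hχx hF in
lemma theta_mem_adjoin {q : MvPolynomial ι K} (hq : q ∈ PJ K J) :
    theta x q ∈ Algebra.adjoin K (ιU '' F) := by
  have : PJ K J ≤ (Algebra.adjoin K (ιU '' (F : Set g))).toSubmodule.comap (theta x) := by
    refine PJ_le fun M hM => ?_
    rw [Submodule.mem_comap, theta_monomial]
    refine Subalgebra.list_prod_mem _ fun u hu => ?_
    rw [List.mem_map] at hu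
    obtain ⟨i, hi, rfl⟩ := hu
    rw [Multiset.mem_sort, Finsupp.mem_toMultiset] at hi
    exact Algebra.subset_adjoin ⟨x i, hJ i (hM hi), rfl⟩
  exact this hq

end adapted

lemma finrank_PJD_le (J : Finset ι) (n : ℕ) :
    Module.finrank K (PJD K J n) ≤ (n + 1) ^ J.card ∧ Module.Finite K (PJD K J n) := by
  let f : {M : ι →₀ ℕ | M.support ⊆ J ∧ M.degree ≤ n} → (J → Fin (n + 1)) := fun M i =>
    ⟨M.1 i, Nat.lt_succ_of_le ((Finsupp.le_degree _ _).trans M.2.2)⟩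
  have hf : Function.Injective f := by
    intro M M' h
    refine Subtype.ext (Finsupp.ext fun i => ?_)
    by_cases hi : i ∈ J
    · simpa [f] using congrFun h ⟨i, hi⟩
    · rw [Finsupp.notMem_support_iff.1 fun h => hi (M.2.1 h),
        Finsupp.notMem_support_iff.1 fun h => hi (M'.2.1 h)]
  have : Finite {M : ι →₀ ℕ | M.support ⊆ J ∧ M.degree ≤ n} := Finite.of_injective f hf
  have b := basisRestrictSupport K {M : ι →₀ ℕ | M.support ⊆ J ∧ M.degree ≤ n}
  refine ⟨?_, Module.Finite.of_basis b⟩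
  rw [Module.finrank_eq_nat_card_basis b]
  refine (Nat.card_le_card_of_injective f hf).trans ?_
  simp

lemma exists_pow_lt (k a : ℕ) : ∃ t : ℕ, (t * a + 1) ^ k < 2 ^ t := by
  have h := tendsto_pow_const_div_const_pow_of_one_lt k (one_lt_two (α := ℝ))
  have hpos : (0 : ℝ) < 1 / ((a : ℝ) + 1) ^ k := by positivity
  obtain ⟨t, ht, ht1⟩ := ((h.eventually (gt_mem_nhds hpos)).and
    (Filter.eventually_ge_atTop 1)).exists
  refine ⟨t, ?_⟩
  have h1 : (t * a + 1) ^ k ≤ (t * (a + 1)) ^ k := Nat.pow_le_pow_left (by nlinarith) k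
  refine h1.trans_lt ?_
  rw [div_lt_div_iff₀ (by positivity) (by positivity), one_mul] at ht
  rw [mul_pow]
  exact_mod_cast ht

include hx hχx in
/-- Two nonzero stable subspaces meeting the polynomials in finitely many variables intersect. -/
lemma exists_ne_zero_mem_inf {J : Finset ι} {F : LieSubalgebra K g} (hJ : ∀ i ∈ J, x i ∈ F)
    (hF : ∀ z ∈ F, ∀ i ∉ J, c z i = 0) {N₁ N₂ : Submodule K (MvPolynomial ι K)}
    (h₁ : ∀ u, ∀ p ∈ N₁, rep x c χ hx hχx hχ u p ∈ N₁)
    (h₂ : ∀ u, ∀ p ∈ N₂, rep x c χ hx hχx hχ u p ∈ N₂)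
    {p₁ p₂ : MvPolynomial ι K} (hp₁ : p₁ ∈ N₁) (hp₂ : p₂ ∈ N₂) (hJ₁ : p₁ ∈ PJ K J)
    (hJ₂ : p₂ ∈ PJ K J) (h0₁ : p₁ ≠ 0) (h0₂ : p₂ ≠ 0) : N₁ ⊓ N₂ ≠ ⊥ := by
  intro hN
  set a := max p₁.totalDegree p₂.totalDegree with ha
  have hd : ∀ n, 2 * Module.finrank K (PJD K J n) ≤ Module.finrank K (PJD K J (n + a)) := by
    intro n
    have hmem : ∀ (p : MvPolynomial ι K), p ∈ PJ K J → p.totalDegree ≤ a → ∀ q ∈ PJD K J n,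
        rep x c χ hx hχx hχ (theta x q) p ∈ PJD K J (n + a) := by
      intro p hp hpa q hq
      rw [PJD_eq] at hq ⊢
      refine ⟨rep_mem_PJ hx hχx hχ hJ hF (theta_mem_adjoin hJ hq.1) hp,
        rep_theta_mem_D hx hχx hχ hq.2 ?_⟩
      rwa [mem_restrictTotalDegree]
    let L : MvPolynomial ι K → MvPolynomial ι K →ₗ[K] MvPolynomial ι K := fun p =>
      (rep x c χ hx hχx hχ).toLinearMap.flip p ∘ₗ theta x
    have e1 := hmem p₁ hJ₁ (le_max_left _ _)
    have e2 := hmem p₂ hJ₂ (le_max_right _ _)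
    let Ψ : (PJD K J n × PJD K J n) →ₗ[K] PJD K J (n + a) :=
      ((L p₁).restrict e1).coprod ((L p₂).restrict e2)
    have hΨ : Function.Injective Ψ := by
      rw [← LinearMap.ker_eq_bot, LinearMap.ker_eq_bot']
      rintro ⟨q₁, q₂⟩ h
      have h : rep x c χ hx hχx hχ (theta x q₁) p₁ + rep x c χ hx hχx hχ (theta x q₂) p₂ = 0 :=
        congrArg Subtype.val h
      have hin : rep x c χ hx hχx hχ (theta x q₁) p₁ ∈ N₁ ⊓ N₂ := by
        refine ⟨h₁ _ _ hp₁, ?_⟩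
        rw [eq_neg_of_add_eq_zero_left h]
        exact neg_mem (h₂ _ _ hp₂)
      rw [hN, Submodule.mem_bot] at hin
      rw [hin, zero_add] at h
      have a1 := eq_zero_of_rep_theta hx hχx hχ h0₁ hin
      have a2 := eq_zero_of_rep_theta hx hχx hχ h0₂ h
      exact Prod.ext (Subtype.ext a1) (Subtype.ext a2)
    have f1 := (finrank_PJD_le (K := K) J n).2
    have f2 := (finrank_PJD_le (K := K) J (n + a)).2
    have := LinearMap.finrank_le_finrank_of_injective hΨ
    rw [Module.finrank_prod] at this
    omega
  have hpow : ∀ t, 2 ^ t ≤ Module.finrank K (PJD K J (t * a)) := by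
    intro t
    induction t with
    | zero =>
      rw [pow_zero, Nat.one_le_iff_ne_zero]
      have f1 := (finrank_PJD_le (K := K) J (0 * a)).2
      intro h
      rw [Submodule.finrank_eq_zero] at h
      have : (1 : MvPolynomial ι K) ∈ PJD K J (0 * a) := by
        rw [show (1 : MvPolynomial ι K) = monomial 0 1 from rfl, monomial_mem_restrictSupport]
        left; simp
      rw [h, Submodule.mem_bot] at this
      exact one_ne_zero this
    | succ t ih =>
      have := hd (t * a)
      rw [← Nat.succ_mul] at this
      calc 2 ^ (t + 1) = 2 * 2 ^ t := by ring
        _ ≤ _ := (Nat.mul_le_mul_left 2 ih).trans this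
  obtain ⟨t, ht⟩ := exists_pow_lt J.card a
  exact absurd ((hpow t).trans (finrank_PJD_le J (t * a)).1) (not_le.2 ht)

end PBW

namespace PBW
open MvPolynomial
attribute [local instance] LieRing.ofAssociativeRing

variable {K g : Type} [Field K] [LieRing g] [LieAlgebra K g]

local notation "U" => UniversalEnvelopingAlgebra K g
local notation "ιU" => UniversalEnvelopingAlgebra.ι K (L := g)

/-- The left ideal of the enveloping algebra generated by `y - χ y` for `y ∈ b`. -/
def charIdeal (b : LieSubalgebra K g) (χ : g →ₗ[K] K) : Submodule U U :=
  Submodule.span U {u | ∃ y ∈ b, u = ιU y - algebraMap K U (χ y)}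

lemma exists_adapted (b F : LieSubalgebra K g) [FiniteDimensional K F] :
    ∃ (ι : Type) (_ : LinearOrder ι) (x : ι → g) (c : g →ₗ[K] (ι →₀ K)) (J : Finset ι),
      (∀ y, c y = 0 ↔ y ∈ b) ∧ (∀ i, c (x i) = Finsupp.single i 1) ∧ (∀ i ∈ J, x i ∈ F) ∧
      (∀ z ∈ F, ∀ i ∉ J, c z i = 0) := by
  let V := F.toSubmodule.map b.toSubmodule.mkQ
  have : FiniteDimensional K F.toSubmodule := ‹FiniteDimensional K F›
  obtain ⟨W, hW⟩ := V.exists_isCompl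
  let b1 := Module.Free.chooseBasis K V
  let b2 := Module.Free.chooseBasis K W
  let B := (b1.prod b2).map (V.prodEquivOfIsCompl W hW)
  have hlift : ∀ i, ∃ z : g, b.toSubmodule.mkQ z = B i ∧ (i.isLeft → z ∈ F) := by
    rintro (i | i)
    · obtain ⟨z, hz, hz'⟩ := (b1 i).2
      exact ⟨z, by rw [hz']; simp [B], fun _ => hz⟩
    · obtain ⟨z, hz⟩ := b.toSubmodule.mkQ_surjective (B (Sum.inr i))
      exact ⟨z, hz, by simp⟩
  choose x hx hxF using hlift
  classical
  refine ⟨_, linearOrderOfSTO WellOrderingRel, x, B.repr.toLinearMap ∘ₗ b.toSubmodule.mkQ,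
    Finset.univ.map Function.Embedding.inl, fun y => ?_, fun i => ?_, fun i hi => ?_,
    fun z hz i hi => ?_⟩
  · simp
  · simp [hx, -Submodule.mkQ_apply]
  · refine hxF i ?_
    obtain ⟨j, -, rfl⟩ := Finset.mem_map.1 hi
    rfl
  · rcases i with i | i
    · simp at hi
    · have hzV : b.toSubmodule.mkQ z ∈ V := ⟨z, hz, rfl⟩
      have := (V.prodEquivOfIsCompl_symm_apply_left W hW ⟨_, hzV⟩)
      simp only [LinearMap.comp_apply, LinearEquiv.coe_coe, B, Module.Basis.map_repr,
        LinearEquiv.trans_apply]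
      rw [this]
      simp

section

variable {ι : Type} [LinearOrder ι] {x : ι → g} {c : g →ₗ[K] (ι →₀ K)} {b : LieSubalgebra K g}
  {χ : g →ₗ[K] K}

/-- Modify a functional so that it vanishes on the chosen lifts. -/
def adjust (x : ι → g) (c : g →ₗ[K] (ι →₀ K)) (χ : g →ₗ[K] K) : g →ₗ[K] K :=
  χ - χ ∘ₗ Finsupp.linearCombination K x ∘ₗ c

lemma adjust_eq {y : g} (hy : c y = 0) : adjust x c χ y = χ y := by simp [adjust, hy]

lemma adjust_x (hx : ∀ i, c (x i) = Finsupp.single i 1) (i : ι) : adjust x c χ (x i) = 0 := by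
  simp [adjust, hx]

lemma adjust_lie (hc : ∀ y, c y = 0 ↔ y ∈ b) (hχ : ∀ y ∈ b, ∀ y' ∈ b, χ ⁅y, y'⁆ = 0) (y y' : g)
    (hy : c y = 0) (hy' : c y' = 0) : adjust x c χ ⁅y, y'⁆ = 0 ∧ c ⁅y, y'⁆ = 0 := by
  have h : c ⁅y, y'⁆ = 0 := by
    rw [hc] at *
    exact b.lie_mem hy hy'
  refine ⟨?_, h⟩
  rw [adjust_eq h]
  exact hχ _ ((hc _).1 hy) _ ((hc _).1 hy')

lemma charIdeal_eq (hc : ∀ y, c y = 0 ↔ y ∈ b) :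
    charIdeal b χ = indIdeal c (adjust x c χ) := by
  unfold charIdeal indIdeal
  congr 1
  ext u
  constructor
  · rintro ⟨y, hy, rfl⟩
    exact ⟨y, (hc y).2 hy, by rw [adjust_eq ((hc y).2 hy)]⟩
  · rintro ⟨y, hy, rfl⟩
    exact ⟨y, (hc y).1 hy, by rw [adjust_eq hy]⟩

end

/-- Homomorphisms between modules induced from characters are injective. -/
lemma mem_charIdeal_of_mul_mem {b : LieSubalgebra K g} {χ χ' : g →ₗ[K] K}
    (hχ : ∀ y ∈ b, ∀ y' ∈ b, χ ⁅y, y'⁆ = 0) (hχ' : ∀ y ∈ b, ∀ y' ∈ b, χ' ⁅y, y'⁆ = 0)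
    {w : U} (hw : w ∉ charIdeal b χ)
    (hwt : ∀ y ∈ b, ιU y * w - χ' y • w ∈ charIdeal b χ) {u : U}
    (hu : u * w ∈ charIdeal b χ) : u ∈ charIdeal b χ' := by
  have hfin : FiniteDimensional K (⊥ : LieSubalgebra K g) :=
    inferInstanceAs (FiniteDimensional K (⊥ : Submodule K g))
  obtain ⟨ι, _, x, c, -, hc, hx, -, -⟩ := exists_adapted b ⊥
  have a1 := adjust_x (χ := χ) hx
  have a2 := adjust_lie (x := x) hc hχ
  have a1' := adjust_x (χ := χ') hx
  have a2' := adjust_lie (x := x) hc hχ'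
  have key : ∀ v ∈ charIdeal b χ', v * w ∈ charIdeal b χ := by
    intro v hv
    have : charIdeal b χ' ≤ (charIdeal b χ).comap (LinearMap.toSpanSingleton U U w) := by
      rw [charIdeal, Submodule.span_le]
      rintro _ ⟨y, hy, rfl⟩
      have := hwt y hy
      rw [Algebra.smul_def, ← sub_mul] at this
      exact this
    exact this hv
  set q := rep x c _ hx a1' a2' u 1 with hq
  have h1 : u - theta x q ∈ charIdeal b χ' := by
    rw [charIdeal_eq hc, mem_indIdeal_iff hx a1' a2', map_sub, LinearMap.sub_apply,
      rep_theta_one, sub_self]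
  have h2 : theta x q * w ∈ charIdeal b χ := by
    have := sub_mem hu (key _ h1)
    rwa [← sub_mul, sub_sub_cancel] at this
  rw [charIdeal_eq hc, mem_indIdeal_iff hx a1 a2] at h2 hw
  rw [map_mul, Module.End.mul_apply] at h2
  have h3 := eq_zero_of_rep_theta hx a1 a2 hw h2
  rw [charIdeal_eq hc, mem_indIdeal_iff hx a1' a2', ← hq, h3]

lemma exists_mem_adjoin {F : ℕ → LieSubalgebra K g} (hF : Monotone F) (hex : ∀ z, ∃ n, z ∈ F n)
    (u : U) : ∃ n, u ∈ Algebra.adjoin K (ιU '' (F n : Set g)) := by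
  have hm : Monotone fun n => Algebra.adjoin K (ιU '' (F n : Set g)) := fun m n h =>
    Algebra.adjoin_mono (Set.image_mono (hF h))
  have : u ∈ ⨆ n, Algebra.adjoin K (ιU '' (F n : Set g)) := by
    refine mem_of_ι_mem _ (fun z => ?_) u
    obtain ⟨n, hn⟩ := hex z
    exact (le_iSup (fun n => Algebra.adjoin K (ιU '' (F n : Set g))) n)
      (Algebra.subset_adjoin ⟨z, hn, rfl⟩)
  rw [← SetLike.mem_coe, Subalgebra.coe_iSup_of_directed hm.directed_le] at this
  simpa using this

/-- Two nonzero submodules of a module induced from a character intersect, if the Lie algebra is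
exhausted by finite-dimensional subalgebras. -/
lemma inf_ne_bot {F : ℕ → LieSubalgebra K g} (hF : Monotone F) (hex : ∀ z, ∃ n, z ∈ F n)
    (hfd : ∀ n, FiniteDimensional K (F n)) {b : LieSubalgebra K g} {χ : g →ₗ[K] K}
    (hχ : ∀ y ∈ b, ∀ y' ∈ b, χ ⁅y, y'⁆ = 0) {N₁ N₂ : Submodule U (U ⧸ charIdeal b χ)}
    (h₁ : N₁ ≠ ⊥) (h₂ : N₂ ≠ ⊥) : N₁ ⊓ N₂ ≠ ⊥ := by
  obtain ⟨v₁, hv₁, hv₁0⟩ := N₁.ne_bot_iff.1 h₁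
  obtain ⟨v₂, hv₂, hv₂0⟩ := N₂.ne_bot_iff.1 h₂
  obtain ⟨u₁, rfl⟩ := Submodule.Quotient.mk_surjective _ v₁
  obtain ⟨u₂, rfl⟩ := Submodule.Quotient.mk_surjective _ v₂
  obtain ⟨n₁, hn₁⟩ := exists_mem_adjoin hF hex u₁
  obtain ⟨n₂, hn₂⟩ := exists_mem_adjoin hF hex u₂
  have hm : Monotone fun n => Algebra.adjoin K (ιU '' (F n : Set g)) := fun m n h =>
    Algebra.adjoin_mono (Set.image_mono (hF h))
  obtain ⟨n, hn₁, hn₂⟩ : ∃ n, u₁ ∈ Algebra.adjoin K (ιU '' (F n : Set g)) ∧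
      u₂ ∈ Algebra.adjoin K (ιU '' (F n : Set g)) :=
    ⟨max n₁ n₂, hm (le_max_left _ _) hn₁, hm (le_max_right _ _) hn₂⟩
  have := hfd n
  obtain ⟨ι, _, x, c, J, hc, hx, hJ, hFJ⟩ := exists_adapted b (F n)
  have a1 := adjust_x (χ := χ) hx
  have a2 := adjust_lie (x := x) hc hχ
  have hmk : ∀ u : U, (Submodule.Quotient.mk u : U ⧸ charIdeal b χ) = 0 ↔
      rep x c _ hx a1 a2 u 1 = 0 := fun u => by
    rw [Submodule.Quotient.mk_eq_zero, charIdeal_eq hc, mem_indIdeal_iff hx a1 a2]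
  rw [Ne, hmk] at hv₁0 hv₂0
  let ev : U →ₗ[K] MvPolynomial ι K := (rep x c _ hx a1 a2).toLinearMap.flip 1
  let P : Submodule U (U ⧸ charIdeal b χ) → Submodule K (MvPolynomial ι K) := fun N =>
    ((N.comap (charIdeal b χ).mkQ).restrictScalars K).map ev
  have hP : ∀ N : Submodule U (U ⧸ charIdeal b χ), ∀ u, ∀ p ∈ P N,
      rep x c _ hx a1 a2 u p ∈ P N := by
    rintro N u _ ⟨v, hv, rfl⟩
    refine ⟨u * v, ?_, ?_⟩
    · have := Submodule.smul_mem _ u hv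
      exact this
    · simp [ev]
  have hone : (1 : MvPolynomial ι K) ∈ PJ K J := by
    rw [show (1 : MvPolynomial ι K) = monomial 0 1 from rfl, monomial_mem_restrictSupport]
    left; simp
  have hne := exists_ne_zero_mem_inf hx a1 a2 hJ hFJ (hP N₁) (hP N₂) ⟨u₁, hv₁, rfl⟩ ⟨u₂, hv₂, rfl⟩
    (rep_mem_PJ hx a1 a2 hJ hFJ hn₁ hone) (rep_mem_PJ hx a1 a2 hJ hFJ hn₂ hone) hv₁0 hv₂0
  obtain ⟨p, ⟨⟨w₁, hw₁, e₁⟩, ⟨w₂, hw₂, e₂⟩⟩, hp⟩ := (Submodule.ne_bot_iff _).1 hne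
  have heq : (Submodule.Quotient.mk w₁ : U ⧸ charIdeal b χ) = Submodule.Quotient.mk w₂ := by
    rw [← sub_eq_zero, ← Submodule.Quotient.mk_sub, hmk, map_sub, LinearMap.sub_apply, sub_eq_zero]
    exact e₁.trans e₂.symm
  rw [Submodule.ne_bot_iff]
  refine ⟨Submodule.Quotient.mk w₁, ⟨hw₁, ?_⟩, ?_⟩
  · rw [heq]; exact hw₂
  · rw [Ne, hmk]
    intro h
    exact hp (e₁.symm.trans h)

end PBW

namespace Str

section Sl2
variable {K M : Type} [Field K] [CharZero K] [AddCommGroup M] [Module K M]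

lemma sl2_h_pow {h f : Module.End K M} (hf : ∀ v, h (f v) = f (h v) - (2 : K) • f v)
    {v : M} {μ : K} (hv : h v = μ • v) (n : ℕ) : h ((f ^ n) v) = (μ - 2 * n) • (f ^ n) v := by
  induction n with
  | zero => simpa using hv
  | succ n ih =>
    rw [pow_succ', Module.End.mul_apply, hf, ih, map_smul, ← sub_smul]
    congr 1
    push_cast
    ring

lemma sl2_e_pow {h e f : Module.End K M} (hef : ∀ v, e (f v) = f (e v) + h v)
    (hf : ∀ v, h (f v) = f (h v) - (2 : K) • f v)
    {v : M} {μ : K} (hv : h v = μ • v) (he : e v = 0) (n : ℕ) :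
    e ((f ^ (n + 1)) v) = ((n + 1) * (μ - n)) • (f ^ n) v := by
  induction n with
  | zero => simp [hef, he, hv]
  | succ n ih =>
    rw [pow_succ', Module.End.mul_apply, hef, ih, sl2_h_pow hf hv, map_smul,
      ← Module.End.mul_apply, ← pow_succ', ← add_smul]
    congr 1
    push_cast
    ring

/-- The weight of a vector killed by `e` in a finite-dimensional representation of `sl₂` is a
natural number `n`, and `f ^ n` does not kill it. -/
lemma sl2_exists_nat [FiniteDimensional K M] {h e f : Module.End K M}
    (hef : ∀ v, e (f v) = f (e v) + h v)
    (hf : ∀ v, h (f v) = f (h v) - (2 : K) • f v)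
    {v : M} {μ : K} (hv : h v = μ • v) (he : e v = 0) (hv0 : v ≠ 0) :
    ∃ n : ℕ, μ = n ∧ (f ^ n) v ≠ 0 := by
  have hex : ∃ n : ℕ, (f ^ n) v = 0 := by
    by_contra! hc
    have hli := Module.End.eigenvectors_linearIndependent' h (fun n : ℕ => μ - 2 * n)
      (fun a b hab => by simpa using hab) (fun n => (f ^ n) v)
      (fun n => ⟨Module.End.mem_eigenspace_iff.2 (sl2_h_pow hf hv n), hc n⟩)
    have := hli.finite
    exact not_finite ℕ
  obtain ⟨n, hn₁, hn₂⟩ := Nat.exists_not_and_succ_of_not_zero_of_exists (p := fun n => (f ^ n) v = 0)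
    (by simpa using hv0) hex
  have := sl2_e_pow hef hf hv he n
  rw [hn₂, map_zero, eq_comm, smul_eq_zero_iff_left hn₁, mul_eq_zero, sub_eq_zero] at this
  exact ⟨n, this.resolve_left (Nat.cast_add_one_ne_zero n), hn₁⟩

end Sl2

section Principal
variable {K L : Type} [Field K] [IsAlgClosed K] [CharZero K] [LieRing L] [LieAlgebra K L]
  [FiniteDimensional K L] [LieAlgebra.IsKilling K L] (H : LieSubalgebra K L) [H.IsCartanSubalgebra]

open LieAlgebra LieAlgebra.IsKilling

lemma exists_principal : ∃ h0 ∈ H, ∃ e f : L, ⁅e, f⁆ = h0 ∧ ⁅h0, e⁆ = (2 : K) • e ∧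
    ⁅h0, f⁆ = -((2 : K) • f) ∧
    (⨆ k : ℤ, (ad K L h0).eigenspace ((2 * k : ℤ) : K) = ⊤) ∧ ∀ y, ⁅h0, y⁆ = 0 → y ∈ H := by
  classical
  obtain ⟨b⟩ := RootPairing.nonempty_base (rootSystem H)
  have key : ∀ α : H.root, ∃ e f : L, ⁅e, f⁆ = (coroot α.1 : L) ∧ e ∈ rootSpace H α.1 ∧
      f ∈ rootSpace H (-α.1 : LieModule.Weight K H L) := by
    intro α
    obtain ⟨h, e, f, ht, he, hf⟩ :=
      exists_isSl2Triple_of_weight_isNonZero (LieSubalgebra.isNonZero_coe_root α)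
    have := IsSl2Triple.h_eq_coroot (LieSubalgebra.isNonZero_coe_root α) ht he hf
    exact ⟨e, f, by rw [ht.lie_e_f, this], he, hf⟩
  choose E Fv hEF hE hF using key
  set ψ : Module.Dual K (Module.Dual K H) := b.toWeightBasis.constr K fun _ => (2 : K) with hψ
  set h0 : H := (Module.evalEquiv K H).symm ψ with hh0
  have hval : ∀ φ : Module.Dual K H, φ h0 = ψ φ := by
    intro φ
    rw [hh0, Module.apply_evalEquiv_symm_apply]
  have hsimple : ∀ i : b.support, (i : H.root).1 h0 = 2 := by
    intro i
    have := hval (b.toWeightBasis i)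
    rw [hψ, Module.Basis.constr_basis] at this
    simpa using this
  have hheight : ∀ α : H.root, α.1 h0 = ((2 * b.height α : ℤ) : K) := by
    intro α
    obtain ⟨c, hc, hc', hα⟩ := b.exists_root_eq_sum_int α
    rw [b.height_eq_sum hα]
    have h1 := congrArg (fun φ : Module.Dual K H => φ h0) hα
    simp only [rootSystem_root_apply, LinearMap.sum_apply, LinearMap.smul_apply] at h1
    have h2 : α.1 h0 = ∑ j ∈ b.support, c j • (j.1 h0) := by simpa using h1
    rw [h2]
    push_cast
    rw [Finset.mul_sum]
    refine Finset.sum_congr rfl fun j hj => ?_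
    rw [hsimple ⟨j, hj⟩]
    simp [mul_comm]
  set c : b.support → K := fun i => b.toCoweightBasis.repr h0 i with hc
  have hsum : (h0 : L) = ∑ i : b.support, c i • (coroot (i : H.root).1 : L) := by
    have := b.toCoweightBasis.sum_repr h0
    conv_lhs => rw [← this]
    simp [hc]
  have hlieh : ∀ (χ : H → K) (x : L), x ∈ rootSpace H χ → ⁅(h0 : L), x⁆ = χ h0 • x := by
    intro χ x hx
    exact lie_eq_smul_of_mem_rootSpace hx h0
  have hspan : (⨆ k : ℤ, (ad K L (h0 : L)).eigenspace ((2 * k : ℤ) : K)) = ⊤ := by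
    rw [eq_top_iff, ← LieSubmodule.top_toSubmodule (R := K) (L := H) (M := L),
      ← LieModule.iSup_genWeightSpace_eq_top' K H L, LieSubmodule.iSup_toSubmodule]
    refine iSup_le fun χ => ?_
    intro x hx
    have h1 := hlieh χ x hx
    by_cases hχ : χ.IsZero
    · refine Submodule.mem_iSup_of_mem 0 ?_
      rw [Module.End.mem_eigenspace_iff, ad_apply, h1, hχ]
      simp
    · refine Submodule.mem_iSup_of_mem (b.height ⟨χ, by simpa using hχ⟩) ?_
      rw [Module.End.mem_eigenspace_iff, ad_apply, h1, ← hheight]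
  refine ⟨h0, h0.2, ∑ i : b.support, E i, ∑ i : b.support, c i • Fv i, ?_, ?_, ?_, hspan, ?_⟩
  · have hEFij : ∀ i j : b.support, i ≠ j → ⁅E i, Fv j⁆ = 0 := by
      intro i j hij
      have h1 : ⁅E i, Fv j⁆ ∈ rootSpace H (((i : H.root).1 : H → K) +
          ((-(j : H.root).1 : LieModule.Weight K H L) : H → K)) :=
        lie_mem_genWeightSpace_of_mem_genWeightSpace (hE i) (hF j)
      by_contra hne
      have hbot : LieModule.genWeightSpace L (((i : H.root).1 : H → K) +
          ((-(j : H.root).1 : LieModule.Weight K H L) : H → K)) ≠ ⊥ := by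
        intro h
        rw [LieAlgebra.rootSpace, h] at h1
        exact hne (by simpa using h1)
      set χ : LieModule.Weight K H L := ⟨_, hbot⟩ with hχ
      have hχv : ∀ x : H, χ x = (i : H.root).1 x - (j : H.root).1 x := fun x => by
        simp [hχ, sub_eq_add_neg]
      have hχ0 : χ.IsNonZero := by
        intro h0'
        refine hij (Subtype.ext ?_)
        have := b.linearIndepOn_root
        refine (rootSystem H).root.injective ?_
        ext x
        have := hχv x
        rw [h0'] at this
        simpa using (sub_eq_zero.1 this.symm)
      refine b.sub_notMem_range_root i.2 j.2 ⟨⟨χ, by simpa using hχ0⟩, ?_⟩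
      ext x
      simpa using hχv x
    rw [hsum, sum_lie_sum]
    refine Finset.sum_congr rfl fun i _ => ?_
    rw [Finset.sum_eq_single i]
    · rw [lie_smul, hEF]
    · intro j _ hj
      rw [lie_smul, hEFij i j hj.symm, smul_zero]
    · simp
  · rw [lie_sum, Finset.smul_sum]
    refine Finset.sum_congr rfl fun i _ => ?_
    rw [hlieh _ _ (hE i), hsimple]
  · rw [lie_sum, Finset.smul_sum, ← Finset.sum_neg_distrib]
    refine Finset.sum_congr rfl fun i _ => ?_
    rw [lie_smul, hlieh _ _ (hF i)]
    have h3 : (-(i : H.root).1 : LieModule.Weight K H L) h0 = -(2 : K) := ?_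
    · rw [h3, smul_comm, neg_smul]
    have := hsimple i
    simpa using this
  · intro y hy
    have htop : y ∈ (rootSpace H (0 : H → K)).toSubmodule ⊔
        ⨆ μ : {μ : K // μ ≠ 0}, (ad K L (h0 : L)).eigenspace μ := by
      have : (⊤ : Submodule K L) ≤ (rootSpace H (0 : H → K)).toSubmodule ⊔
        ⨆ μ : {μ : K // μ ≠ 0}, (ad K L (h0 : L)).eigenspace μ := by
        rw [← LieSubmodule.top_toSubmodule (R := K) (L := H) (M := L),
          ← LieModule.iSup_genWeightSpace_eq_top' K H L, LieSubmodule.iSup_toSubmodule]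
        refine iSup_le fun χ => ?_
        by_cases hχ : χ.IsZero
        · refine le_sup_of_le_left ?_
          rw [hχ]
        · refine le_sup_of_le_right fun x hx => ?_
          have h1 := hlieh χ x hx
          have h2 := hheight ⟨χ, by simpa using hχ⟩
          refine Submodule.mem_iSup_of_mem ⟨χ h0, ?_⟩ ?_
          · have h2' : χ h0 = _ := h2
            rw [h2']
            have := b.height_ne_zero ⟨χ, by simpa using hχ⟩
            exact_mod_cast mul_ne_zero two_ne_zero this
          · rw [Module.End.mem_eigenspace_iff, ad_apply, h1]
      exact this trivial
    obtain ⟨y0, hy0, p, hp, rfl⟩ := Submodule.mem_sup.1 htop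
    have hy0H : y0 ∈ H := by
      have h1 := zeroRootSubalgebra_eq_of_is_cartan K L H
      rw [← h1]
      exact hy0
    have hp0 : ⁅(h0 : L), p⁆ = 0 := by
      have : ⁅(h0 : L), y0⁆ = 0 := by
        rw [hlieh _ _ hy0]; simp
      rwa [lie_add, this, zero_add] at hy
    have hdis := (Module.End.eigenspaces_iSupIndep (ad K L (h0 : L))) 0
    have : p = 0 := by
      refine Submodule.disjoint_def.1 hdis p ?_ ?_
      · rw [Module.End.mem_eigenspace_iff, ad_apply, hp0, zero_smul]
      · rwa [iSup_subtype] at hp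
    rw [this, add_zero]
    exact hy0H

end Principal

end Str

namespace Str

section Commuting
variable {K M : Type} [Field K] [IsAlgClosed K] [AddCommGroup M] [Module K M]
  [FiniteDimensional K M]

lemma exists_common_eigenvector (S : Set (Module.End K M)) (hS : ∀ a ∈ S, ∀ b ∈ S, a * b = b * a)
    {W : Submodule K M} (hW : W ≠ ⊥) (hst : ∀ a ∈ S, ∀ w ∈ W, a w ∈ W) :
    ∃ v ∈ W, v ≠ 0 ∧ ∀ a ∈ S, ∃ c : K, a v = c • v := by
  obtain ⟨W', ⟨hW'0, hW'W, hW'S⟩, hmin⟩ := wellFounded_lt.has_min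
    {W' : Submodule K M | W' ≠ ⊥ ∧ W' ≤ W ∧ ∀ a ∈ S, ∀ w ∈ W', a w ∈ W'} ⟨W, hW, le_rfl, hst⟩
  obtain ⟨v, hv, hv0⟩ := Submodule.exists_mem_ne_zero_of_ne_bot hW'0
  refine ⟨v, hW'W hv, hv0, fun a ha => ?_⟩
  have : Nontrivial W' := Submodule.nontrivial_iff_ne_bot.2 hW'0
  obtain ⟨c, hc⟩ := Module.End.exists_eigenvalue (a.restrict (hW'S a ha))
  obtain ⟨u, hu⟩ := hc.exists_hasEigenvector
  have hua : a (u : M) = c • (u : M) := by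
    have := congrArg Subtype.val hu.apply_eq_smul
    simpa using this
  set W'' : Submodule K M := W' ⊓ a.eigenspace c with hW''
  have h1 : W'' = W' := by
    refine le_antisymm inf_le_left ?_
    by_contra hlt
    refine hmin W'' ⟨?_, inf_le_left.trans hW'W, ?_⟩ (lt_of_le_not_ge inf_le_left hlt)
    · intro h
      have : (u : M) ∈ W'' := ⟨u.2, Module.End.mem_eigenspace_iff.2 hua⟩
      rw [h, Submodule.mem_bot] at this
      exact hu.2 (Subtype.ext this)
    · intro b hb w hw
      refine ⟨hW'S b hb w hw.1, Module.End.mem_eigenspace_iff.2 ?_⟩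
      rw [← Module.End.mul_apply, hS a ha b hb, Module.End.mul_apply,
        Module.End.mem_eigenspace_iff.1 hw.2, map_smul]
  have h2 : v ∈ W'' := h1 ▸ hv
  exact ⟨c, Module.End.mem_eigenspace_iff.1 h2.2⟩

end Commuting

section Forms
variable {K M Y : Type} [Field K] [CharZero K] [AddCommGroup M] [Module K M]
  [AddCommGroup Y] [Module K Y] [FiniteDimensional K M]

/-- The operators `a` with `[x, a] = μ a`. -/
def adEig (x : Module.End K M) (μ : K) : Submodule K (Module.End K M) where
  carrier := {a | ∀ v, x (a v) = a (x v) + μ • a v}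
  add_mem' := by
    intro a b ha hb v
    simp only [LinearMap.add_apply, map_add, ha v, hb v, smul_add]
    abel
  zero_mem' := by intro v; simp
  smul_mem' := by
    intro c a ha v
    simp only [LinearMap.smul_apply, map_smul, ha v, smul_add]
    rw [smul_comm]

lemma adEig_apply_mem {x a : Module.End K M} {μ ν : K} (ha : a ∈ adEig x μ) {v : M}
    (hv : v ∈ x.eigenspace ν) : a v ∈ x.eigenspace (ν + μ) := by
  rw [Module.End.mem_eigenspace_iff] at hv ⊢
  rw [ha v, hv, map_smul, add_smul]

lemma adEig_pow {x a : Module.End K M} {μ ν : K} (ha : a ∈ adEig x μ) (v : M) (k : ℕ) :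
    a (((x - algebraMap K _ ν) ^ k) v) = ((x - algebraMap K _ (ν + μ)) ^ k) (a v) := by
  induction k generalizing v with
  | zero => simp
  | succ k ih =>
    rw [pow_succ, Module.End.mul_apply, ih, pow_succ, Module.End.mul_apply]
    congr 1
    simp only [LinearMap.sub_apply, Module.algebraMap_end_apply, map_sub, map_smul, ha v, add_smul]
    abel

variable (B : M →ₗ[K] M →ₗ[K] Y) 

lemma form_genEig_aux {x : Module.End K M} {P : Submodule K M} (hP : ∀ u ∈ P, x u ∈ P)
    (hx : ∀ u ∈ P, ∀ w ∈ P, B (x u) w + B u (x w) = 0) {μ ν : K}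
    (hμν : μ + ν ≠ 0) : ∀ (n : ℕ) (i j : ℕ), i + j ≤ n → ∀ u ∈ P, ∀ w ∈ P,
    (∀ w, B (((x - algebraMap K _ μ) ^ i) u) w = 0) →
    (∀ u, B u (((x - algebraMap K _ ν) ^ j) w) = 0) → B u w = 0 := by
  have hP' : ∀ μ, ∀ u ∈ P, (x - algebraMap K _ μ) u ∈ P := fun μ u hu => by
    simpa using P.sub_mem (hP u hu) (P.smul_mem μ hu)
  intro n
  induction n with
  | zero =>
    intro i j hij u _ w _ hu hw
    obtain rfl : i = 0 := by omega
    exact hu w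
  | succ n ih =>
    intro i j hij u huP w hwP hu hw
    rcases i with _ | i
    · exact hu w
    rcases j with _ | j
    · exact hw u
    have h1 := ih i (j + 1) (by omega) ((x - algebraMap K _ μ) u) (hP' μ u huP) w hwP
      (by simpa only [pow_succ, Module.End.mul_apply] using hu) hw
    have h2 := ih (i + 1) j (by omega) u huP ((x - algebraMap K _ ν) w) (hP' ν w hwP) hu
      (by simpa only [pow_succ, Module.End.mul_apply] using hw)
    have h3 := hx u huP w hwP
    simp only [LinearMap.sub_apply, Module.algebraMap_end_apply, map_sub, map_smul,
      LinearMap.smul_apply] at h1 h2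
    have h4 : (μ + ν) • B u w = 0 := by
      rw [add_smul, ← sub_eq_zero.1 h1, ← sub_eq_zero.1 h2, h3]
    exact (smul_eq_zero.1 h4).resolve_left hμν

lemma form_genEig {x : Module.End K M} (hx : ∀ u w, B (x u) w + B u (x w) = 0) {μ ν : K}
    (hμν : μ + ν ≠ 0) (i j : ℕ) (u w : M)
    (hu : ((x - algebraMap K _ μ) ^ i) u = 0) (hw : ((x - algebraMap K _ ν) ^ j) w = 0) :
    B u w = 0 :=
  form_genEig_aux B (P := ⊤) (fun _ _ => trivial) (fun u _ w _ => hx u w) hμν _ i j le_rfl u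
    trivial w trivial (fun w => by rw [hu]; simp) (fun u => by rw [hw]; simp)

lemma form_eig {x : Module.End K M} (hx : ∀ u w, B (x u) w + B u (x w) = 0) {μ ν : K}
    (hμν : μ + ν ≠ 0) {u w : M} (hu : u ∈ x.eigenspace μ) (hw : w ∈ x.eigenspace ν) :
    B u w = 0 := by
  refine form_genEig B hx hμν 1 1 u w ?_ ?_
  · simpa [sub_eq_zero] using Module.End.mem_eigenspace_iff.1 hu
  · simpa [sub_eq_zero] using Module.End.mem_eigenspace_iff.1 hw

lemma form_pow {p q : Module.End K M} (hpq : ∀ u w, B (p u) w + B u (q w) = 0) (k : ℕ) (u w : M) :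
    B ((p ^ k) u) w = (-1 : K) ^ k • B u ((q ^ k) w) := by
  induction k generalizing w with
  | zero => simp
  | succ k ih =>
    rw [pow_succ', Module.End.mul_apply, eq_neg_of_add_eq_zero_left (hpq _ _), ih, pow_succ q,
      pow_succ, Module.End.mul_apply]
    simp

variable {B}

/-- A semisimple-like criterion: an operator acting diagonalizably on an algebra `A` of operators
preserving a form without `A`-stable isotropic subspaces is diagonalizable. -/
lemma eigenspaces_eq_top_of_form [IsAlgClosed K] {A : Submodule K (Module.End K M)}
    {x : Module.End K M}
    (hA : A ≤ ⨆ μ : K, A ⊓ adEig x μ)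
    (hx : ∀ u w, B (x u) w + B u (x w) = 0)
    (hiso : ∀ W : Submodule K M, (∀ a ∈ A, ∀ w ∈ W, a w ∈ W) → (∀ u ∈ W, ∀ w ∈ W, B u w = 0) →
      W = ⊥) : (⨆ μ, x.eigenspace μ) = ⊤ := by
  classical
  let U : ℕ → Submodule K M := fun k =>
    ⨆ μ, (x.maxGenEigenspace μ).map ((x - algebraMap K _ μ) ^ k)
  have hUst : ∀ k, ∀ a ∈ A, ∀ w ∈ U k, a w ∈ U k := by
    intro k a ha w hw
    have hle : A ≤ { carrier := {a | U k ≤ (U k).comap a}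
                     add_mem' := fun {a b} ha hb w hw => (U k).add_mem (ha hw) (hb hw)
                     zero_mem' := fun w hw => (U k).zero_mem
                     smul_mem' := fun c a ha w hw => (U k).smul_mem c (ha hw) :
                     Submodule K (Module.End K M)} := by
      refine hA.trans (iSup_le fun μ => ?_)
      rintro a ⟨-, ha⟩
      change U k ≤ (U k).comap a
      refine iSup_le fun ν => ?_
      rintro _ ⟨w, hw, rfl⟩
      rw [Submodule.mem_comap, adEig_pow ha]
      refine Submodule.mem_iSup_of_mem (ν + μ) ⟨a w, ?_, rfl⟩
      obtain ⟨j, hj⟩ := (Module.End.mem_maxGenEigenspace _ _ _).1 hw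
      refine (Module.End.mem_maxGenEigenspace _ _ _).2 ⟨j, ?_⟩
      have := adEig_pow ha w j (ν := ν)
      rw [← Algebra.algebraMap_eq_smul_one] at hj ⊢
      rw [← this, hj, map_zero]
    exact hle ha hw
  have hle : ∀ (k : ℕ), U k = ⊥ → ∀ μ, ∀ w ∈ x.maxGenEigenspace μ,
      ((x - algebraMap K _ μ) ^ k) w = 0 := by
    intro k hk μ w hw
    have : ((x - algebraMap K _ μ) ^ k) w ∈ U k := Submodule.mem_iSup_of_mem μ ⟨w, hw, rfl⟩
    rwa [hk, Submodule.mem_bot] at this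
  have hUiso : ∀ k j, U j = ⊥ → j ≤ 2 * k → U k = ⊥ := by
    intro k j hj hjk
    refine hiso _ (hUst k) ?_
    intro u hu w hw
    have h1 : U k ≤ (⨅ w : U k, LinearMap.ker (B.flip w)) := by
      refine iSup_le fun μ => le_iInf ?_
      rintro ⟨w, hw⟩
      rintro _ ⟨u, hu, rfl⟩
      rw [LinearMap.mem_ker, LinearMap.flip_apply]
      have h2 : U k ≤ LinearMap.ker (B (((x - algebraMap K _ μ) ^ k) u)) := by
        refine iSup_le fun ν => ?_
        rintro _ ⟨w, hw, rfl⟩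
        rw [LinearMap.mem_ker]
        have hu0 := hle j hj μ u hu
        have hw0 := hle j hj ν w hw
        by_cases hμν : μ + ν = 0
        · obtain rfl : ν = -μ := (neg_eq_of_add_eq_zero_right hμν).symm
          have h3 : ∀ u w, B ((x - algebraMap K _ μ) u) w + B u ((x - algebraMap K _ (-μ)) w) = 0 := by
            intro u w
            have := hx u w
            have h5 : (x - algebraMap K (Module.End K M) (-μ)) w = x w + μ • w := by simp
            have h6 : (x - algebraMap K (Module.End K M) μ) u = x u - μ • u := by simp
            rw [h5, h6, ← this]
            simp only [map_sub, map_add, map_smul, LinearMap.sub_apply, LinearMap.smul_apply]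
            abel
          rw [form_pow B h3, ← Module.End.mul_apply, ← pow_add, show k + k = (2 * k - j) + j by omega, pow_add,
            Module.End.mul_apply, hw0]
          simp
        · refine form_genEig B hx hμν j j _ _ ?_ ?_
          · rw [← Module.End.mul_apply, ← pow_add, add_comm, pow_add, Module.End.mul_apply, hu0,
              map_zero]
          · rw [← Module.End.mul_apply, ← pow_add, add_comm, pow_add, Module.End.mul_apply, hw0,
              map_zero]
      exact h2 hw
    have h2 := (Submodule.mem_iInf _).1 (h1 hu) ⟨w, hw⟩
    simpa using h2
  have hex : ∃ k, U k = ⊥ := by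
    refine ⟨Module.finrank K M, ?_⟩
    refine eq_bot_iff.2 (iSup_le fun μ => ?_)
    rintro _ ⟨w, hw, rfl⟩
    rw [SetLike.mem_coe, Module.End.maxGenEigenspace_eq_genEigenspace_finrank,
      Module.End.mem_genEigenspace_nat, LinearMap.mem_ker] at hw
    rw [← Algebra.algebraMap_eq_smul_one] at hw
    simpa using hw
  have hU1 : U 1 = ⊥ := by
    have h0 := Nat.find_spec hex
    by_contra h1
    have h2 : 2 ≤ Nat.find hex := by
      by_contra hlt
      have : Nat.find hex ≤ 1 := by omega
      exact h1 (hUiso 1 _ h0 (by omega))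
    exact Nat.find_min hex (m := Nat.find hex - 1) (by omega)
      (hUiso _ _ h0 (by omega))
  rw [eq_top_iff, ← Module.End.iSup_maxGenEigenspace_eq_top x]
  refine iSup_mono fun μ w hw => ?_
  have := hle 1 hU1 μ w hw
  rw [Module.End.mem_eigenspace_iff]
  simpa [sub_eq_zero] using this

lemma comap_stable {A : Submodule K (Module.End K M)} {P Q : Submodule K M} {ι : Type}
    {E : ι → Submodule K (Module.End K M)} (hA : A ≤ ⨆ i, E i)
    (h : ∀ i, ∀ a ∈ E i, ∀ w ∈ P, a w ∈ Q) : ∀ a ∈ A, ∀ w ∈ P, a w ∈ Q := by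
  intro a ha w hw
  have hle : A ≤ { carrier := {a | P ≤ Q.comap a}
                   add_mem' := fun {a b} ha hb w hw => Q.add_mem (ha hw) (hb hw)
                   zero_mem' := fun w hw => Q.zero_mem
                   smul_mem' := fun c a ha w hw => Q.smul_mem c (ha hw) :
                   Submodule K (Module.End K M)} :=
    hA.trans (iSup_le fun i a ha w hw => h i a ha w hw)
  exact hle ha hw

lemma eigenspace_even_eq_bot_of_form [IsAlgClosed K] {A : Submodule K (Module.End K M)}
    {x e f : Module.End K M} (hxA : x ∈ A) (hfA : f ∈ A)
    (hlie : ∀ a ∈ A, ∀ b ∈ A, a * b - b * a ∈ A)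
    (hA : A ≤ ⨆ k : ℤ, A ⊓ adEig x ((2 * k : ℤ) : K))
    (hcomm : ∀ a ∈ A ⊓ adEig x 0, ∀ b ∈ A ⊓ adEig x 0, a * b = b * a)
    (hef : e * f - f * e = x) (he : e ∈ adEig x 2) (hf : f ∈ adEig x (-2))
    (hB : ∀ a ∈ A, ∀ u w, B (a u) w + B u (a w) = 0) (halt : ∀ u w, B u w = - B w u)
    (hiso : ∀ W : Submodule K M, (∀ a ∈ A, ∀ w ∈ W, a w ∈ W) → (∀ u ∈ W, ∀ w ∈ W, B u w = 0) →
      W = ⊥) (k : ℤ) : x.eigenspace ((2 * k : ℤ) : K) = ⊥ := by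
  classical
  by_contra hk
  let E : ℤ → Submodule K M := fun k => x.eigenspace ((2 * k : ℤ) : K)
  have hEmap : ∀ {i j : ℤ} {a v}, a ∈ adEig x ((2 * j : ℤ) : K) → v ∈ E i → a v ∈ E (i + j) := by
    intro i j a v ha hv
    have := adEig_apply_mem ha hv
    rwa [← Int.cast_add, ← mul_add] at this
  have hfin : {k : ℤ | E k ≠ ⊥}.Finite := by
    have h1 : Set.Finite {μ : K | x.eigenspace μ ≠ ⊥} := Module.End.finite_hasEigenvalue x
    refine Set.Finite.of_injOn (f := fun k : ℤ => ((2 * k : ℤ) : K)) (fun k hk => hk) ?_ h1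
    intro a _ b _ hab
    have : (2 * a : ℤ) = 2 * b := Int.cast_injective (α := K) hab
    omega
  obtain ⟨m, hm, hmax⟩ := hfin.exists_maximal ⟨k, hk⟩
  have htop : ∀ j, m < j → E j = ⊥ := by
    intro j hj
    by_contra h
    exact absurd (hmax h hj.le) (not_le.2 hj)
  have hst0 : ∀ a ∈ A ⊓ adEig x 0, ∀ w ∈ E m, a w ∈ E m := by
    intro a ha w hw
    have := hEmap (j := 0) (by simpa using ha.2) hw
    simpa using this
  obtain ⟨v, hv, hv0, hvA⟩ := exists_common_eigenvector (SetLike.coe (A ⊓ adEig x 0)) hcomm hm hst0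
  have hkill : ∀ j : ℤ, 0 < j → ∀ a ∈ adEig x ((2 * j : ℤ) : K), a v = 0 := by
    intro j hj a ha
    have := hEmap ha hv
    rwa [htop _ (by omega), Submodule.mem_bot] at this
  have hxv : x v = ((2 * m : ℤ) : K) • v := Module.End.mem_eigenspace_iff.1 hv
  have hef' : ∀ v, e (f v) = f (e v) + x v := by
    intro v
    rw [← hef]
    simp
  have hf' : ∀ v, x (f v) = f (x v) - (2 : K) • f v := by
    intro v
    rw [hf v, neg_smul, sub_eq_add_neg]
  obtain ⟨n, hn, hfn⟩ := sl2_exists_nat hef' hf' hxv (hkill 1 one_pos e (by simpa using he)) hv0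
  have hn' : 2 * m = n := by exact_mod_cast hn
  let W : Submodule K M := sInf {W | v ∈ W ∧
    ∀ j : ℤ, j ≤ 0 → ∀ a ∈ A ⊓ adEig x ((2 * j : ℤ) : K), ∀ w ∈ W, a w ∈ W}
  have hvW : v ∈ W := Submodule.mem_sInf.2 fun P hP => hP.1
  have hWst : ∀ j : ℤ, j ≤ 0 → ∀ a ∈ A ⊓ adEig x ((2 * j : ℤ) : K), ∀ w ∈ W, a w ∈ W := by
    intro j hj a ha w hw
    exact Submodule.mem_sInf.2 fun P hP => hP.2 j hj a ha w (Submodule.mem_sInf.1 hw P hP)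
  have hWA : ∀ a ∈ A, ∀ w ∈ W, a w ∈ W := by
    let W' : Submodule K M :=
      { carrier := {w | w ∈ W ∧ ∀ a ∈ A, a w ∈ W}
        add_mem' := fun {u w} hu hw => ⟨W.add_mem hu.1 hw.1, fun a ha => by
          rw [map_add]; exact W.add_mem (hu.2 a ha) (hw.2 a ha)⟩
        zero_mem' := ⟨W.zero_mem, fun a _ => by rw [map_zero]; exact W.zero_mem⟩
        smul_mem' := fun c w hw => ⟨W.smul_mem c hw.1, fun a ha => by
          rw [map_smul]; exact W.smul_mem c (hw.2 a ha)⟩ }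
    have hle : W ≤ W' := by
      refine sInf_le ⟨⟨hvW, ?_⟩, ?_⟩
      · intro a ha
        refine comap_stable (P := K ∙ v) (Q := W) hA ?_ a ha v (Submodule.mem_span_singleton_self v)
        intro j a ha w hw
        obtain ⟨c, rfl⟩ := Submodule.mem_span_singleton.1 hw
        rw [map_smul]
        refine W.smul_mem c ?_
        rcases le_or_gt j 0 with hj | hj
        · exact hWst j hj a ha v hvW
        · rw [hkill j hj a ha.2]
          exact W.zero_mem
      · intro j hj b hb w hw
        refine ⟨hWst j hj b hb w hw.1, fun a ha => ?_⟩
        have h1 : a (b w) = b (a w) + (a * b - b * a) w := by simp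
        rw [h1]
        exact W.add_mem (hWst j hj b hb _ (hw.2 a ha)) (hw.2 _ (hlie a ha b hb.1))
    intro a ha w hw
    exact (hle hw).2 a ha
  have hWle : W ≤ (K ∙ v) ⊔ ⨆ i : {i : ℤ // i < m}, E i := by
    refine sInf_le ⟨Submodule.mem_sup_left (Submodule.mem_span_singleton_self v), ?_⟩
    intro j hj a ha
    have h1 : (K ∙ v) ⊔ ⨆ i : {i : ℤ // i < m}, E i ≤
        ((K ∙ v) ⊔ ⨆ i : {i : ℤ // i < m}, E i).comap a := by
      refine sup_le ?_ (iSup_le ?_)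
      · rw [Submodule.span_singleton_le_iff_mem, Submodule.mem_comap]
        rcases hj.lt_or_eq with hj | rfl
        · exact Submodule.mem_sup_right
            (Submodule.mem_iSup_of_mem ⟨m + j, by omega⟩ (hEmap ha.2 hv))
        · obtain ⟨c, hc⟩ := hvA a ⟨ha.1, by simpa using ha.2⟩
          rw [hc]
          exact Submodule.mem_sup_left (Submodule.smul_mem _ _ (Submodule.mem_span_singleton_self v))
      · rintro ⟨i, hi⟩ w hw
        exact Submodule.mem_sup_right
            (Submodule.mem_iSup_of_mem ⟨i + j, by omega⟩ (hEmap ha.2 hw))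
    exact h1
  have hfW : ∀ i : ℕ, (f ^ i) v ∈ W := by
    intro i
    induction i with
    | zero => simpa using hvW
    | succ i ih =>
      rw [pow_succ', Module.End.mul_apply]
      exact hWA f hfA _ ih
  have hfnE : (f ^ n) v ∈ E (-m) := by
    have := sl2_h_pow hf' hxv n
    rw [Module.End.mem_eigenspace_iff, this]
    congr 1
    rw [show (2 * (n : K)) = ((2 * (2 * m) : ℤ) : K) by rw [hn']; push_cast; ring]
    push_cast
    ring
  have hBW : ∀ w ∈ W, B w ((f ^ n) v) = 0 := by
    have : W ≤ LinearMap.ker (B.flip ((f ^ n) v)) := by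
      refine hWle.trans (sup_le ?_ (iSup_le ?_))
      · rw [Submodule.span_singleton_le_iff_mem, LinearMap.mem_ker, LinearMap.flip_apply]
        have h1 := form_pow B (hB f hfA) n v v
        have hne : Even n := ⟨m.toNat, by omega⟩
        rw [hne.neg_one_pow, one_smul, halt] at h1
        have h2 : (2 : K) • B v ((f ^ n) v) = 0 := by
          rw [two_smul]
          nth_rewrite 1 [← h1]
          exact neg_add_cancel _
        exact (smul_eq_zero.1 h2).resolve_left two_ne_zero
      · rintro ⟨i, hi⟩ w hw
        rw [LinearMap.mem_ker, LinearMap.flip_apply]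
        refine form_eig B (hB x hxA) ?_ hw hfnE
        have : 2 * i + 2 * (-m) ≠ 0 := by omega
        exact_mod_cast this
    intro w hw
    simpa using this hw
  have hbot := hiso { carrier := {u | u ∈ W ∧ ∀ w ∈ W, B w u = 0}
                      add_mem' := fun {a b} ha hb => ⟨W.add_mem ha.1 hb.1, fun w hw => by
                        rw [map_add, ha.2 w hw, hb.2 w hw, add_zero]⟩
                      zero_mem' := ⟨W.zero_mem, fun w _ => map_zero _⟩
                      smul_mem' := fun c a ha => ⟨W.smul_mem c ha.1, fun w hw => by
                        rw [map_smul, ha.2 w hw, smul_zero]⟩ } ?_ ?_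
  · have : (f ^ n) v ∈ (⊥ : Submodule K M) := hbot ▸ ⟨hfW n, hBW⟩
    exact hfn (by simpa using this)
  · intro a ha w hw
    refine ⟨hWA a ha w hw.1, fun u hu => ?_⟩
    have := hB a ha u w
    rw [hw.2 _ (hWA a ha u hu), zero_add] at this
    exact this
  · intro u hu w hw
    exact hw.2 u hu.1

end Forms
end Str

namespace Str
attribute [local instance] LieRing.ofAssociativeRing

section Solv
variable {K F : Type} [Field K] [IsAlgClosed K] [CharZero K] [LieRing F] [LieAlgebra K F]

/-- Abelian ideals are central. -/
def Red (K F : Type) [Field K] [LieRing F] [LieAlgebra K F] : Prop :=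
  ∀ J : Submodule K F, (∀ y : F, ∀ u ∈ J, ⁅y, u⁆ ∈ J) → (∀ u ∈ J, ∀ w ∈ J, ⁅u, w⁆ = 0) →
    ∀ u ∈ J, ∀ y : F, ⁅y, u⁆ = 0

lemma red_of_center (h : ∀ I : LieIdeal K F, IsLieAbelian I → I ≤ LieAlgebra.center K F) :
    Red K F := by
  intro J hJ hJ' u hu y
  let I : LieIdeal K F := { J with lie_mem := fun {y u} hu => hJ y u hu }
  have hI : IsLieAbelian I := ⟨fun a b => Subtype.ext (hJ' a a.2 b b.2)⟩
  exact (LieModule.mem_maxTrivSubmodule K F F u).1 (h I hI hu) y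

abbrev Zc (K F : Type) [Field K] [LieRing F] [LieAlgebra K F] : Submodule K F :=
  (LieAlgebra.center K F).toSubmodule

lemma mem_Zc {z : F} : z ∈ Zc K F ↔ ∀ y : F, ⁅y, z⁆ = 0 :=
  LieModule.mem_maxTrivSubmodule K F F z

lemma Zc_lie {z : F} (hz : z ∈ Zc K F) (y : F) : ⁅z, y⁆ = 0 := by
  rw [← lie_skew, mem_Zc.1 hz, neg_zero]

variable [FiniteDimensional K F]

lemma lie_mem_center_aux (hred : Red K F) {I A : Submodule K F}
    (hI : ∀ y : F, ∀ u ∈ I, ⁅y, u⁆ ∈ I) (hA : ∀ y : F, ∀ u ∈ A, ⁅y, u⁆ ∈ A)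
    (hIA : ∀ x ∈ I, ∀ y ∈ I, ⁅x, y⁆ ∈ A)
    (hAspan : ∀ w : F, (∀ x ∈ I, ∀ y ∈ I, ⁅⁅x, y⁆, w⁆ = 0) → ∀ u ∈ A, ⁅u, w⁆ = 0)
    (hAA : ∀ x ∈ A, ∀ y ∈ A, ⁅x, y⁆ ∈ Zc K F) :
    A ≤ Zc K F := by
  classical
  -- nonzero generalized eigenvalues do not occur
  let B : F →ₗ[K] F →ₗ[K] F := (LieAlgebra.ad K F).toLinearMap
  have hBz : ∀ z ∈ Zc K F, ∀ w, B z w = 0 := fun z hz w => Zc_lie hz w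
  have hBz' : ∀ z ∈ Zc K F, ∀ u, B u z = 0 := fun z hz u => mem_Zc.1 hz u
  have hgen : ∀ x ∈ I, ∀ α : K, α ≠ 0 → ∀ u ∈ A, ∀ k : ℕ,
      ((LieAlgebra.ad K F x - algebraMap K _ α) ^ k) u ∈ Zc K F → u ∈ Zc K F := by
    intro x hx α hα
    set p : Module.End K F := LieAlgebra.ad K F x - algebraMap K _ α with hp
    have hpv : ∀ v, p v = ⁅x, v⁆ - α • v := fun v => by simp [hp]
    have hpZ : ∀ z ∈ Zc K F, p z ∈ Zc K F := fun z hz => by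
      rw [hpv, mem_Zc.1 hz, zero_sub]
      exact (Zc K F).neg_mem ((Zc K F).smul_mem _ hz)
    have hpkZ : ∀ (k : ℕ), ∀ z ∈ Zc K F, (p ^ k) z ∈ Zc K F := by
      intro k
      induction k with
      | zero => intro z hz; simpa using hz
      | succ k ih => intro z hz; rw [pow_succ, Module.End.mul_apply]; exact ih _ (hpZ z hz)
    have hpA : ∀ u ∈ A, p u ∈ A := fun u hu => by
      rw [hpv]; exact A.sub_mem (hA x u hu) (A.smul_mem _ hu)
    have hc : ∀ c ∈ I, ∀ k : ℕ, ∀ u ∈ A, (p ^ k) u ∈ Zc K F → (p ^ k) ⁅c, u⁆ ∈ Zc K F := by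
      intro c hcI k
      induction k with
      | zero =>
        intro u hu h
        have h0 : u ∈ Zc K F := by simpa using h
        rw [mem_Zc.1 h0]; simp
      | succ k ih =>
        intro u hu h
        rw [pow_succ, Module.End.mul_apply] at h ⊢
        have h1 : p ⁅c, u⁆ = ⁅c, p u⁆ + ⁅⁅x, c⁆, u⁆ := by
          rw [hpv, hpv, lie_sub, lie_smul, leibniz_lie x c u]; abel
        rw [h1, map_add]
        exact (Zc K F).add_mem (ih _ (hpA u hu) h) (hpkZ _ _ (hAA _ (hIA _ hx _ hcI) _ hu))
    have hb : ∀ y : F, ∀ k : ℕ, ∀ u ∈ A, (p ^ k) u ∈ Zc K F → (p ^ (k + 1)) ⁅y, u⁆ ∈ Zc K F := by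
      intro y k
      induction k with
      | zero =>
        intro u hu h
        have h0 : u ∈ Zc K F := by simpa using h
        rw [mem_Zc.1 h0]; simp
      | succ k ih =>
        intro u hu h
        have h' := h
        rw [pow_succ, Module.End.mul_apply] at h
        rw [pow_succ, Module.End.mul_apply]
        have h1 : p ⁅y, u⁆ = ⁅y, p u⁆ + ⁅⁅x, y⁆, u⁆ := by
          rw [hpv, hpv, lie_sub, lie_smul, leibniz_lie x y u]; abel
        rw [h1, map_add]
        refine (Zc K F).add_mem (ih _ (hpA u hu) h) (hc _ ?_ _ u hu h')
        rw [← lie_skew]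
        exact I.neg_mem (hI _ _ hx)
    let J : Submodule K F :=
      { carrier := {u | u ∈ A ∧ ∃ k : ℕ, (p ^ k) u ∈ Zc K F}
        add_mem' := by
          rintro u w ⟨hu, i, hi⟩ ⟨hw, j, hj⟩
          refine ⟨A.add_mem hu hw, i + j, ?_⟩
          rw [map_add]
          refine (Zc K F).add_mem ?_ ?_
          · rw [add_comm, pow_add, Module.End.mul_apply]; exact hpkZ _ _ hi
          · rw [pow_add, Module.End.mul_apply]; exact hpkZ _ _ hj
        zero_mem' := ⟨A.zero_mem, 0, by simp⟩
        smul_mem' := by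
          rintro c u ⟨hu, i, hi⟩
          exact ⟨A.smul_mem c hu, i, by rw [map_smul]; exact (Zc K F).smul_mem c hi⟩ }
    have := hred J ?_ ?_
    · intro u hu k hk
      exact mem_Zc.2 (this u ⟨hu, k, hk⟩)
    · rintro y u ⟨hu, k, hk⟩
      exact ⟨hA y u hu, k + 1, hb y k u hu hk⟩
    · rintro u ⟨hu, i, hi⟩ w ⟨hw, j, hj⟩
      refine form_genEig_aux B (x := LieAlgebra.ad K F x) (P := A) (hA x) ?_ (μ := α) (ν := α)
        (by rw [← two_mul]; exact mul_ne_zero two_ne_zero hα) _ i j le_rfl u hu w hw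
        (hBz _ hi) (hBz' _ hj)
      intro u hu w hw
      have := mem_Zc.1 (hAA u hu w hw) x
      rw [leibniz_lie] at this
      exact this
  have hnil : ∀ x ∈ I, ∀ u ∈ A, ∃ k : ℕ, (LieAlgebra.ad K F x ^ k) u = 0 := by
    intro x hx u hu
    let xr : Module.End K A := LinearMap.restrict (LieAlgebra.ad K F x) (hA x)
    have hxr : ∀ w : A, ((xr w : A) : F) = ⁅x, (w : F)⁆ := fun _ => rfl
    have htop := Module.End.iSup_maxGenEigenspace_eq_top xr
    have hle : (⊤ : Submodule K A) ≤ xr.maxGenEigenspace 0 := by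
      rw [← htop]
      refine iSup_le fun α => ?_
      by_cases hα : α = 0
      · rw [hα]
      · intro w hw
        obtain ⟨k, hk⟩ := (Module.End.mem_maxGenEigenspace _ _ _).1 hw
        have hk' : ((LieAlgebra.ad K F x - algebraMap K _ α) ^ k) (w : F) = 0 := by
          have h1 : ∀ (k : ℕ) (w : A),
              ((((xr - α • 1) ^ k) w : A) : F) =
              ((LieAlgebra.ad K F x - algebraMap K _ α) ^ k) (w : F) := by
            intro k
            induction k with
            | zero => intro w; simp
            | succ k ih =>
              intro w
              rw [pow_succ, Module.End.mul_apply, ih, pow_succ, Module.End.mul_apply]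
              simp [hxr]
          rw [← h1, hk]; rfl
        have hwZ := hgen x hx α hα w w.2 k (by rw [hk']; exact (Zc K F).zero_mem)
        have h2 : ∀ k : ℕ, ((LieAlgebra.ad K F x - algebraMap K _ α) ^ k) (w : F) =
            (-α) ^ k • (w : F) := by
          intro k
          induction k with
          | zero => simp
          | succ k ih =>
            rw [pow_succ', Module.End.mul_apply, ih]
            simp [mem_Zc.1 hwZ x, pow_succ', mul_smul]
            exact smul_comm _ _ _
        rw [h2] at hk'
        have : (w : F) = 0 :=
          (smul_eq_zero.1 hk').resolve_left (pow_ne_zero _ (neg_ne_zero.2 hα))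
        rw [show w = 0 from Subtype.ext this]
        exact Submodule.zero_mem _
    obtain ⟨k, hk⟩ := (Module.End.mem_maxGenEigenspace _ _ _).1
      (hle (show (⟨u, hu⟩ : A) ∈ ⊤ from trivial))
    refine ⟨k, ?_⟩
    have h1 : ∀ (k : ℕ) (w : A), ((xr ^ k) w : F) =
        (LieAlgebra.ad K F x ^ k) (w : F) := by
      intro k
      induction k with
      | zero => intro w; simp
      | succ k ih =>
        intro w
        rw [pow_succ, Module.End.mul_apply, ih, pow_succ, Module.End.mul_apply]
        simp [hxr]
    rw [zero_smul, sub_zero] at hk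
    have := h1 k ⟨u, hu⟩
    rw [hk] at this
    exact this.symm
  by_contra hAZ
  -- a vector of `A` annihilated by `I` modulo the centre
  obtain ⟨W, ⟨hWA, hWZ, hWI⟩, hmin⟩ := wellFounded_lt.has_min
    {W : Submodule K F | W ≤ A ∧ ¬ W ≤ Zc K F ∧ ∀ x ∈ I, ∀ w ∈ W, ⁅x, w⁆ ∈ W}
    ⟨A, le_rfl, hAZ, fun x _ w hw => hA x w hw⟩
  have hW0 : ∀ x ∈ I, ∀ w ∈ W, ⁅x, w⁆ ∈ Zc K F := by
    intro x hx
    have h1 : W ⊓ (Zc K F).comap (LieAlgebra.ad K F x) = W := by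
      by_contra hne
      refine hmin _ ⟨inf_le_left.trans hWA, ?_, ?_⟩ (lt_of_le_of_ne inf_le_left hne)
      · obtain ⟨w, hw, hwZ⟩ := SetLike.not_le_iff_exists.1 hWZ
        have hex : ∃ k : ℕ, (LieAlgebra.ad K F x ^ k) w ∈ Zc K F := by
          obtain ⟨k, hk⟩ := hnil x hx w (hWA hw)
          exact ⟨k, by rw [hk]; exact (Zc K F).zero_mem⟩
        obtain ⟨n, hn₁, hn₂⟩ := Nat.exists_not_and_succ_of_not_zero_of_exists
          (p := fun k => (LieAlgebra.ad K F x ^ k) w ∈ Zc K F) (by simpa using hwZ) hex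
        intro hle
        refine hn₁ (hle ⟨?_, ?_⟩)
        · have : ∀ k : ℕ, (LieAlgebra.ad K F x ^ k) w ∈ W := by
            intro k
            induction k with
            | zero => simpa using hw
            | succ k ih => rw [pow_succ', Module.End.mul_apply]; exact hWI x hx _ ih
          exact this n
        · rw [pow_succ', Module.End.mul_apply] at hn₂
          exact hn₂
      · rintro y hy w ⟨hw, hwx⟩
        refine ⟨hWI y hy w hw, ?_⟩
        change ⁅x, ⁅y, w⁆⁆ ∈ Zc K F
        have hwx' : ⁅x, w⁆ ∈ Zc K F := hwx
        rw [leibniz_lie, mem_Zc.1 hwx', add_zero]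
        exact hAA _ (hIA _ hx _ hy) _ (hWA hw)
    intro w hw
    rw [← h1] at hw
    exact hw.2
  let J : Submodule K F :=
    { carrier := {u | u ∈ A ∧ ∀ x ∈ I, ⁅x, u⁆ ∈ Zc K F}
      add_mem' := fun {a b} ha hb => ⟨A.add_mem ha.1 hb.1, fun x hx => by
        rw [lie_add]; exact (Zc K F).add_mem (ha.2 x hx) (hb.2 x hx)⟩
      zero_mem' := ⟨A.zero_mem, fun x _ => by rw [lie_zero]; exact (Zc K F).zero_mem⟩
      smul_mem' := fun c a ha => ⟨A.smul_mem c ha.1, fun x hx => by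
        rw [lie_smul]; exact (Zc K F).smul_mem c (ha.2 x hx)⟩ }
  refine hWZ fun w hw => mem_Zc.2 (hred J ?_ ?_ w ⟨hWA hw, fun x hx => hW0 x hx w hw⟩)
  · rintro y u ⟨hu, hux⟩
    refine ⟨hA y u hu, fun x hx => ?_⟩
    rw [leibniz_lie, mem_Zc.1 (hux x hx), add_zero]
    refine hux _ ?_
    rw [← lie_skew]
    exact I.neg_mem (hI y x hx)
  · rintro u ⟨hu, hux⟩ w ⟨hw, hwx⟩
    refine hAspan w ?_ u hu
    intro x hx y hy
    rw [lie_lie, mem_Zc.1 (hwx y hy), mem_Zc.1 (hwx x hx), sub_zero]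

lemma lie_mem_center_of_solvable (hred : Red K F) (k : ℕ) : ∀ I : LieIdeal K F,
    LieAlgebra.derivedSeriesOfIdeal K F k I = ⊥ → ∀ x ∈ I, ∀ y ∈ I, ⁅x, y⁆ ∈ Zc K F := by
  induction k with
  | zero =>
    intro I hI x hx y hy
    rw [LieAlgebra.derivedSeriesOfIdeal_zero] at hI
    rw [hI] at hx
    rw [(LieSubmodule.mem_bot x).1 hx, zero_lie]
    exact (Zc K F).zero_mem
  | succ k ih =>
    intro I hI x hx y hy
    rw [LieAlgebra.derivedSeriesOfIdeal_add, LieAlgebra.derivedSeriesOfIdeal_succ,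
      LieAlgebra.derivedSeriesOfIdeal_zero] at hI
    refine lie_mem_center_aux hred (I := I.toSubmodule) (A := (⁅I, I⁆ : LieIdeal K F).toSubmodule)
      (fun y u hu => I.lie_mem hu) (fun y u hu => (⁅I, I⁆ : LieIdeal K F).lie_mem hu)
      (fun x hx y hy => LieSubmodule.lie_mem_lie hx hy) ?_ (ih _ hI)
      (LieSubmodule.lie_mem_lie hx hy)
    intro w hw u hu
    rw [LieSubmodule.mem_toSubmodule, ← LieSubmodule.mem_toSubmodule,
      LieSubmodule.lieIdeal_oper_eq_linear_span'] at hu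
    induction hu using Submodule.span_induction with
    | mem u hu => obtain ⟨x, hx, y, hy, rfl⟩ := hu; exact hw x hx y hy
    | zero => exact zero_lie _
    | add a b _ _ ha hb => rw [add_lie, ha, hb, add_zero]
    | smul c a _ ha => rw [smul_lie, ha, smul_zero]

lemma radical_lie_mem_center (hred : Red K F) {x y : F} (hx : x ∈ LieAlgebra.radical K F)
    (hy : y ∈ LieAlgebra.radical K F) : ⁅x, y⁆ ∈ Zc K F := by
  have hs : LieAlgebra.IsSolvable (LieAlgebra.radical K F) := inferInstance
  obtain ⟨k, hk⟩ := (LieAlgebra.isSolvable_iff K _).1 hs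
  refine lie_mem_center_of_solvable hred k (LieAlgebra.radical K F) ?_ x hx y hy
  exact (LieIdeal.derivedSeries_eq_bot_iff _ k).1 hk

end Solv
end Str

namespace Str
attribute [local instance] LieRing.ofAssociativeRing

section ModEig
variable {K F : Type} [Field K] [LieRing F] [LieAlgebra K F]

/-- Vectors `y` with `⁅x, y⁆ = μ y` modulo `P`. -/
def modEig (P : Submodule K F) (x : F) (μ : K) : Submodule K F :=
  P.comap (LieAlgebra.ad K F x - algebraMap K _ μ)

lemma mem_modEig {P : Submodule K F} {x y : F} {μ : K} :
    y ∈ modEig P x μ ↔ ⁅x, y⁆ - μ • y ∈ P := by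
  simp [modEig]

lemma mem_of_eigen_of_iSup {V ι : Type} [AddCommGroup V] [Module K V] (T : Module.End K V)
    {A : ι → Submodule K V} {c : ι → K} (hc : Function.Injective c)
    (hA : ∀ i, A i ≤ T.eigenspace (c i)) {i : ι} {a : V} (ha : a ∈ ⨆ i, A i)
    (ha' : a ∈ T.eigenspace (c i)) : a ∈ A i := by
  classical
  have hle : (⨆ i, A i) ≤ A i ⊔ ⨆ (j) (_ : j ≠ i), A j := by
    refine iSup_le fun j => ?_
    by_cases hj : j = i
    · rw [hj]; exact le_sup_left
    · exact (le_iSup₂_of_le (f := fun (j) (_ : j ≠ i) => A j) j hj le_rfl).trans le_sup_right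
  obtain ⟨b, hb, d, hd, rfl⟩ := Submodule.mem_sup.1 (hle ha)
  have h1 := (T.eigenspaces_iSupIndep.comp hc) i
  have hd' : d ∈ T.eigenspace (c i) := by
    have := Submodule.sub_mem _ ha' (hA i hb)
    rwa [add_sub_cancel_left] at this
  have : d = 0 := by
    refine (Submodule.disjoint_def.1 h1) d hd' ?_
    exact (iSup₂_mono fun j _ => hA j) hd
  rw [this, add_zero]; exact hb

end ModEig

section RadMod
variable {K F : Type} [Field K] [LieRing F] [LieAlgebra K F]

/-- The centre as a submodule of the radical. -/
def radZ (K F : Type) [Field K] [LieRing F] [LieAlgebra K F] : LieSubmodule K F (LieAlgebra.radical K F) :=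
  { (Zc K F).comap (LieAlgebra.radical K F).toSubmodule.subtype with
    lie_mem := fun {y z} hz => by
      have hz' : (z : F) ∈ Zc K F := hz
      change ⁅y, (z : F)⁆ ∈ Zc K F
      rw [(LieModule.mem_maxTrivSubmodule K F F _).1 hz' y]
      exact Submodule.zero_mem _ }

lemma mem_radZ {u : LieAlgebra.radical K F} : u ∈ radZ K F ↔ (u : F) ∈ Zc K F := Iff.rfl

abbrev RadMod (K F : Type) [Field K] [LieRing F] [LieAlgebra K F] : Type := LieAlgebra.radical K F ⧸ radZ K F

abbrev rmk (u : LieAlgebra.radical K F) : RadMod K F := LieSubmodule.Quotient.mk u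

lemma rmk_eq_zero {u : LieAlgebra.radical K F} : rmk u = 0 ↔ (u : F) ∈ Zc K F := by
  rw [← mem_radZ]
  exact Submodule.Quotient.mk_eq_zero (radZ K F).toSubmodule

lemma rmk_surj (m : RadMod K F) : ∃ u, rmk u = m := Submodule.Quotient.mk_surjective _ m

abbrev rφ (y : F) : Module.End K (RadMod K F) := LieModule.toEnd K F (RadMod K F) y

lemma rφ_mk (y : F) (u : LieAlgebra.radical K F) : (rφ y : Module.End K (RadMod K F)) (rmk u) = rmk ⁅y, u⁆ := rfl

variable [IsAlgClosed K] [CharZero K] [FiniteDimensional K F]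

lemma rφ_eq_zero (hred : Red K F) {y : F} (hy : y ∈ LieAlgebra.radical K F) :
    (rφ y : Module.End K (RadMod K F)) = 0 := by
  ext m
  obtain ⟨u, rfl⟩ := rmk_surj m
  rw [rφ_mk, LinearMap.zero_apply, rmk_eq_zero]
  exact radical_lie_mem_center hred hy u.2

/-- The form on the radical modulo the centre induced by the bracket. -/
lemma exists_rform : ∃ B : RadMod K F →ₗ[K] RadMod K F →ₗ[K] F,
    ∀ u w : LieAlgebra.radical K F, B (rmk u) (rmk w) = ⁅(u : F), (w : F)⁆ := by
  let B0 : LieAlgebra.radical K F →ₗ[K] LieAlgebra.radical K F →ₗ[K] F :=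
    (LieAlgebra.ad K F).toLinearMap.compl₁₂ (LieAlgebra.radical K F).toSubmodule.subtype
      (LieAlgebra.radical K F).toSubmodule.subtype
  let B1 : RadMod K F →ₗ[K] LieAlgebra.radical K F →ₗ[K] F :=
    (radZ K F).toSubmodule.liftQ B0 (by
      intro z hz
      ext w
      exact Zc_lie (mem_radZ.1 hz) (w : F))
  let B2 : RadMod K F →ₗ[K] RadMod K F →ₗ[K] F :=
    (radZ K F).toSubmodule.liftQ B1.flip (by
      intro z hz
      ext m
      obtain ⟨u, rfl⟩ := rmk_surj m
      exact mem_Zc.1 (mem_radZ.1 hz) (u : F))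
  exact ⟨B2.flip, fun u w => rfl⟩

lemma rform_inv (hred : Red K F) {B : RadMod K F →ₗ[K] RadMod K F →ₗ[K] F}
    (hB : ∀ u w : LieAlgebra.radical K F, B (rmk u) (rmk w) = ⁅(u : F), (w : F)⁆) (y : F)
    (m n : RadMod K F) : B (rφ y m) n + B m (rφ y n) = 0 := by
  obtain ⟨u, rfl⟩ := rmk_surj m
  obtain ⟨w, rfl⟩ := rmk_surj n
  rw [rφ_mk, rφ_mk, hB, hB]
  have := mem_Zc.1 (radical_lie_mem_center hred u.2 w.2) y
  rw [leibniz_lie] at this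
  exact this

lemma rform_iso (hred : Red K F) {B : RadMod K F →ₗ[K] RadMod K F →ₗ[K] F}
    (hB : ∀ u w : LieAlgebra.radical K F, B (rmk u) (rmk w) = ⁅(u : F), (w : F)⁆)
    (W : Submodule K (RadMod K F)) (hW : ∀ y : F, ∀ w ∈ W, rφ y w ∈ W)
    (hiso : ∀ u ∈ W, ∀ w ∈ W, B u w = 0) : W = ⊥ := by
  rw [eq_bot_iff]
  intro m hm
  obtain ⟨u, rfl⟩ := rmk_surj m
  rw [Submodule.mem_bot, rmk_eq_zero, mem_Zc]
  let J : Submodule K F := (W.comap (radZ K F).toSubmodule.mkQ).map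
    (LieAlgebra.radical K F).toSubmodule.subtype
  refine hred J ?_ ?_ u ⟨u, hm, rfl⟩
  · rintro y _ ⟨w, hw, rfl⟩
    exact ⟨(⁅y, (show LieAlgebra.radical K F from w)⁆ : LieAlgebra.radical K F), hW y _ hw, rfl⟩
  · rintro _ ⟨w, hw, rfl⟩ _ ⟨v, hv, rfl⟩
    exact (hB w v).symm.trans (hiso _ hw _ hv)

/-- Operators on the radical modulo centre coming from `F`. -/
def rA (K F : Type) [Field K] [LieRing F] [LieAlgebra K F] :
    Submodule K (Module.End K (RadMod K F)) :=
  LinearMap.range (LieModule.toEnd K F (RadMod K F)).toLinearMap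

lemma rφ_mem_rA (y : F) : (rφ y : Module.End K (RadMod K F)) ∈ rA K F := ⟨y, rfl⟩

lemma rφ_lie (x y : F) : (rφ ⁅x, y⁆ : Module.End K (RadMod K F)) = rφ x * rφ y - rφ y * rφ x :=
  LieHom.map_lie _ x y

lemma rφ_mem_adEig (hred : Red K F) {x y : F} {μ : K}
    (hy : y ∈ modEig (LieAlgebra.radical K F).toSubmodule x μ) :
    (rφ y : Module.End K (RadMod K F)) ∈ adEig (rφ x) μ := by
  intro v
  have h := rφ_eq_zero hred (mem_modEig.1 hy)
  have h1 : (rφ (⁅x, y⁆ - μ • y) : Module.End K (RadMod K F)) =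
      rφ x * rφ y - rφ y * rφ x - μ • rφ y := by
    rw [rφ, map_sub, map_smul, ← rφ, rφ_lie]
  rw [h1] at h
  have := LinearMap.congr_fun h v
  simp only [LinearMap.sub_apply, Module.End.mul_apply, LinearMap.smul_apply,
    LinearMap.zero_apply] at this
  rw [sub_sub, sub_eq_zero] at this
  exact this

lemma rA_le {x : F} {ι : Type} {c : ι → K}
    (hx : (⊤ : Submodule K F) ≤ ⨆ i, modEig (LieAlgebra.radical K F).toSubmodule x (c i)) :
    rA K F ≤ ⨆ i, (modEig (LieAlgebra.radical K F).toSubmodule x (c i)).map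
      (LieModule.toEnd K F (RadMod K F)).toLinearMap := by
  rw [← Submodule.map_iSup, top_le_iff.1 hx, rA, LinearMap.range_eq_map]

/-- Diagonalizability modulo the radical implies diagonalizability of the radical modulo the
centre. -/
lemma radical_le_iSup_modEig (hred : Red K F) {x : F}
    (hx : (⊤ : Submodule K F) ≤ ⨆ μ, modEig (LieAlgebra.radical K F).toSubmodule x μ) :
    (LieAlgebra.radical K F).toSubmodule ≤
      ⨆ μ, (LieAlgebra.radical K F).toSubmodule ⊓ modEig (Zc K F) x μ := by
  obtain ⟨B, hB⟩ := exists_rform (K := K) (F := F)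
  have htop : (⨆ μ, (rφ x : Module.End K (RadMod K F)).eigenspace μ) = ⊤ := by
    refine eigenspaces_eq_top_of_form (B := B) (A := rA K F) ?_ (rform_inv hred hB x) ?_
    · refine (rA_le hx).trans (iSup_mono fun μ => ?_)
      rintro _ ⟨y, hy, rfl⟩
      exact ⟨rφ_mem_rA y, rφ_mem_adEig hred hy⟩
    · exact fun W hW hiso => rform_iso hred hB W (fun y => hW _ (rφ_mem_rA y)) hiso
  intro u hu
  have hm : rmk (⟨u, hu⟩ : LieAlgebra.radical K F) ∈
      ⨆ μ, (rφ x : Module.End K (RadMod K F)).eigenspace μ := by rw [htop]; trivial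
  have key : (⨆ μ, (rφ x : Module.End K (RadMod K F)).eigenspace μ) ≤
      ((⨆ μ, (LieAlgebra.radical K F).toSubmodule ⊓ modEig (Zc K F) x μ).comap
        (LieAlgebra.radical K F).toSubmodule.subtype).map (radZ K F).toSubmodule.mkQ := by
    refine iSup_le fun μ m hm => ?_
    obtain ⟨w, rfl⟩ := rmk_surj m
    refine ⟨w, ?_, rfl⟩
    refine Submodule.mem_iSup_of_mem μ ⟨w.2, mem_modEig.2 ?_⟩
    have h1 := Module.End.mem_eigenspace_iff.1 hm
    rw [rφ_mk, ← sub_eq_zero] at h1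
    exact rmk_eq_zero (u := ⁅x, w⁆ - μ • w).1 h1
  obtain ⟨w, hw, hwu⟩ := key hm
  have h1 : rmk (⟨u, hu⟩ - w) = 0 := by
    change rmk _ - rmk w = 0
    rw [← hwu]; exact sub_self _
  have h2 : u - (w : F) ∈ Zc K F := rmk_eq_zero.1 h1
  have : u = (w : F) + (u - w) := by abel
  rw [this]
  refine Submodule.add_mem _ hw (Submodule.mem_iSup_of_mem 0 ⟨?_, mem_modEig.2 ?_⟩)
  · exact Submodule.sub_mem _ hu w.2
  · rw [zero_smul, sub_zero, mem_Zc.1 h2]; exact Submodule.zero_mem _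

lemma mem_Zc_of_even (hred : Red K F) {h0 e f : F}
    (hef : ⁅e, f⁆ - h0 ∈ LieAlgebra.radical K F)
    (he : ⁅h0, e⁆ - (2 : K) • e ∈ LieAlgebra.radical K F)
    (hf : ⁅h0, f⁆ + (2 : K) • f ∈ LieAlgebra.radical K F)
    (hx : (⊤ : Submodule K F) ≤
      ⨆ k : ℤ, modEig (LieAlgebra.radical K F).toSubmodule h0 ((2 * k : ℤ) : K))
    (hcomm : ∀ y y' : F, ⁅h0, y⁆ ∈ LieAlgebra.radical K F → ⁅h0, y'⁆ ∈ LieAlgebra.radical K F →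
      ⁅y, y'⁆ ∈ LieAlgebra.radical K F) (k : ℤ) {u : F} (hu : u ∈ LieAlgebra.radical K F)
    (huk : u ∈ modEig (Zc K F) h0 ((2 * k : ℤ) : K)) : u ∈ Zc K F := by
  obtain ⟨B, hB⟩ := exists_rform (K := K) (F := F)
  have hinj : Function.Injective fun k : ℤ => ((2 * k : ℤ) : K) := fun i j hij => by
    have : (2 * i : ℤ) = 2 * j := Int.cast_injective (α := K) hij
    omega
  have hcommA : ∀ a ∈ rA K F ⊓ adEig (rφ h0) 0, ∃ y, ⁅h0, y⁆ ∈ LieAlgebra.radical K F ∧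
      rφ y = a := by
    rintro a ⟨ha, ha'⟩
    let T : Module.End K (Module.End K (RadMod K F)) :=
      LinearMap.mulLeft K (rφ h0) - LinearMap.mulRight K (rφ h0)
    have hT : ∀ μ, adEig (rφ h0) μ ≤ T.eigenspace μ := by
      intro μ a ha
      rw [Module.End.mem_eigenspace_iff]
      ext1 v
      simp [T, ha v]
    have := mem_of_eigen_of_iSup T hinj (i := 0) (a := a) (fun i => ?_) (rA_le hx ha) ?_
    · obtain ⟨y, hy, rfl⟩ := this
      refine ⟨y, ?_, rfl⟩
      have := mem_modEig.1 hy
      simpa using this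
    · rintro _ ⟨y, hy, rfl⟩
      exact hT _ (rφ_mem_adEig hred hy)
    · simpa using hT _ ha'
  have hrel : ∀ {a b : F}, a - b ∈ LieAlgebra.radical K F →
      (rφ a : Module.End K (RadMod K F)) = rφ b := by
    intro a b h
    have := rφ_eq_zero hred h
    rw [rφ, map_sub, sub_eq_zero] at this
    exact this
  have hbot := eigenspace_even_eq_bot_of_form (B := B) (A := rA K F) (x := rφ h0) (e := rφ e)
    (f := rφ f) (rφ_mem_rA _) (rφ_mem_rA _) ?_ ?_ ?_ ?_ ?_ ?_ ?_ ?_ ?_ k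
  · have : rmk (⟨u, hu⟩ : LieAlgebra.radical K F) ∈
        (rφ h0 : Module.End K (RadMod K F)).eigenspace ((2 * k : ℤ) : K) := by
      rw [Module.End.mem_eigenspace_iff, rφ_mk, ← sub_eq_zero]
      exact rmk_eq_zero (u := ⁅h0, (⟨u, hu⟩ : LieAlgebra.radical K F)⁆ -
        ((2 * k : ℤ) : K) • ⟨u, hu⟩).2 (mem_modEig.1 huk)
    rw [hbot, Submodule.mem_bot, rmk_eq_zero] at this
    exact this
  · rintro _ ⟨a, rfl⟩ _ ⟨b, rfl⟩
    exact ⟨⁅a, b⁆, rφ_lie a b⟩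
  · refine (rA_le hx).trans (iSup_mono fun μ => ?_)
    rintro _ ⟨y, hy, rfl⟩
    exact ⟨rφ_mem_rA y, rφ_mem_adEig hred hy⟩
  · intro a ha b hb
    obtain ⟨y, hy, rfl⟩ := hcommA a ha
    obtain ⟨y', hy', rfl⟩ := hcommA b hb
    have := rφ_eq_zero hred (hcomm y y' hy hy')
    rw [rφ_lie, sub_eq_zero] at this
    exact this
  · rw [← rφ_lie]; exact hrel hef
  · exact rφ_mem_adEig hred (mem_modEig.2 he)
  · refine rφ_mem_adEig hred (mem_modEig.2 ?_)
    rw [neg_smul, sub_neg_eq_add]; exact hf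
  · rintro _ ⟨y, rfl⟩
    exact rform_inv hred hB y
  · intro m n
    obtain ⟨u, rfl⟩ := rmk_surj m
    obtain ⟨w, rfl⟩ := rmk_surj n
    rw [hB, hB, lie_skew]
  · exact fun W hW hiso => rform_iso hred hB W (fun y => hW _ (rφ_mem_rA y)) hiso

end RadMod
end Str

namespace Str
attribute [local instance] LieRing.ofAssociativeRing

lemma mem_of_iSupIndep {K V ι : Type} [Field K] [AddCommGroup V] [Module K V]
    {A B : ι → Submodule K V} (hB : iSupIndep B) (hA : ∀ i, A i ≤ B i) {i : ι} {a : V}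
    (ha : a ∈ ⨆ i, A i) (ha' : a ∈ B i) : a ∈ A i := by
  classical
  have hle : (⨆ i, A i) ≤ A i ⊔ ⨆ (j) (_ : j ≠ i), A j := by
    refine iSup_le fun j => ?_
    by_cases hj : j = i
    · rw [hj]; exact le_sup_left
    · exact (le_iSup₂_of_le (f := fun (j) (_ : j ≠ i) => A j) j hj le_rfl).trans le_sup_right
  obtain ⟨b, hb, d, hd, rfl⟩ := Submodule.mem_sup.1 (hle ha)
  have hd' : d ∈ B i := by
    have := Submodule.sub_mem _ ha' (hA i hb)
    rwa [add_sub_cancel_left] at this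
  have : d = 0 := by
    refine (Submodule.disjoint_def.1 (hB i)) d hd' ?_
    exact (iSup₂_mono fun j _ => hA j) hd
  rw [this, add_zero]; exact hb

section Quot
variable {K F : Type} [Field K] [CharZero K] [LieRing F] [LieAlgebra K F] [FiniteDimensional K F]
open LieAlgebra

instance quotient_radical_hasTrivialRadical : HasTrivialRadical K (F ⧸ radical K F) := by
  rw [hasTrivialRadical_iff_no_abelian_ideals]
  intro J hJ
  let I : LieIdeal K F :=
    { J.toSubmodule.comap (LieSubmodule.Quotient.mk' (radical K F) : F →ₗ[K] F ⧸ radical K F) with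
      lie_mem := fun {x y} hy => by
        have hy' : (LieSubmodule.Quotient.mk y : F ⧸ radical K F) ∈ J := hy
        change (LieSubmodule.Quotient.mk ⁅x, y⁆ : F ⧸ radical K F) ∈ J
        rw [LieSubmodule.Quotient.mk_bracket]
        exact LieSubmodule.lie_mem J hy' }
  have hI : I ≤ radical K F := by
    rw [← LieIdeal.solvable_iff_le_radical]
    obtain ⟨k, hk⟩ := IsSolvable.solvable K (radical K F)
    rw [LieIdeal.derivedSeries_eq_bot_iff] at hk
    refine IsSolvable.mk (R := K) (k := k + 1) ?_
    rw [LieIdeal.derivedSeries_eq_bot_iff, derivedSeriesOfIdeal_add, eq_bot_iff, ← hk]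
    refine derivedSeriesOfIdeal_mono ?_ k
    rw [derivedSeriesOfIdeal_succ, derivedSeriesOfIdeal_zero, LieSubmodule.lieIdeal_oper_eq_span,
      LieSubmodule.lieSpan_le]
    rintro _ ⟨⟨x, hx⟩, ⟨y, hy⟩, rfl⟩
    rw [SetLike.mem_coe, ← LieSubmodule.Quotient.mk_eq_zero]
    have := congrArg Subtype.val (hJ.trivial ⟨_, hx⟩ ⟨_, hy⟩)
    exact this
  rw [eq_bot_iff]
  intro y hy
  obtain ⟨x, rfl⟩ := LieSubmodule.Quotient.surjective_mk' (radical K F) y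
  rw [LieSubmodule.mem_bot]
  exact (LieSubmodule.Quotient.mk_eq_zero _).2 (hI hy)

end Quot

section Killing
variable {K L : Type} [Field K] [CharZero K] [LieRing L] [LieAlgebra K L] [FiniteDimensional K L]
open LieAlgebra

/-- The centralizer of a set. -/
def centr (T : Set L) : LieSubalgebra K L where
  carrier := {y | ∀ t ∈ T, ⁅t, y⁆ = 0}
  add_mem' := fun ha hb t ht => by rw [lie_add, ha t ht, hb t ht, add_zero]
  zero_mem' := fun t _ => lie_zero t
  smul_mem' := fun c y hy t ht => by rw [lie_smul, hy t ht, smul_zero]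
  lie_mem' := fun {a b} ha hb t ht => by rw [leibniz_lie, ha t ht, hb t ht, zero_lie, lie_zero, add_zero]

lemma exists_cartan_of_diag (T : Set L) (hT : ∀ t ∈ T, ∀ t' ∈ T, ⁅t, t'⁆ = 0)
    (hd : ∀ t ∈ T, ∀ y : L, ⁅t, ⁅t, y⁆⁆ = 0 → ⁅t, y⁆ = 0) :
    ∃ H : LieSubalgebra K L, H.IsCartanSubalgebra ∧ T ⊆ H := by
  let C : LieSubalgebra K L := centr T
  obtain ⟨x, hx⟩ := exists_isCartanSubalgebra_engel K C
  set H' := LieSubalgebra.engel K x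
  let H : LieSubalgebra K L := H'.map C.incl
  have hTH : T ⊆ H := by
    intro t ht
    have h1 : t ∈ C := fun t' ht' => hT t' ht' t ht
    refine ⟨⟨t, h1⟩, ?_, rfl⟩
    change _ ∈ H'
    rw [← hx.self_normalizing, LieSubalgebra.mem_normalizer_iff]
    intro y hy
    have : ⁅(⟨t, h1⟩ : C), y⁆ = 0 := Subtype.ext (y.2 t ht)
    rw [this]; exact zero_mem _
  refine ⟨H, ⟨?_, ?_⟩, hTH⟩
  · have := hx.nilpotent
    exact (LieEquiv.nilpotent_iff_equiv_nilpotent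
      (LieSubalgebra.equivMapOfInjective C.incl H' Subtype.val_injective)).1 this
  · apply le_antisymm
    · intro y hy
      rw [LieSubalgebra.mem_normalizer_iff'] at hy
      have hyC : y ∈ C := by
        intro t ht
        apply hd t ht
        obtain ⟨z, hz, hz'⟩ := hy t (hTH ht)
        rw [← hz']
        exact z.2 t ht
      refine ⟨⟨y, hyC⟩, ?_, rfl⟩
      change _ ∈ H'
      rw [← hx.self_normalizing, LieSubalgebra.mem_normalizer_iff']
      intro z hz
      obtain ⟨w, hw, hw'⟩ := hy z ⟨z, hz, rfl⟩
      have : w = ⁅z, (⟨y, hyC⟩ : C)⁆ := Subtype.ext hw'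
      rw [← this]; exact hw
    · exact LieSubalgebra.le_normalizer H

lemma perfect_of_killing [IsKilling K L] :
    Submodule.span K {z : L | ∃ x y : L, ⁅x, y⁆ = z} = ⊤ := by
  by_contra hne
  obtain ⟨φ, hφ, hφ'⟩ := Submodule.exists_le_ker_of_lt_top _ (lt_top_iff_ne_top.2 hne)
  have hnd := IsKilling.killingForm_nondegenerate K L
  apply hφ
  obtain ⟨z, rfl⟩ := (LinearMap.BilinForm.toDual (killingForm K L) hnd).surjective φ
  have : z = 0 := by
    have hz : z ∈ center K L := by
      rw [LieModule.mem_maxTrivSubmodule]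
      intro y
      refine hnd.1 _ fun w => ?_
      have h2 : ⁅y, w⁆ ∈ LinearMap.ker (LinearMap.BilinForm.toDual (killingForm K L) hnd z) :=
        hφ' (Submodule.subset_span ⟨y, w, rfl⟩)
      rw [LinearMap.mem_ker, LinearMap.BilinForm.toDual_def] at h2
      rw [← lie_skew, LinearMap.map_neg, LinearMap.neg_apply, LieModule.traceForm_apply_lie_apply, h2,
        neg_zero]
    simpa using hz
  rw [this, map_zero]

end Killing
end Str

namespace Str
attribute [local instance] LieRing.ofAssociativeRing

section Diag
variable {K V : Type} [Field K] [AddCommGroup V] [Module K V]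

lemma jointEigenspaces_indep {ι : Type} (f : ι → Module.End K V) (hf : ∀ i j, Commute (f i) (f j)) :
    iSupIndep fun χ : ι → K => ⨅ i, (f i).eigenspace (χ i) := by
  refine (Module.End.independent_iInf_maxGenEigenspace_of_forall_mapsTo f fun i j φ =>
    Module.End.mapsTo_maxGenEigenspace_of_comm (hf j i) φ).mono fun χ => ?_
  exact iInf_mono fun i => (Module.End.genEigenspace (f i) (χ i)).mono le_top

lemma mem_eigenspace_of_diag {T : Module.End K V} (hT : ⊤ ≤ ⨆ μ, T.eigenspace μ) {μ : K} {y : V}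
    (hy : y ∈ T.maxGenEigenspace μ) : y ∈ T.eigenspace μ :=
  mem_of_iSupIndep T.independent_maxGenEigenspace
    (fun μ => (Module.End.genEigenspace T μ).mono le_top) (hT trivial) hy

lemma apply_eq_zero_of_diag {T : Module.End K V} (hT : ⊤ ≤ ⨆ μ, T.eigenspace μ) {y : V}
    (hy : T (T y) = 0) : T y = 0 := by
  have := mem_eigenspace_of_diag hT (μ := 0) (y := y)
    ((Module.End.mem_maxGenEigenspace _ _ _).2 ⟨2, by simpa [pow_two] using hy⟩)
  simpa [Module.End.mem_eigenspace_iff] using this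

lemma iSup_jointEigenspaces [FiniteDimensional K V] {ι : Type} (f : ι → Module.End K V)
    (hf : ∀ i j, Commute (f i) (f j))
    (hd : ∀ i, ⊤ ≤ ⨆ μ, (f i).eigenspace μ) :
    ⊤ ≤ ⨆ χ : ι → K, ⨅ i, (f i).eigenspace (χ i) := by
  have := Module.End.iSup_iInf_maxGenEigenspace_eq_top_of_iSup_maxGenEigenspace_eq_top_of_commute f
    (fun i j _ => hf i j) (fun i => top_le_iff.1 ((hd i).trans
      (iSup_mono fun μ => (Module.End.genEigenspace (f i) μ).mono le_top)))
  rw [← this]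
  exact iSup_mono fun χ => iInf_mono fun i y hy => mem_eigenspace_of_diag (hd i) hy

lemma comap_iSup_le {V' ι : Type} [AddCommGroup V'] [Module K V'] [Nonempty ι] {p : V →ₗ[K] V'}
    (hp : Function.Surjective p) (E : ι → Submodule K V') :
    (⨆ i, E i).comap p ≤ ⨆ i, (E i).comap p := by
  have h1 : (⨆ i, E i) = (⨆ i, (E i).comap p).map p := by
    rw [Submodule.map_iSup]
    exact iSup_congr fun i => (Submodule.map_comap_eq_of_surjective hp _).symm
  rw [h1, Submodule.comap_map_eq, sup_le_iff]
  refine ⟨le_rfl, ?_⟩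
  obtain ⟨i⟩ := ‹Nonempty ι›
  exact le_iSup_of_le i (LinearMap.ker_le_comap _)

end Diag

section ThmA
variable {K F : Type} [Field K] [IsAlgClosed K] [CharZero K] [LieRing F] [LieAlgebra K F]
  [FiniteDimensional K F]
open LieAlgebra

/-- The simultaneous eigenspaces for the adjoint action of a set. -/
def jointWt (K : Type) {F : Type} [Field K] [LieRing F] [LieAlgebra K F] (T : Set F) (χ : T → K) :
    Submodule K F := ⨅ t : T, (ad K F (t : F)).eigenspace (χ t)

lemma mem_jointWt {T : Set F} {χ : T → K} {y : F} : y ∈ jointWt K T χ ↔ ∀ t : T, ⁅(t : F), y⁆ = χ t • y := by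
  simp [jointWt]

/-- The projection to the quotient by the radical. -/
def rquot (K F : Type) [Field K] [LieRing F] [LieAlgebra K F] [FiniteDimensional K F] :
    F →ₗ[K] F ⧸ radical K F := (LieSubmodule.Quotient.mk' (radical K F) : F →ₗ[K] F ⧸ radical K F)

lemma rquot_surj : Function.Surjective (rquot K F) := LieSubmodule.Quotient.surjective_mk' _

lemma rquot_eq_zero {y : F} : rquot K F y = 0 ↔ y ∈ radical K F := LieSubmodule.Quotient.mk_eq_zero _

lemma rquot_lie (x y : F) : rquot K F ⁅x, y⁆ = ⁅rquot K F x, rquot K F y⁆ :=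
  LieSubmodule.Quotient.mk_bracket (radical K F) x y

lemma modEig_radical (x : F) (μ : K) : modEig (radical K F).toSubmodule x μ =
    ((ad K (F ⧸ radical K F) (rquot K F x)).eigenspace μ).comap (rquot K F) := by
  ext y
  rw [mem_modEig, Submodule.mem_comap, Module.End.mem_eigenspace_iff, ad_apply, ← rquot_lie,
    ← sub_eq_zero, ← map_smul, ← map_sub, rquot_eq_zero]
  rfl

lemma exists_lift_zero {T : Set F} (hT : ∀ t ∈ T, ∀ t' ∈ T, ⁅t, t'⁆ = 0)
    (hd : ⊤ ≤ ⨆ χ, jointWt K T χ) {z : F ⧸ radical K F} (hz : ∀ t ∈ T, ⁅rquot K F t, z⁆ = 0) :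
    ∃ y : F, rquot K F y = z ∧ ∀ t ∈ T, ⁅t, y⁆ = 0 := by
  have hind := jointEigenspaces_indep (fun t : T => ad K (F ⧸ radical K F) (rquot K F t)) (by
    intro i j
    rw [commute_iff_lie_eq, ← LieHom.map_lie, ← rquot_lie, hT _ i.2 _ j.2, map_zero, _root_.map_zero])
  have := mem_of_iSupIndep (A := fun χ => (jointWt K T χ).map (rquot K F)) hind (i := 0) (a := z) ?_ ?_ ?_
  · obtain ⟨y, hy, rfl⟩ := this
    refine ⟨y, rfl, fun t ht => ?_⟩
    simpa using mem_jointWt.1 hy ⟨t, ht⟩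
  · rintro χ _ ⟨y, hy, rfl⟩
    rw [Submodule.mem_iInf]
    intro t
    rw [Module.End.mem_eigenspace_iff, ad_apply, ← rquot_lie, mem_jointWt.1 hy t, map_smul]
  · rw [← Submodule.map_iSup, top_le_iff.1 hd, Submodule.map_top, LinearMap.range_eq_top.2 rquot_surj]
    trivial
  · rw [Submodule.mem_iInf]
    intro t
    rw [Module.End.mem_eigenspace_iff, ad_apply, hz _ t.2, Pi.zero_apply, zero_smul]

lemma diag_quot {x : F} (h : ⊤ ≤ ⨆ μ, (ad K F x).eigenspace μ) :
    ⊤ ≤ ⨆ μ, (ad K (F ⧸ radical K F) (rquot K F x)).eigenspace μ := by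
  have h1 : (⊤ : Submodule K F).map (rquot K F) ≤ ⨆ μ, ((ad K F x).eigenspace μ).map (rquot K F) := by
    rw [← Submodule.map_iSup]; exact Submodule.map_mono h
  rw [Submodule.map_top, LinearMap.range_eq_top.2 rquot_surj] at h1
  refine h1.trans (iSup_mono fun μ => ?_)
  rintro _ ⟨y, hy, rfl⟩
  rw [SetLike.mem_coe, Module.End.mem_eigenspace_iff, ad_apply] at hy
  rw [Module.End.mem_eigenspace_iff, ad_apply, ← rquot_lie, hy, map_smul]

lemma diag_of_modEig (hD : ⊤ ≤ Submodule.span K {z : F | ∃ x y : F, ⁅x, y⁆ = z} ⊔ Zc K F) {x : F}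
    (hx : ⊤ ≤ ⨆ μ, modEig (Zc K F) x μ) : ⊤ ≤ ⨆ μ, (ad K F x).eigenspace μ := by
  refine hD.trans (sup_le ?_ ?_)
  · rw [Submodule.span_le]
    rintro _ ⟨u, v, rfl⟩
    rw [SetLike.mem_coe]
    have hu : u ∈ ⨆ μ, modEig (Zc K F) x μ := hx trivial
    have hv : v ∈ ⨆ μ, modEig (Zc K F) x μ := hx trivial
    refine Submodule.iSup_induction _ (motive := fun u => ⁅u, v⁆ ∈ ⨆ μ, (ad K F x).eigenspace μ) hu ?_ ?_ ?_
    · intro a u hu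
      refine Submodule.iSup_induction _ (motive := fun v => ⁅u, v⁆ ∈ ⨆ μ, (ad K F x).eigenspace μ) hv ?_ ?_ ?_
      · intro b v hv
        refine Submodule.mem_iSup_of_mem (a + b) ?_
        rw [Module.End.mem_eigenspace_iff, ad_apply, leibniz_lie]
        have h1 := Zc_lie (mem_modEig.1 hu) v
        have h2 := mem_Zc.1 (mem_modEig.1 hv) u
        rw [sub_lie, smul_lie, sub_eq_zero] at h1
        rw [lie_sub, lie_smul, sub_eq_zero] at h2
        rw [h1, h2, add_smul]
      · rw [lie_zero]; exact zero_mem _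
      · intro v w hv hw; rw [lie_add]; exact add_mem hv hw
    · rw [zero_lie]; exact zero_mem _
    · intro v w hv hw; rw [add_lie]; exact add_mem hv hw
  · intro z hz
    refine Submodule.mem_iSup_of_mem 0 ?_
    rw [Module.End.mem_eigenspace_iff, ad_apply, zero_smul, mem_Zc.1 hz]

/-- The conclusion of the structure theorem on tori: a maximal torus containing `T` which is
the centralizer of one of its elements. -/
lemma exists_torus (hred : Red K F) {T : Set F} (hT : ∀ t ∈ T, ∀ t' ∈ T, ⁅t, t'⁆ = 0)
    (hd : ⊤ ≤ ⨆ χ, jointWt K T χ) :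
    ∃ h0 : F, ∃ C : LieSubalgebra K F, T ⊆ C ∧ (∀ x ∈ C, ∀ y ∈ C, ⁅x, y⁆ = 0) ∧
      (∀ x ∈ C, ⊤ ≤ ⨆ μ, (ad K F x).eigenspace μ) ∧ h0 ∈ C ∧ ∀ y, ⁅h0, y⁆ = 0 → y ∈ C := by
  have hdT : ∀ t ∈ T, ⊤ ≤ ⨆ μ, (ad K F t).eigenspace μ := fun t ht =>
    hd.trans (iSup_le fun χ => le_iSup_of_le (χ ⟨t, ht⟩) (iInf_le _ (⟨t, ht⟩ : T)))
  obtain ⟨H, hH, hTH⟩ := exists_cartan_of_diag (K := K) (rquot K F '' T)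
    (by rintro _ ⟨t, ht, rfl⟩ _ ⟨t', ht', rfl⟩; rw [← rquot_lie, hT t ht t' ht', map_zero])
    (by
      rintro _ ⟨t, ht, rfl⟩ y hy
      exact apply_eq_zero_of_diag (diag_quot (hdT t ht)) hy)
  have hHab : ∀ a ∈ H, ∀ b ∈ H, ⁅a, b⁆ = 0 := fun a ha b hb =>
    congrArg Subtype.val (trivial_lie_zero H H ⟨a, ha⟩ ⟨b, hb⟩)
  obtain ⟨H0, hH0, e', f', hef, he, hf, hev, hcent⟩ := exists_principal H
  obtain ⟨e, rfl⟩ := rquot_surj e'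
  obtain ⟨f, rfl⟩ := rquot_surj f'
  obtain ⟨h0, rfl, hTh0⟩ := exists_lift_zero hT hd (z := H0)
    (fun t ht => hHab _ (hTH ⟨t, ht, rfl⟩) _ hH0)
  have hinj : Function.Injective fun k : ℤ => ((2 * k : ℤ) : K) := fun i j hij => by
    have : (2 * i : ℤ) = 2 * j := Int.cast_injective (α := K) hij
    omega
  have hL : ∀ c : K, ∀ y ∈ (ad K F h0).maxGenEigenspace c,
      rquot K F y ∈ (ad K _ (rquot K F h0)).eigenspace c ∧
        ((∀ k : ℤ, c ≠ ((2 * k : ℤ) : K)) → rquot K F y = 0) := by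
    intro c y hy
    have hy' : rquot K F y ∈ (ad K _ (rquot K F h0)).maxGenEigenspace c := by
      rw [Module.End.mem_maxGenEigenspace] at hy ⊢
      obtain ⟨n, hn⟩ := hy
      refine ⟨n, ?_⟩
      have key : ∀ w, ((ad K _ (rquot K F h0) - c • 1) ^ n) (rquot K F w) =
          rquot K F (((ad K F h0 - c • 1) ^ n) w) := by
        clear hn
        induction n with
        | zero => intro w; simp
        | succ n ih =>
          intro w
          rw [pow_succ, pow_succ, Module.End.mul_apply, Module.End.mul_apply, ← ih]
          congr 1
      rw [key, hn, map_zero]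
    have h2 := mem_of_iSupIndep
      (A := fun c => ⨆ (k : ℤ) (_ : c = ((2 * k : ℤ) : K)), (ad K _ (rquot K F h0)).eigenspace c)
      (ad K _ (rquot K F h0)).independent_maxGenEigenspace
      (fun c => iSup₂_le fun _ _ => (Module.End.genEigenspace _ c).mono le_top) (a := rquot K F y) ?_ hy'
    · constructor
      · exact (iSup₂_le fun _ _ => le_rfl :
          (⨆ (k : ℤ) (_ : c = ((2 * k : ℤ) : K)), (ad K _ (rquot K F h0)).eigenspace c) ≤ _) h2
      · intro hc
        have : (⨆ (k : ℤ) (_ : c = ((2 * k : ℤ) : K)), (ad K _ (rquot K F h0)).eigenspace c) = ⊥ := by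
          simp only [iSup_eq_bot]
          intro k hk
          exact absurd hk (hc k)
        rw [this] at h2
        simpa using h2
    · have : (⊤ : Submodule K (F ⧸ radical K F)) ≤ ⨆ c, ⨆ (k : ℤ) (_ : c = ((2 * k : ℤ) : K)),
          (ad K _ (rquot K F h0)).eigenspace c := by
        rw [← hev]
        exact iSup_le fun k => le_iSup_of_le _ (le_iSup₂_of_le (f := fun (j : ℤ) (_ :
          ((2 * k : ℤ) : K) = ((2 * j : ℤ) : K)) => (ad K _ (rquot K F h0)).eigenspace ((2 * k : ℤ) : K))
            k rfl le_rfl)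
      exact this trivial
  have hP1 : ∀ c : K, (∀ k : ℤ, c ≠ ((2 * k : ℤ) : K)) → ∀ y ∈ (ad K F h0).maxGenEigenspace c,
      y ∈ radical K F := fun c hc y hy => rquot_eq_zero.1 ((hL c y hy).2 hc)
  have hP2 : ∀ k : ℤ, ∀ y ∈ (ad K F h0).maxGenEigenspace ((2 * k : ℤ) : K), y ∈ radical K F →
      y ∈ Zc K F := by
    intro k y hy hyR
    obtain ⟨n, hn⟩ := (Module.End.mem_maxGenEigenspace _ _ _).1 hy
    clear hy
    induction n generalizing y with
    | zero => simp at hn; rw [hn]; exact zero_mem _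
    | succ n ih =>
      rw [pow_succ, Module.End.mul_apply] at hn
      refine mem_Zc_of_even hred (h0 := h0) (e := e) (f := f) ?_ ?_ ?_ ?_ ?_ k hyR (mem_modEig.2 ?_)
      · rw [← rquot_eq_zero, map_sub, rquot_lie, hef, sub_self]
      · rw [← rquot_eq_zero, map_sub, rquot_lie, he, map_smul, sub_self]
      · rw [← rquot_eq_zero, map_add, rquot_lie, hf, map_smul, neg_add_cancel]
      · simp only [modEig_radical]
        refine le_trans ?_ (comap_iSup_le rquot_surj _)
        rw [hev, Submodule.comap_top]
      · intro y y' hy hy'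
        rw [← rquot_eq_zero, rquot_lie] at hy hy' ⊢
        exact hHab _ (hcent _ hy) _ (hcent _ hy')
      · have hmem : ⁅h0, y⁆ - ((2 * k : ℤ) : K) • y ∈ radical K F :=
          sub_mem (LieSubmodule.lie_mem _ hyR) (Submodule.smul_mem _ _ hyR)
        refine ih _ hmem ?_
        simpa using hn
  have hR0 : ∀ c : K, c ≠ 0 → ∀ y ∈ (ad K F h0).maxGenEigenspace c,
      y ∈ Submodule.span K {z : F | ∃ x y : F, ⁅x, y⁆ = z} := by
    intro c hc y hy
    obtain ⟨n, hn⟩ := (Module.End.mem_maxGenEigenspace _ _ _).1 hy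
    clear hy
    induction n generalizing y with
    | zero => simp at hn; rw [hn]; exact zero_mem _
    | succ n ih =>
      rw [pow_succ, Module.End.mul_apply] at hn
      have h1 := ih _ hn
      have h2 : y = c⁻¹ • (⁅h0, y⁆ - (ad K F h0 - c • 1) y) := by
        simp [smul_smul, inv_mul_cancel₀ hc]
      rw [h2]
      exact Submodule.smul_mem _ _ (sub_mem (Submodule.subset_span ⟨_, _, rfl⟩) h1)
  have htop : ⨆ c, (ad K F h0).maxGenEigenspace c = ⊤ := Module.End.iSup_maxGenEigenspace_eq_top _
  have hRdec : (radical K F).toSubmodule =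
      ⨆ c, (radical K F).toSubmodule ⊓ (ad K F h0).maxGenEigenspace c :=
    Submodule.eq_iSup_inf_genEigenspace ⊤
      (fun x hx => LieSubmodule.lie_mem (radical K F) (x := h0) hx) htop
  have hD : ⊤ ≤ Submodule.span K {z : F | ∃ x y : F, ⁅x, y⁆ = z} ⊔ Zc K F := by
    have hR : (radical K F).toSubmodule ≤ Submodule.span K {z : F | ∃ x y : F, ⁅x, y⁆ = z} ⊔ Zc K F := by
      rw [hRdec]
      refine iSup_le fun c y hy => ?_
      by_cases hc : ∃ k : ℤ, c = ((2 * k : ℤ) : K)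
      · obtain ⟨k, rfl⟩ := hc
        exact Submodule.mem_sup_right (hP2 k y hy.2 hy.1)
      · push Not at hc
        exact Submodule.mem_sup_left (hR0 c (by simpa using hc 0) y hy.2)
    intro y _
    have hy : rquot K F y ∈ (Submodule.span K {z : F | ∃ x y : F, ⁅x, y⁆ = z}).map (rquot K F) := by
      have h1 : (⊤ : Submodule K (F ⧸ radical K F)) ≤
          (Submodule.span K {z : F | ∃ x y : F, ⁅x, y⁆ = z}).map (rquot K F) := by
        rw [← perfect_of_killing, Submodule.span_le]
        rintro _ ⟨a, b, rfl⟩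
        obtain ⟨a, rfl⟩ := rquot_surj a
        obtain ⟨b, rfl⟩ := rquot_surj b
        exact ⟨⁅a, b⁆, Submodule.subset_span ⟨a, b, rfl⟩, rquot_lie a b⟩
      exact h1 trivial
    obtain ⟨w, hw, hw'⟩ := hy
    have h3 : y - w ∈ radical K F := by rw [← rquot_eq_zero, map_sub, hw', sub_self]
    have := add_mem (Submodule.mem_sup_left hw) (hR h3)
    rwa [add_sub_cancel] at this
  have hC : ∀ x : F, x ∈ LieSubalgebra.engel K h0 ↔ x ∈ (ad K F h0).maxGenEigenspace 0 := by
    intro x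
    rw [LieSubalgebra.mem_engel_iff, Module.End.mem_maxGenEigenspace]
    simp
  have hCH : ∀ x ∈ LieSubalgebra.engel K h0, rquot K F x ∈ H := fun x hx => by
    have := (hL 0 x ((hC x).1 hx)).1
    rw [Module.End.mem_eigenspace_iff, zero_smul] at this
    exact hcent _ this
  have hdiagL : ∀ x ∈ LieSubalgebra.engel K h0,
      ⊤ ≤ ⨆ μ, (ad K _ (rquot K F x)).eigenspace μ := by
    intro x hx
    have h1 := (IsKilling.isSemisimple_ad_of_mem_isCartanSubalgebra (hCH x hx)).isFinitelySemisimple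
    rw [← Module.End.iSup_maxGenEigenspace_eq_top (ad K _ (rquot K F x))]
    exact iSup_mono fun μ => (h1.maxGenEigenspace_eq_eigenspace μ).le
  have hdiag : ∀ x ∈ LieSubalgebra.engel K h0, ⊤ ≤ ⨆ μ, (ad K F x).eigenspace μ := by
    intro x hx
    refine diag_of_modEig hD ?_
    have hxR : ⊤ ≤ ⨆ μ, modEig (radical K F).toSubmodule x μ := by
      simp only [modEig_radical]
      refine le_trans ?_ (comap_iSup_le rquot_surj _)
      rw [top_le_iff.1 (hdiagL x hx), Submodule.comap_top]
    have hRle : (radical K F).toSubmodule ≤ ⨆ μ, modEig (Zc K F) x μ :=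
      (radical_le_iSup_modEig hred hxR).trans (iSup_mono fun μ => inf_le_right)
    have hstab : ∀ c, ∀ y ∈ (ad K F h0).maxGenEigenspace c, ⁅x, y⁆ ∈ (ad K F h0).maxGenEigenspace c := by
      intro c y hy
      have := LieModule.lie_mem_maxGenEigenspace_toEnd (R := K) (L := F) (M := F) (x := h0) ((hC x).1 hx) hy
      rwa [zero_add] at this
    rw [← htop]
    refine iSup_le fun c => ?_
    by_cases hc : ∃ k : ℤ, c = ((2 * k : ℤ) : K)
    · obtain ⟨k, rfl⟩ := hc
      set P := (ad K F h0).maxGenEigenspace ((2 * k : ℤ) : K) with hP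
      have hQ : P.map (rquot K F) =
          ⨆ μ, P.map (rquot K F) ⊓ (ad K _ (rquot K F x)).eigenspace μ := by
        refine Submodule.eq_iSup_inf_genEigenspace 1 ?_ (top_le_iff.1 (hdiagL x hx))
        rintro _ ⟨y, hy, rfl⟩
        exact ⟨⁅x, y⁆, hstab _ y hy, rquot_lie x y⟩
      have hle : P.map (rquot K F) ≤ (⨆ μ, modEig (Zc K F) x μ).map (rquot K F) := by
        rw [hQ, Submodule.map_iSup]
        refine iSup_mono fun μ => ?_
        rintro _ ⟨⟨y, hy, rfl⟩, hy'⟩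
        refine ⟨y, mem_modEig.2 (hP2 k _ (sub_mem (hstab _ y hy) (Submodule.smul_mem _ _ hy)) ?_), rfl⟩
        rw [SetLike.mem_coe, Module.End.mem_eigenspace_iff, ad_apply] at hy'
        rw [← rquot_eq_zero, map_sub, rquot_lie, hy', map_smul, sub_self]
      intro y hy
      obtain ⟨w, hw, hw'⟩ := hle ⟨y, hy, rfl⟩
      have h3 : y - w ∈ radical K F := by rw [← rquot_eq_zero, map_sub, hw', sub_self]
      have := add_mem hw (hRle h3)
      rwa [add_sub_cancel] at this
    · push Not at hc
      exact fun y hy => hRle (hP1 c hc y hy)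
  have hmemC : ∀ y, ⁅h0, y⁆ = 0 → y ∈ LieSubalgebra.engel K h0 := fun y hy =>
    LieSubalgebra.mem_engel_iff _ _ _ |>.2 ⟨1, by simpa using hy⟩
  refine ⟨h0, LieSubalgebra.engel K h0, ?_, ?_, hdiag, hmemC _ (lie_self _), hmemC⟩
  · intro t ht
    exact hmemC t (by rw [← lie_skew, hTh0 t ht, neg_zero])
  · intro x hx y hy
    have h1 : ⁅x, y⁆ ∈ radical K F := by
      rw [← rquot_eq_zero, rquot_lie]; exact hHab _ (hCH x hx) _ (hCH y hy)
    have h2 : ⁅x, y⁆ ∈ Zc K F := by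
      refine hP2 0 _ ?_ h1
      have := (hC _).1 ((LieSubalgebra.engel K h0).lie_mem hx hy)
      simpa using this
    exact apply_eq_zero_of_diag (hdiag x hx) (mem_Zc.1 h2 x)

end ThmA
end Str

namespace Str
attribute [local instance] LieRing.ofAssociativeRing

section Cartan
variable {K A L : Type} [Field K] [CharZero K] [LieRing L] [LieAlgebra K L] [FiniteDimensional K L]
  [LieRing A] [LieAlgebra K A]
open LieAlgebra

lemma isSolvable_of_killingForm_eq_zero (f : A →ₗ⁅K⁆ L) (hf : Function.Injective f)
    (h : ∀ x y : A, killingForm K L (f x) (f y) = 0) : IsSolvable A := by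
  have : FiniteDimensional K A := FiniteDimensional.of_injective (f : A →ₗ[K] L) hf
  let _ := LieRingModule.compLieHom L f
  have := LieModule.compLieHom L f
  have htf : LieModule.traceForm K A L = 0 := by
    ext x y
    exact h x y
  have hnil : LieModule.IsNilpotent (derivedSeries K A 1) L :=
    LieModule.isNilpotent_derivedSeries_of_traceForm_eq_zero htf
  have hring : LieRing.IsNilpotent (derivedSeries K A 1) := by
    rw [LieAlgebra.isNilpotent_iff_forall (R := K)]
    rintro ⟨x, hx⟩
    obtain ⟨n, hn⟩ := (LieModule.isNilpotent_iff_forall' (R := K)).mp hnil ⟨x, hx⟩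
    refine ⟨n, LinearMap.ext fun y => ?_⟩
    have key : ∀ (k : ℕ) (y : derivedSeries K A 1),
        f (((ad K (derivedSeries K A 1) ⟨x, hx⟩) ^ k) y : derivedSeries K A 1) =
        ((LieModule.toEnd K (derivedSeries K A 1) L ⟨x, hx⟩) ^ k) (f y) := by
      intro k
      induction k with
      | zero => intro y; simp
      | succ k ih =>
        intro y
        rw [pow_succ, pow_succ, Module.End.mul_apply, Module.End.mul_apply, ih]
        congr 1
        exact f.map_lie x y
    have := key n y
    rw [hn, LinearMap.zero_apply] at this
    exact Subtype.ext (hf (this.trans (map_zero f).symm))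
  obtain ⟨k, hk⟩ := IsSolvable.solvable K (derivedSeries K A 1)
  rw [LieIdeal.derivedSeries_eq_bot_iff] at hk
  refine IsSolvable.mk (R := K) (k := k + 1) ?_
  rw [derivedSeries_def, derivedSeriesOfIdeal_add]
  exact hk

end Cartan

section Torus
variable {K g : Type} [Field K] [IsAlgClosed K] [CharZero K] [LieRing g] [LieAlgebra K g]
variable (S : Setup K g)

instance (n : ℕ) : FiniteDimensional K (S.F n) := S.F_findim n

lemma red (n : ℕ) : Red K (S.F n) := red_of_center (S.F_reductive n)

lemma exists_mem_two (x y : g) : ∃ n, x ∈ S.F n ∧ y ∈ S.F n := by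
  obtain ⟨n, hn⟩ := S.F_exhaust x
  obtain ⟨m, hm⟩ := S.F_exhaust y
  exact ⟨max n m, S.F_mono (le_max_left n m) hn, S.F_mono (le_max_right n m) hm⟩

lemma h_lie {x y : g} (hx : x ∈ S.h) (hy : y ∈ S.h) : ⁅x, y⁆ = 0 := by
  obtain ⟨n, hxn, hyn⟩ := exists_mem_two S x y
  have h1 := (S.h_maxToral n).1.2.1
  exact congrArg Subtype.val (h1.trivial ⟨x, hx, hxn⟩ ⟨y, hy, hyn⟩)

lemma iSup_jointWt (n : ℕ) : ⊤ ≤ ⨆ χ, jointWt K {t : S.F n | (t : g) ∈ S.h} χ := by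
  have h1 := (S.h_maxToral n).1.2.2
  have h2 : (S.F n).toSubmodule ≤ (⨆ χ, jointWt K {t : S.F n | (t : g) ∈ S.h} χ).map
      ((S.F n).incl : S.F n →ₗ[K] g) := by
    refine h1.trans (iSup_le ?_)
    rintro α x ⟨hx, hx'⟩
    refine ⟨⟨x, hx⟩, Submodule.mem_iSup_of_mem (fun t => α ⟨t.1, t.2, t.1.2⟩) (mem_jointWt.2 ?_), rfl⟩
    intro t
    exact Subtype.ext (hx' ⟨t.1, t.2, t.1.2⟩)
  intro x _
  obtain ⟨y, hy, hyx⟩ := h2 x.2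
  rwa [← Subtype.ext hyx]

/-- A subalgebra of commuting `ad`-diagonalizable elements is toral. -/
lemma isToralIn_map {s : LieSubalgebra K g} [FiniteDimensional K s] {C : LieSubalgebra K s}
    (hab : ∀ x ∈ C, ∀ y ∈ C, ⁅x, y⁆ = 0) (hd : ∀ x ∈ C, ⊤ ≤ ⨆ μ, (LieAlgebra.ad K s x).eigenspace μ) :
    IsToralIn K g s (C.map s.incl) := by
  refine ⟨?_, ⟨?_⟩, ?_⟩
  · rintro _ ⟨x, -, rfl⟩; exact x.2
  · rintro ⟨_, x, hx, rfl⟩ ⟨_, y, hy, rfl⟩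
    have := hab x hx y hy
    exact Subtype.ext (congrArg Subtype.val this :)
  · have h1 := iSup_jointEigenspaces (fun c : C => LieAlgebra.ad K s (c : s))
      (by
        intro i j
        rw [commute_iff_lie_eq, ← LieHom.map_lie, hab _ i.2 _ j.2, _root_.map_zero])
      (fun c => hd c c.2)
    have h2 : s.toSubmodule ≤ (⨆ χ : C → K, ⨅ c : C, (LieAlgebra.ad K s (c : s)).eigenspace (χ c)).map
        (s.incl : s →ₗ[K] g) := by
      intro x hx
      exact ⟨⟨x, hx⟩, h1 trivial, rfl⟩
    refine h2.trans ?_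
    rw [Submodule.map_iSup]
    refine iSup_le fun χ => ?_
    by_cases hbot : (⨅ c : C, (LieAlgebra.ad K s (c : s)).eigenspace (χ c)) = ⊥
    · rw [hbot, Submodule.map_bot]; exact bot_le
    obtain ⟨y, hy, hy0⟩ := Submodule.exists_mem_ne_zero_of_ne_bot hbot
    have hev : ∀ z ∈ (⨅ c : C, (LieAlgebra.ad K s (c : s)).eigenspace (χ c)), ∀ c : C,
        ⁅(c : s), z⁆ = χ c • z := fun z hz c =>
      Module.End.mem_eigenspace_iff.1 ((Submodule.mem_iInf _).1 hz c)
    have hinj : Function.Injective fun a : K => a • y := smul_left_injective K hy0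
    let χ' : C →ₗ[K] K :=
      { toFun := χ
        map_add' := fun a b => hinj (by
          simp only [add_smul, ← hev y hy]
          exact add_lie (a : s) (b : s) y)
        map_smul' := fun a b => hinj (by
          simp only [smul_eq_mul, mul_smul, ← hev y hy, RingHom.id_apply]
          exact smul_lie a (b : s) y) }
    let e := LieSubalgebra.equivMapOfInjective s.incl C Subtype.val_injective
    refine le_iSup_of_le (χ'.comp (e.symm : _ →ₗ[K] C)) ?_
    rintro _ ⟨z, hz, rfl⟩
    refine ⟨z.2, fun t => ?_⟩
    obtain ⟨c, rfl⟩ := e.surjective t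
    have := congrArg Subtype.val (hev z hz c)
    rw [LinearMap.comp_apply]
    change ⁅((c : s) : g), (z : g)⁆ = χ (e.symm (e c)) • (z : g)
    rw [LieEquiv.symm_apply_apply]
    exact this

lemma mem_h_of_centralizes {n : ℕ} {x : g} (hx : x ∈ S.F n)
    (hc : ∀ t ∈ S.h, t ∈ S.F n → ⁅t, x⁆ = 0) : x ∈ S.h := by
  obtain ⟨h0, C, hTC, hab, hd, h0C, hcent⟩ := exists_torus (red S n)
    (T := {t : S.F n | (t : g) ∈ S.h})
    (fun t ht t' ht' => Subtype.ext (h_lie S ht ht')) (iSup_jointWt S n)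
  have h1 := (S.h_maxToral n).2 _ (isToralIn_map hab hd)
    (fun t ht => ⟨⟨t, ht.2⟩, hTC ht.1, rfl⟩)
  have hCh : ∀ c ∈ C, (c : g) ∈ S.h := fun c hc => by
    have : (c : g) ∈ C.map (S.F n).incl := ⟨c, hc, rfl⟩
    rw [h1] at this
    exact this.1
  exact hCh _ (hcent ⟨x, hx⟩ (Subtype.ext (hc _ (hCh _ h0C) h0.2)))

end Torus
end Str

namespace Str
attribute [local instance] LieRing.ofAssociativeRing
open Filter

section Trace
variable {K V : Type} [Field K] [CharZero K] [AddCommGroup V] [Module K V] [FiniteDimensional K V]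

lemma eigenspace_eq_bot_of_commutator {T A B : Module.End K V} (h : A * B - B * A = T)
    (hA : T * A = A * T) (hB : T * B = B * T) {c : K} (hc : c ≠ 0) : T.eigenspace c = ⊥ := by
  have st : ∀ {X : Module.End K V}, T * X = X * T → ∀ v ∈ T.eigenspace c, X v ∈ T.eigenspace c := by
    intro X hX v hv
    rw [Module.End.mem_eigenspace_iff] at hv ⊢
    rw [← Module.End.mul_apply, hX, Module.End.mul_apply, hv, map_smul]
  have h1 : A.restrict (st hA) * B.restrict (st hB) - B.restrict (st hB) * A.restrict (st hA) =
      c • (1 : Module.End K (T.eigenspace c)) := by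
    ext v
    have h2 := LinearMap.congr_fun h v
    rw [Module.End.mem_eigenspace_iff.1 v.2] at h2
    simpa using h2
  have h3 := congrArg (LinearMap.trace K (T.eigenspace c)) h1
  rw [map_sub, LinearMap.trace_mul_comm, sub_self, map_smul, LinearMap.trace_one, smul_eq_mul, eq_comm,
    mul_eq_zero, Nat.cast_eq_zero] at h3
  exact Submodule.finrank_eq_zero.1 (h3.resolve_left hc)

end Trace

section Weights
variable {K g : Type} [Field K] [IsAlgClosed K] [CharZero K] [LieRing g] [LieAlgebra K g]
variable (S : Setup K g)

/-- The weight spaces of `g`. -/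
abbrev wt (α : Module.Dual K S.h) : Submodule K g := adWeightSpace K g S.h α

abbrev IsRt (α : Module.Dual K S.h) : Prop := IsRootOf K g S.h α

variable {S}

lemma wt_lie {α β : Module.Dual K S.h} {x y : g} (hx : x ∈ wt S α) (hy : y ∈ wt S β) :
    ⁅x, y⁆ ∈ wt S (α + β) := by
  intro H
  rw [leibniz_lie, hx H, hy H, smul_lie, lie_smul, LinearMap.add_apply, add_smul]

lemma ev_mem (S : Setup K g) (x : g) : ∀ᶠ n in atTop, x ∈ S.F n := by
  obtain ⟨n, hn⟩ := S.F_exhaust x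
  exact eventually_atTop.2 ⟨n, fun m hm => S.F_mono hm hn⟩

lemma mem_wt_zero {x : g} : x ∈ wt S 0 ↔ x ∈ S.h := by
  constructor
  · intro hx
    obtain ⟨n, hn⟩ := S.F_exhaust x
    refine mem_h_of_centralizes S hn fun t ht _ => ?_
    simpa using hx ⟨t, ht⟩
  · intro hx H
    rw [h_lie S H.2 hx, LinearMap.zero_apply, zero_smul]

lemma wt_disj {α β : Module.Dual K S.h} (hαβ : α ≠ β) {x : g} (hx : x ∈ wt S α) (hy : x ∈ wt S β) :
    x = 0 := by
  by_contra hx0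
  refine hαβ (LinearMap.ext fun H => ?_)
  exact smul_left_injective K hx0 ((hx H).symm.trans (hy H))

lemma eq_zero_of_not_root {α : Module.Dual K S.h} (hα : α ≠ 0) (h : ¬ IsRt S α) {x : g} (hx : x ∈ wt S α) :
    x = 0 := by
  by_contra hx0
  exact h ⟨hα, fun hb => hx0 (by rw [← Submodule.mem_bot K, ← hb]; exact hx)⟩

lemma neg_mem_pos {α : Module.Dual K S.h} (hα : IsRt S α) (h : α ∉ S.pos) : -α ∈ S.pos := by
  by_contra h'
  exact h ((S.pos_polar α hα).2 h')

lemma neg_notMem_pos {α : Module.Dual K S.h} (hα : α ∈ S.pos) : -α ∉ S.pos :=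
  (S.pos_polar α (S.pos_root α hα)).1 hα

lemma add_ne_of_simple {α β γ : Module.Dual K S.h} (hα : S.IsSimpleRoot α) (hβ : β ∈ S.pos)
    (hγ : γ ∈ S.pos) : β + γ ≠ α := fun h =>
  hα.2 ⟨{β, γ}, by simp, by simp [hβ, hγ], by simp [h]⟩

lemma sub_not_root {α β : Module.Dual K S.h} (hα : S.IsSimpleRoot α) (hβ : S.IsSimpleRoot β) :
    ¬ IsRt S (α - β) := by
  intro h
  by_cases hp : α - β ∈ S.pos
  · exact add_ne_of_simple hα hp hβ.1 (by abel)
  · exact add_ne_of_simple hβ (neg_mem_pos h hp) hα.1 (by abel)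

lemma lie_eq_zero_of_simple {α β : Module.Dual K S.h} (hα : S.IsSimpleRoot α) (hβ : S.IsSimpleRoot β)
    (hαβ : α ≠ β) {x y : g} (hx : x ∈ wt S α) (hy : y ∈ wt S (-β)) : ⁅x, y⁆ = 0 := by
  have := wt_lie hx hy
  rw [← sub_eq_add_neg] at this
  exact eq_zero_of_not_root (sub_ne_zero.2 hαβ) (sub_not_root hα hβ) this

lemma central_of_ev (S : Setup K g) {z : g}
    (h : ∀ᶠ n in atTop, ∀ hz : z ∈ S.F n, (⟨z, hz⟩ : S.F n) ∈ Zc K (S.F n)) (y : g) :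
    ⁅y, z⁆ = 0 := by
  obtain ⟨n, h1, h2, h3⟩ := (h.and ((ev_mem S z).and (ev_mem S y))).exists
  have h4 := mem_Zc.1 (h1 h2) ⟨y, h3⟩
  exact congrArg Subtype.val h4

lemma diag_F {n : ℕ} {t : g} (ht : t ∈ S.h) (htn : t ∈ S.F n) :
    ⊤ ≤ ⨆ μ, (LieAlgebra.ad K (S.F n) ⟨t, htn⟩).eigenspace μ :=
  (iSup_jointWt S n).trans (iSup_le fun χ => le_iSup_of_le (χ ⟨⟨t, htn⟩, ht⟩)
    (iInf_le (fun t : {t : S.F n | (t : g) ∈ S.h} =>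
      (LieAlgebra.ad K (S.F n) (t : S.F n)).eigenspace (χ t)) ⟨⟨t, htn⟩, ht⟩))

lemma heisenberg {α : Module.Dual K S.h} {e f : g} (he : e ∈ wt S α) (hf : f ∈ wt S (-α))
    (ht : ⁅e, f⁆ ∈ S.h) (h0 : α ⟨⁅e, f⁆, ht⟩ = 0) (y : g) : ⁅y, ⁅e, f⁆⁆ = 0 := by
  refine central_of_ev S ?_ y
  filter_upwards [ev_mem S e, ev_mem S f] with n hen hfn hz
  have hd := diag_F ht hz
  have hte : ⁅⁅e, f⁆, e⁆ = 0 := by rw [he ⟨_, ht⟩, h0, zero_smul]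
  have htf : ⁅⁅e, f⁆, f⁆ = 0 := by rw [hf ⟨_, ht⟩, LinearMap.neg_apply, h0, neg_zero, zero_smul]
  have hb : ∀ c : K, c ≠ 0 → (LieAlgebra.ad K (S.F n) ⟨⁅e, f⁆, hz⟩).eigenspace c = ⊥ := by
    intro c hc
    refine eigenspace_eq_bot_of_commutator (A := LieAlgebra.ad K (S.F n) ⟨e, hen⟩)
      (B := LieAlgebra.ad K (S.F n) ⟨f, hfn⟩) ?_ ?_ ?_ hc
    · rw [← LieRing.of_associative_ring_bracket, ← LieHom.map_lie]
      rfl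
    · rw [← sub_eq_zero, ← LieRing.of_associative_ring_bracket, ← LieHom.map_lie]
      have : ⁅(⟨⁅e, f⁆, hz⟩ : S.F n), (⟨e, hen⟩ : S.F n)⁆ = 0 := Subtype.ext hte
      rw [this, _root_.map_zero]
    · rw [← sub_eq_zero, ← LieRing.of_associative_ring_bracket, ← LieHom.map_lie]
      have : ⁅(⟨⁅e, f⁆, hz⟩ : S.F n), (⟨f, hfn⟩ : S.F n)⁆ = 0 := Subtype.ext htf
      rw [this, _root_.map_zero]
  rw [mem_Zc]
  intro y
  have hle : (⊤ : Submodule K (S.F n)) ≤ (LieAlgebra.ad K (S.F n) ⟨⁅e, f⁆, hz⟩).eigenspace 0 := by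
    refine hd.trans (iSup_le fun c => ?_)
    by_cases hc : c = 0
    · rw [hc]
    · rw [hb c hc]; exact bot_le
  have := Module.End.mem_eigenspace_iff.1 (hle (x := y) trivial)
  rw [zero_smul, LieAlgebra.ad_apply] at this
  rw [← lie_skew, this, neg_zero]

end Weights

section Killing
variable {K g : Type} [Field K] [IsAlgClosed K] [CharZero K] [LieRing g] [LieAlgebra K g]
variable (S : Setup K g)

/-- A linear projection onto `F n`. -/
def proj (n : ℕ) : g →ₗ[K] S.F n := ((S.F n).toSubmodule.subtype.exists_leftInverse_of_injective
  (Submodule.ker_subtype _)).choose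

lemma proj_apply {n : ℕ} {x : g} (hx : x ∈ S.F n) : proj S n x = ⟨x, hx⟩ :=
  LinearMap.congr_fun ((S.F n).toSubmodule.subtype.exists_leftInverse_of_injective
    (Submodule.ker_subtype _)).choose_spec ⟨x, hx⟩

/-- The Killing form of `F n`, extended to `g`. -/
def kap (n : ℕ) : g →ₗ[K] g →ₗ[K] K := (killingForm K (S.F n)).compl₁₂ (proj S n) (proj S n)

lemma kap_apply {n : ℕ} {x y : g} (hx : x ∈ S.F n) (hy : y ∈ S.F n) :
    kap S n x y = killingForm K (S.F n) ⟨x, hx⟩ ⟨y, hy⟩ := by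
  rw [kap, LinearMap.compl₁₂_apply, proj_apply S hx, proj_apply S hy]

lemma kap_comm (n : ℕ) (x y : g) : kap S n x y = kap S n y x := by
  rw [kap, LinearMap.compl₁₂_apply, LinearMap.compl₁₂_apply, LieModule.traceForm_comm]

lemma kap_lie {n : ℕ} {x y z : g} (hx : x ∈ S.F n) (hy : y ∈ S.F n) (hz : z ∈ S.F n) :
    kap S n ⁅x, y⁆ z = kap S n x ⁅y, z⁆ := by
  rw [kap_apply S ((S.F n).lie_mem hx hy) hz, kap_apply S hx ((S.F n).lie_mem hy hz)]
  exact LieModule.traceForm_apply_lie_apply K (S.F n) (S.F n) ⟨x, hx⟩ ⟨y, hy⟩ ⟨z, hz⟩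

/-- Eventual orthogonality for the Killing forms. -/
def Orth (x y : g) : Prop := ∀ᶠ n in atTop, kap S n x y = 0

variable {S}

lemma orth_wt {μ ν : Module.Dual K S.h} (h : μ + ν ≠ 0) {x y : g} (hx : x ∈ wt S μ) (hy : y ∈ wt S ν) :
    Orth S x y := by
  obtain ⟨H, hH⟩ : ∃ H, (μ + ν) H ≠ 0 := by
    by_contra! h'
    exact h (LinearMap.ext h')
  filter_upwards [ev_mem S x, ev_mem S y, ev_mem S (H : g)] with n hxn hyn hHn
  have h1 := kap_lie S hxn hHn hyn
  rw [hy H, ← lie_skew, hx H, map_neg, map_smul, map_smul, LinearMap.neg_apply, LinearMap.smul_apply] at h1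
  have h2 : (μ + ν) H • kap S n x y = 0 := by
    rw [LinearMap.add_apply, add_smul, ← h1, add_neg_cancel]
  exact (smul_eq_zero.1 h2).resolve_left hH

/-- The vectors eventually orthogonal to `y`. -/
def orthTo (S : Setup K g) (y : g) : Submodule K g where
  carrier := {x | Orth S x y}
  add_mem' := fun ha hb => by
    filter_upwards [ha, hb] with n h1 h2
    rw [map_add, LinearMap.add_apply, h1, h2, add_zero]
  zero_mem' := Eventually.of_forall fun n => by rw [_root_.map_zero, LinearMap.zero_apply]
  smul_mem' := fun c x hx => by
    filter_upwards [hx] with n h1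
    rw [map_smul, LinearMap.smul_apply, h1, smul_zero]

lemma Orth.symm {x y : g} (h : Orth S x y) : Orth S y x := by
  filter_upwards [h] with n hn
  rw [kap_comm, hn]

lemma orth_uniform {P Q : Submodule K g} (hP : P.FG) (hQ : Q.FG) (h : ∀ x ∈ P, ∀ y ∈ Q, Orth S x y) :
    ∀ᶠ n in atTop, ∀ x ∈ P, ∀ y ∈ Q, kap S n x y = 0 := by
  obtain ⟨s, rfl⟩ := hP
  obtain ⟨t, rfl⟩ := hQ
  have h1 : ∀ᶠ n in atTop, ∀ x ∈ s, ∀ y ∈ t, kap S n x y = 0 := by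
    rw [eventually_all_finset]
    intro x hx
    rw [eventually_all_finset]
    exact fun y hy => h x (Submodule.subset_span hx) y (Submodule.subset_span hy)
  filter_upwards [h1] with n hn x hx y hy
  have h2 : ∀ x ∈ s, kap S n x y = 0 := fun x hx => by
    have : Submodule.span K (t : Set g) ≤ LinearMap.ker (kap S n x) :=
      Submodule.span_le.2 fun y hy => hn x hx y hy
    exact this hy
  have : Submodule.span K (s : Set g) ≤ LinearMap.ker ((kap S n).flip y) :=
      Submodule.span_le.2 fun x hx => h2 x hx
  exact this hx

/-- An ideal of `F n` whose elements are eventually mutually orthogonal lies in the radical. -/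
lemma le_radical_of_orth {n : ℕ} (I : LieIdeal K (S.F n))
    (h : ∀ x ∈ I, ∀ y ∈ I, Orth S (x : g) (y : g)) : I ≤ LieAlgebra.radical K (S.F n) := by
  rw [← LieAlgebra.LieIdeal.solvable_iff_le_radical]
  have hfg : (I.toSubmodule.map ((S.F n).incl : S.F n →ₗ[K] g)).FG :=
    (IsNoetherian.noetherian I.toSubmodule).map _
  have hu := orth_uniform (S := S) hfg hfg (by
    rintro _ ⟨x, hx, rfl⟩ _ ⟨y, hy, rfl⟩
    exact h x hx y hy)
  obtain ⟨m, hm, hnm⟩ := (hu.and (eventually_ge_atTop n)).exists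
  have hle : S.F n ≤ S.F m := S.F_mono hnm
  refine isSolvable_of_killingForm_eq_zero (K := K)
    ((LieSubalgebra.inclusion hle).comp (LieIdeal.incl I)) ?_ ?_
  · exact (LieSubalgebra.inclusion_injective hle).comp (Subtype.val_injective)
  · intro x y
    have : kap S m ((x : S.F n) : g) ((y : S.F n) : g) = 0 := hm _ ⟨x, x.2, rfl⟩ _ ⟨y, y.2, rfl⟩
    rwa [kap_apply S (hle x.1.2) (hle y.1.2)] at this

end Killing
end Str

namespace Str
attribute [local instance] LieRing.ofAssociativeRing
open Filter

section Simple
variable {K g : Type} [Field K] [IsAlgClosed K] [CharZero K] [LieRing g] [LieAlgebra K g]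
variable {S : Setup K g}

lemma lie_central_of_orth {J : Submodule K g} (hJ : ∀ y : g, ∀ x ∈ J, ⁅y, x⁆ ∈ J)
    (ho : ∀ x ∈ J, ∀ y ∈ J, Orth S x y) {x y : g} (hx : x ∈ J) (hy : y ∈ J) (z : g) :
    ⁅z, ⁅x, y⁆⁆ = 0 := by
  refine central_of_ev S ?_ z
  filter_upwards [ev_mem S x, ev_mem S y] with n hxn hyn hz
  let I : LieIdeal K (S.F n) :=
    { J.comap ((S.F n).incl : S.F n →ₗ[K] g) with
      lie_mem := fun {u v} hv => hJ _ _ hv }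
  have hI := le_radical_of_orth I fun u hu v hv => ho _ hu _ hv
  exact radical_lie_mem_center (red S n) (x := ⟨x, hxn⟩) (y := ⟨y, hyn⟩) (hI hx) (hI hy)

lemma central_of_abelian (S : Setup K g) {J : Submodule K g} (hJ : ∀ y : g, ∀ x ∈ J, ⁅y, x⁆ ∈ J)
    (ho : ∀ x ∈ J, ∀ y ∈ J, ⁅x, y⁆ = 0) {x : g} (hx : x ∈ J) (z : g) : ⁅z, x⁆ = 0 := by
  refine central_of_ev S (Eventually.of_forall fun n hxn => mem_Zc.2 fun y => ?_) z
  exact red S n (J.comap ((S.F n).incl : S.F n →ₗ[K] g)) (fun u v hv => hJ _ _ hv)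
    (fun u hu v hv => Subtype.ext (ho _ hu _ hv)) ⟨x, hxn⟩ hx y

/-- The elements stabilizing a subspace. -/
def stab (J : Submodule K g) : LieSubalgebra K g where
  carrier := {x | ∀ y ∈ J, ⁅x, y⁆ ∈ J}
  add_mem' := fun ha hb y hy => by rw [add_lie]; exact J.add_mem (ha y hy) (hb y hy)
  zero_mem' := fun y _ => by rw [zero_lie]; exact J.zero_mem
  smul_mem' := fun c x hx y hy => by rw [smul_lie]; exact J.smul_mem c (hx y hy)
  lie_mem' := fun {a b} ha hb y hy => by
    rw [lie_lie]
    exact J.sub_mem (ha _ (hb y hy)) (hb _ (ha y hy))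

lemma wt_le_of_pos {α : Module.Dual K S.h} (hα : α ∈ S.pos) : wt S α ≤ S.b.toSubmodule := by
  rw [S.b_eq]
  exact le_sup_of_le_right (le_iSup₂_of_le α hα le_rfl)

lemma eq_top_of_stable (hD : S.IsDynkin) (T : LieSubalgebra K g) (hh : S.h ≤ T)
    (hneg : ∀ μ, IsRt S μ → μ ∉ S.pos → wt S μ ≤ T.toSubmodule)
    (hs : ∀ β, S.IsSimpleRoot β → wt S β ≤ T.toSubmodule) (x : g) : x ∈ T := by
  have hb : S.b ≤ T := by
    rw [hD, LieSubalgebra.lieSpan_le]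
    refine Set.union_subset hh (Set.iUnion₂_subset fun β hβ => hs β hβ)
  have : (⊤ : Submodule K g) ≤ T.toSubmodule := by
    rw [← S.h_span]
    refine iSup_le fun μ => ?_
    by_cases h0 : μ = 0
    · subst h0
      exact fun x hx => hh (mem_wt_zero.1 hx)
    by_cases hr : IsRt S μ
    · by_cases hp : μ ∈ S.pos
      · exact (wt_le_of_pos hp).trans hb
      · exact hneg μ hr hp
    · intro x hx
      rw [eq_zero_of_not_root h0 hr hx]
      exact T.zero_mem
  exact this Submodule.mem_top

/-- The sum of the negative root spaces. -/
def nminus (S : Setup K g) : Submodule K g :=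
  ⨆ μ : {μ : Module.Dual K S.h // IsRt S μ ∧ μ ∉ S.pos}, wt S μ

lemma wt_le_nminus {μ : Module.Dual K S.h} (hr : IsRt S μ) (hp : μ ∉ S.pos) : wt S μ ≤ nminus S :=
  le_iSup (fun μ : {μ : Module.Dual K S.h // IsRt S μ ∧ μ ∉ S.pos} => wt S μ) ⟨μ, hr, hp⟩

lemma add_ne_zero_of_neg {μ ν : Module.Dual K S.h} (hr : IsRt S μ) (hp : μ ∉ S.pos)
    (hp' : ν ∉ S.pos) : μ + ν ≠ 0 := by
  intro h
  rw [eq_neg_of_add_eq_zero_right h] at hp'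
  exact hp' (neg_mem_pos hr hp)

lemma nminus_lie {x y : g} (hx : x ∈ nminus S) (hy : y ∈ nminus S) : ⁅x, y⁆ ∈ nminus S := by
  have key : ∀ μ : {μ : Module.Dual K S.h // IsRt S μ ∧ μ ∉ S.pos}, ∀ x ∈ wt S μ.1,
      ∀ y ∈ nminus S, ⁅x, y⁆ ∈ nminus S := by
    intro μ x hx y hy
    induction hy using Submodule.iSup_induction' with
    | mem ν y hy =>
      have h1 := wt_lie hx hy
      by_cases hr : IsRt S (μ.1 + ν.1)
      · exact wt_le_nminus hr (S.neg_add _ _ μ.2.1 ν.2.1 μ.2.2 ν.2.2 hr) h1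
      · rw [eq_zero_of_not_root (add_ne_zero_of_neg μ.2.1 μ.2.2 ν.2.2) hr h1]
        exact zero_mem _
    | zero => rw [lie_zero]; exact zero_mem _
    | add a b _ _ ha hb => rw [lie_add]; exact add_mem ha hb
  induction hx using Submodule.iSup_induction' with
  | mem μ x hx => exact key μ x hx y hy
  | zero => rw [zero_lie]; exact zero_mem _
  | add a b _ _ ha hb => rw [add_lie]; exact add_mem ha hb

lemma nminus_orth {x y : g} (hx : x ∈ nminus S) (hy : y ∈ nminus S) : Orth S x y := by
  have key : ∀ μ : {μ : Module.Dual K S.h // IsRt S μ ∧ μ ∉ S.pos}, ∀ x ∈ wt S μ.1,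
      Orth S x y := by
    intro μ x hx
    have : nminus S ≤ orthTo S x := iSup_le fun ν y hy =>
      (orth_wt (add_ne_zero_of_neg μ.2.1 μ.2.2 ν.2.2) hx hy).symm
    exact (this hy : Orth S y x).symm
  exact (iSup_le key : nminus S ≤ orthTo S y) hx

lemma nminus_wt_zero {x : g} (hx : x ∈ nminus S) (hx' : x ∈ wt S 0) : x = 0 := by
  have h1 := S.h_indep 0
  refine Submodule.disjoint_def.1 h1 x hx' ?_
  refine (iSup_le fun μ => ?_ : nminus S ≤ _) hx
  exact le_iSup₂_of_le μ.1 μ.2.1.1 le_rfl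

lemma orth_central {z : g} (hz : ∀ y : g, ⁅y, z⁆ = 0) (x : g) : Orth S x z := by
  filter_upwards [ev_mem S x, ev_mem S z] with n hx hzn
  rw [kap_apply S hx hzn, killingForm_apply_apply]
  have : LieAlgebra.ad K (S.F n) ⟨z, hzn⟩ = 0 := by
    ext y
    have := hz y
    rw [← lie_skew, neg_eq_zero] at this
    simpa using this
  rw [this, LinearMap.comp_zero, _root_.map_zero]

/-- The smallest subspace containing `wt (-α)` that is stable under `h` and the negative root spaces. -/
def gen (S : Setup K g) (α : Module.Dual K S.h) : Submodule K g :=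
  sInf {P | wt S (-α) ≤ P ∧ S.h ≤ stab P ∧
    ∀ μ, IsRt S μ → μ ∉ S.pos → wt S μ ≤ (stab P).toSubmodule}

lemma gen_le {α : Module.Dual K S.h} {P : Submodule K g} (h1 : wt S (-α) ≤ P) (h2 : S.h ≤ stab P)
    (h3 : ∀ μ, IsRt S μ → μ ∉ S.pos → wt S μ ≤ (stab P).toSubmodule) : gen S α ≤ P :=
  sInf_le ⟨h1, h2, h3⟩

lemma le_gen (α : Module.Dual K S.h) : wt S (-α) ≤ gen S α := le_sInf fun _ hP => hP.1

lemma h_le_gen (α : Module.Dual K S.h) : S.h ≤ stab (gen S α) := fun x hx y hy => by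
  rw [gen, Submodule.mem_sInf] at hy ⊢
  exact fun P hP => hP.2.1 hx y (hy P hP)

lemma neg_le_gen (α : Module.Dual K S.h) (μ : Module.Dual K S.h) (hr : IsRt S μ) (hp : μ ∉ S.pos) :
    wt S μ ≤ (stab (gen S α)).toSubmodule := fun x hx y hy => by
  rw [gen, Submodule.mem_sInf] at hy ⊢
  exact fun P hP => hP.2.2 μ hr hp hx y (hy P hP)

lemma gen_le_nminus {α : Module.Dual K S.h} (hα : IsRt S (-α)) (hp : -α ∉ S.pos) :
    gen S α ≤ nminus S := by
  refine gen_le (wt_le_nminus hα hp) (fun x hx y hy => ?_) (fun μ hr hp x hx y hy =>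
    nminus_lie (wt_le_nminus hr hp hx) hy)
  induction hy using Submodule.iSup_induction' with
  | mem ν y hy =>
    rw [hy ⟨x, hx⟩]
    exact Submodule.smul_mem _ _ (wt_le_nminus ν.2.1 ν.2.2 hy)
  | zero => rw [lie_zero]; exact zero_mem _
  | add a b _ _ ha hb => rw [lie_add]; exact add_mem ha hb

/-- The center of `g`. -/
def cent (K g : Type) [Field K] [LieRing g] [LieAlgebra K g] : Submodule K g where
  carrier := {z | ∀ y : g, ⁅y, z⁆ = 0}
  add_mem' := fun ha hb y => by rw [lie_add, ha, hb, add_zero]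
  zero_mem' := fun y => lie_zero y
  smul_mem' := fun c x hx y => by rw [lie_smul, hx, smul_zero]

lemma mem_cent {z : g} : z ∈ cent K g ↔ ∀ y : g, ⁅y, z⁆ = 0 := Iff.rfl

lemma gen_ideal (hD : S.IsDynkin) {α : Module.Dual K S.h} (hα : S.IsSimpleRoot α)
    (hz : ∀ e ∈ wt S α, ∀ f ∈ wt S (-α), ⁅e, f⁆ ∈ cent K g) (x : g) :
    x ∈ stab (gen S α ⊔ cent K g) := by
  set J := gen S α ⊔ cent K g with hJ
  have hst : ∀ u, u ∈ stab (gen S α) → u ∈ stab J := by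
    intro u hu y hy
    obtain ⟨y₁, h₁, y₂, h₂, rfl⟩ := Submodule.mem_sup.1 hy
    rw [lie_add, mem_cent.1 h₂, add_zero]
    exact Submodule.mem_sup_left (hu y₁ h₁)
  refine eq_top_of_stable hD _ (fun u hu => hst u (h_le_gen α hu))
    (fun μ hr hp u hu => hst u (neg_le_gen α μ hr hp hu)) ?_ x
  have hle : gen S α ≤ J := le_sup_left
  have main : ∀ y ∈ gen S α, y ∈ J ∧ ∀ β, S.IsSimpleRoot β → ∀ e ∈ wt S β, ⁅e, y⁆ ∈ J := by
    let P : Submodule K g :=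
      { carrier := {y | y ∈ J ∧ ∀ β, S.IsSimpleRoot β → ∀ e ∈ wt S β, ⁅e, y⁆ ∈ J}
        add_mem' := fun ha hb => ⟨add_mem ha.1 hb.1, fun β hβ e he => by
          rw [lie_add]; exact add_mem (ha.2 β hβ e he) (hb.2 β hβ e he)⟩
        zero_mem' := ⟨zero_mem _, fun β hβ e he => by rw [lie_zero]; exact zero_mem _⟩
        smul_mem' := fun c x hx => ⟨J.smul_mem c hx.1, fun β hβ e he => by
          rw [lie_smul]; exact J.smul_mem c (hx.2 β hβ e he)⟩ }
    refine (gen_le ?_ ?_ ?_ : gen S α ≤ P)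
    · refine fun y hy => ⟨hle (le_gen α hy), fun β hβ e he => ?_⟩
      by_cases hβα : β = α
      · subst hβα
        exact Submodule.mem_sup_right (hz e he y hy)
      · rw [lie_eq_zero_of_simple hβ hα hβα he hy]
        exact zero_mem _
    · refine fun u hu y hy => ⟨hst u (h_le_gen α hu) y hy.1, fun β hβ e he => ?_⟩
      rw [leibniz_lie, ← lie_skew e u, he ⟨u, hu⟩, neg_lie, smul_lie]
      exact add_mem (neg_mem (J.smul_mem _ (hy.2 β hβ e he)))
        (hst u (h_le_gen α hu) _ (hy.2 β hβ e he))
    · refine fun μ hr hp u hu y hy => ⟨hst u (neg_le_gen α μ hr hp hu) y hy.1, fun β hβ e he => ?_⟩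
      rw [leibniz_lie]
      refine add_mem ?_ (hst u (neg_le_gen α μ hr hp hu) _ (hy.2 β hβ e he))
      have h1 := wt_lie he hu
      by_cases h0 : β + μ = 0
      · rw [h0] at h1
        exact hst _ (h_le_gen α (mem_wt_zero.1 h1)) _ hy.1
      by_cases hr' : IsRt S (β + μ)
      · by_cases hp' : β + μ ∈ S.pos
        · exact absurd (by abel) (add_ne_of_simple hβ hp' (neg_mem_pos hr hp))
        · exact hst _ (neg_le_gen α _ hr' hp' h1) _ hy.1
      · rw [eq_zero_of_not_root h0 hr' h1, zero_lie]
        exact zero_mem _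
  intro β hβ e he y hy
  obtain ⟨y₁, h₁, y₂, h₂, rfl⟩ := Submodule.mem_sup.1 hy
  rw [lie_add, mem_cent.1 h₂, add_zero]
  exact (main y₁ h₁).2 β hβ e he

lemma exists_coroot_of_neg (hD : S.IsDynkin) {α : Module.Dual K S.h} (hα : S.IsSimpleRoot α)
    (hr : IsRt S (-α)) :
    ∃ e ∈ wt S α, ∃ f ∈ wt S (-α), ∃ t : S.h, (t : g) = ⁅e, f⁆ ∧ α t ≠ 0 := by
  by_contra! hc
  have hp : -α ∉ S.pos := neg_notMem_pos hα.1
  have hz : ∀ e ∈ wt S α, ∀ f ∈ wt S (-α), ⁅e, f⁆ ∈ cent K g := by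
    intro e he f hf
    have h1 := wt_lie he hf
    rw [add_neg_cancel] at h1
    exact heisenberg he hf (mem_wt_zero.1 h1) (hc e he f hf _ rfl)
  have hid := gen_ideal hD hα hz
  have hN := gen_le_nminus hr hp
  have hid' : ∀ y : g, ∀ x ∈ gen S α ⊔ cent K g, ⁅y, x⁆ ∈ gen S α ⊔ cent K g := fun y => hid y
  have ho : ∀ x ∈ gen S α ⊔ cent K g, ∀ y ∈ gen S α ⊔ cent K g, Orth S x y := by
    have h1 : ∀ y ∈ gen S α, gen S α ⊔ cent K g ≤ orthTo S y := fun y hy =>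
      sup_le (fun x hx => nminus_orth (hN hx) (hN hy)) (fun x hx => (orth_central hx y).symm)
    intro x hx y hy
    exact Orth.symm ((sup_le (fun y hy => (Orth.symm (h1 y hy hx))) (fun y hy => (orth_central hy x).symm) :
      gen S α ⊔ cent K g ≤ orthTo S x) hy)
  have hab : ∀ x ∈ gen S α ⊔ cent K g, ∀ y ∈ gen S α ⊔ cent K g, ⁅x, y⁆ = 0 := by
    intro x hx y hy
    have h1 := lie_central_of_orth hid' ho hx hy
    have h2 : ⁅x, y⁆ ∈ wt S 0 := fun H => by rw [h1, LinearMap.zero_apply, zero_smul]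
    refine nminus_wt_zero ?_ h2
    obtain ⟨x₁, h₁, x₂, h₂, rfl⟩ := Submodule.mem_sup.1 hx
    obtain ⟨y₁, h₃, y₂, h₄, rfl⟩ := Submodule.mem_sup.1 hy
    rw [lie_add, mem_cent.1 h₄, add_zero, add_lie, ← lie_skew x₂, mem_cent.1 h₂, neg_zero, add_zero]
    exact nminus_lie (hN h₁) (hN h₃)
  refine hr.2 ((Submodule.eq_bot_iff _).2 fun f hf => ?_)
  refine wt_disj hr.1 hf (fun H => ?_)
  rw [central_of_abelian S hid' hab (Submodule.mem_sup_left (le_gen α hf)), LinearMap.zero_apply,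
    zero_smul]

/-- The radical of the eventual orthogonality relation. -/
def orthRad (S : Setup K g) : Submodule K g := ⨅ z, orthTo S z

lemma mem_orthRad {y : g} : y ∈ orthRad S ↔ ∀ z, Orth S y z := by
  rw [orthRad, Submodule.mem_iInf]
  rfl

lemma orthRad_ideal (u y : g) (hy : y ∈ orthRad S) : ⁅u, y⁆ ∈ orthRad S := by
  rw [mem_orthRad] at hy ⊢
  intro z
  filter_upwards [hy ⁅u, z⁆, ev_mem S u, ev_mem S y, ev_mem S z] with n h1 hu hyn hz
  rw [← lie_skew, map_neg, LinearMap.neg_apply, kap_lie S hyn hu hz, h1, neg_zero]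

lemma neg_isRt (S : Setup K g) {α : Module.Dual K S.h} (hα : IsRt S α) : IsRt S (-α) := by
  refine ⟨neg_ne_zero.2 hα.1, fun hbot => hα.2 ((Submodule.eq_bot_iff _).2 fun e he => ?_)⟩
  replace hbot : wt S (-α) = ⊥ := hbot
  have heJ : e ∈ orthRad S := by
    rw [mem_orthRad]
    have : (⊤ : Submodule K g) ≤ orthTo S e := by
      rw [← S.h_span]
      refine iSup_le fun ν y hy => ?_
      by_cases h : ν + α = 0
      · replace hy : y ∈ wt S ν := hy
        rw [eq_neg_of_add_eq_zero_left h, hbot, Submodule.mem_bot] at hy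
        rw [hy]
        exact zero_mem _
      · exact orth_wt h hy he
    exact fun z => Orth.symm (this Submodule.mem_top)
  have h1 : ∀ y : g, ⁅e, y⁆ ∈ ⨆ μ, ⨆ _ : μ ≠ (0 : Module.Dual K S.h), wt S μ := by
    intro y
    have : y ∈ ⨆ α : Module.Dual K S.h, wt S α := by rw [S.h_span]; trivial
    induction this using Submodule.iSup_induction' with
    | mem ν y hy =>
      by_cases h : α + ν = 0
      · rw [eq_neg_of_add_eq_zero_right h, hbot, Submodule.mem_bot] at hy
        rw [hy, lie_zero]
        exact zero_mem _
      · exact (le_iSup₂_of_le (α + ν) h le_rfl : wt S (α + ν) ≤ _) (wt_lie he hy)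
    | zero => rw [lie_zero]; exact zero_mem _
    | add a b _ _ ha hb => rw [lie_add]; exact add_mem ha hb
  have h2 : ∀ y ∈ orthRad S, ⁅e, y⁆ = 0 := by
    intro y hy
    have h3 := lie_central_of_orth (S := S) orthRad_ideal
      (fun x hx z _ => mem_orthRad.1 hx z) heJ hy
    exact Submodule.disjoint_def.1 (S.h_indep 0) _
      (fun H => by rw [h3, LinearMap.zero_apply, zero_smul]) (h1 y)
  let Z : Submodule K g :=
    { carrier := {u | u ∈ orthRad S ∧ ∀ y ∈ orthRad S, ⁅u, y⁆ = 0}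
      add_mem' := fun ha hb => ⟨add_mem ha.1 hb.1, fun y hy => by
        rw [add_lie, ha.2 y hy, hb.2 y hy, add_zero]⟩
      zero_mem' := ⟨zero_mem _, fun y _ => zero_lie y⟩
      smul_mem' := fun c x hx => ⟨Submodule.smul_mem _ c hx.1, fun y hy => by
        rw [smul_lie, hx.2 y hy, smul_zero]⟩ }
  have hZ : ∀ y : g, ∀ x ∈ Z, ⁅y, x⁆ ∈ Z := fun y x hx => ⟨orthRad_ideal y x hx.1, fun z hz => by
    rw [lie_lie, hx.2 z hz, lie_zero, hx.2 _ (orthRad_ideal y z hz), sub_zero]⟩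
  have h4 := central_of_abelian S hZ (fun x hx y hy => hx.2 y hy.1) (⟨heJ, h2⟩ : e ∈ Z)
  have h5 : e ∈ wt S 0 := fun H => by rw [h4, LinearMap.zero_apply, zero_smul]
  exact wt_disj hα.1 he h5

/-- Every simple root has an `sl₂`-triple. -/
lemma exists_triple (hD : S.IsDynkin) {α : Module.Dual K S.h} (hα : S.IsSimpleRoot α) :
    ∃ e ∈ wt S α, ∃ f ∈ wt S (-α), ∃ t : S.h, (t : g) = ⁅e, f⁆ ∧ α t = 2 := by
  obtain ⟨e, he, f, hf, t, ht, h⟩ := exists_coroot_of_neg hD hα (neg_isRt S (S.pos_root α hα.1))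
  refine ⟨e, he, (2 / α t) • f, Submodule.smul_mem _ _ hf, (2 / α t) • t, ?_, ?_⟩
  · rw [lie_smul, ← ht]
    rfl
  · rw [map_smul, smul_eq_mul, div_mul_cancel₀ _ h]

end Simple
end Str

namespace Str
attribute [local instance] LieRing.ofAssociativeRing
open Filter

section Int
variable {K M : Type} [Field K] [CharZero K] [AddCommGroup M] [Module K M] [FiniteDimensional K M]

lemma sl2_exists_int {h e f : Module.End K M} (hef : ∀ v, e (f v) = f (e v) + h v)
    (hf : ∀ v, h (f v) = f (h v) - (2 : K) • f v) (he : ∀ v, h (e v) = e (h v) + (2 : K) • e v)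
    {v : M} {μ : K} (hv : h v = μ • v) (hv0 : v ≠ 0) : ∃ z : ℤ, μ = z := by
  have hpow : ∀ n : ℕ, h ((e ^ n) v) = (μ + 2 * n) • (e ^ n) v := by
    intro n
    have := sl2_h_pow (h := -h) (f := e) (μ := -μ)
      (fun v => by simp only [LinearMap.neg_apply, he, map_neg]; abel)
      (by rw [LinearMap.neg_apply, hv, neg_smul] : (-h) v = -μ • v) n
    rw [LinearMap.neg_apply, neg_eq_iff_eq_neg, ← neg_smul] at this
    rw [this]
    congr 1
    ring
  have hex : ∃ n : ℕ, (e ^ n) v = 0 := by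
    by_contra! hc
    have hli := Module.End.eigenvectors_linearIndependent' h (fun n : ℕ => μ + 2 * n)
      (fun a b hab => by simpa using hab) (fun n => (e ^ n) v)
      (fun n => ⟨Module.End.mem_eigenspace_iff.2 (hpow n), hc n⟩)
    have := hli.finite
    exact not_finite ℕ
  obtain ⟨n, hn₁, hn₂⟩ := Nat.exists_not_and_succ_of_not_zero_of_exists (p := fun n => (e ^ n) v = 0)
    (by simpa using hv0) hex
  obtain ⟨k, hk, -⟩ := sl2_exists_nat hef hf (hpow n)
    (by rw [← Module.End.mul_apply, ← pow_succ']; exact hn₂) hn₁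
  exact ⟨k - 2 * n, by push_cast; rw [← hk]; ring⟩

lemma trace_sq_of_rat {T : Module.End K M} (hT : ⊤ ≤ ⨆ q : ℚ, T.eigenspace (q : K)) :
    ∃ r : ℚ, 0 ≤ r ∧ LinearMap.trace K M (T * T) = r ∧ (r = 0 → T = 0) := by
  have hs : ⊤ ≤ Submodule.span K {v : M | ∃ q : ℚ, T v = (q : K) • v} :=
    hT.trans (iSup_le fun q v hv => Submodule.subset_span ⟨q, Module.End.mem_eigenspace_iff.1 hv⟩)
  let b := Module.Basis.ofSpan hs
  have hb : ∀ i, ∃ q : ℚ, T (b i) = (q : K) • b i := fun i =>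
    Module.Basis.ofSpan_subset hs ⟨i, rfl⟩
  choose q hq using hb
  have : Fintype ((linearIndepOn_empty K id).extend
    (Set.empty_subset {v : M | ∃ q : ℚ, T v = (q : K) • v})) := FiniteDimensional.fintypeBasisIndex b
  classical
  refine ⟨∑ i, q i * q i, Finset.sum_nonneg fun i _ => mul_self_nonneg _, ?_, fun h => ?_⟩
  · rw [LinearMap.trace_eq_matrix_trace K b, Matrix.trace, Rat.cast_sum]
    refine Finset.sum_congr rfl fun i _ => ?_
    rw [Matrix.diag_apply, LinearMap.toMatrix_apply, Module.End.mul_apply, hq, map_smul, hq, smul_smul,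
      map_smul, b.repr_self]
    simp
  · refine b.ext fun i => ?_
    have := (Finset.sum_eq_zero_iff_of_nonneg fun i _ => mul_self_nonneg _).1 h i (Finset.mem_univ i)
    rw [hq, mul_self_eq_zero.1 this, Rat.cast_zero, zero_smul, LinearMap.zero_apply]

end Int

section Triples
variable {K g : Type} [Field K] [IsAlgClosed K] [CharZero K] [LieRing g] [LieAlgebra K g]
variable {S : Setup K g}

/-- An `sl₂`-triple for the root `α`. -/
structure IsTriple (S : Setup K g) (α : Module.Dual K S.h) (e f : g) (t : S.h) : Prop where
  he : e ∈ wt S α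
  hf : f ∈ wt S (-α)
  lie : ⁅e, f⁆ = t
  two : α t = 2

variable {α : Module.Dual K S.h} {e f : g} {t : S.h}

namespace IsTriple

lemma lie_e (T : IsTriple S α e f t) : ⁅(t : g), e⁆ = (2 : K) • e := by rw [T.he t, T.two]

lemma lie_f (T : IsTriple S α e f t) : ⁅(t : g), f⁆ = -((2 : K) • f) := by
  rw [T.hf t, LinearMap.neg_apply, T.two, neg_smul]

lemma t_ne (T : IsTriple S α e f t) : t ≠ 0 := by
  rintro rfl
  have := T.two
  rw [_root_.map_zero] at this
  exact two_ne_zero this.symm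

lemma e_ne (T : IsTriple S α e f t) : e ≠ 0 := by
  rintro rfl
  have := T.lie
  rw [zero_lie] at this
  exact T.t_ne (Subtype.ext this.symm)

lemma f_ne (T : IsTriple S α e f t) : f ≠ 0 := by
  rintro rfl
  have := T.lie
  rw [lie_zero] at this
  exact T.t_ne (Subtype.ext this.symm)

variable {n : ℕ}

lemma mem (T : IsTriple S α e f t) (he : e ∈ S.F n) (hf : f ∈ S.F n) : (t : g) ∈ S.F n := by
  rw [← T.lie]
  exact (S.F n).lie_mem he hf

lemma exists_int (T : IsTriple S α e f t) (he : e ∈ S.F n) (hf : f ∈ S.F n) {v : g} (hv : v ∈ S.F n)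
    (hv0 : v ≠ 0) {c : K} (h : ⁅(t : g), v⁆ = c • v) : ∃ z : ℤ, c = z := by
  refine sl2_exists_int (h := LieAlgebra.ad K (S.F n) ⟨t, T.mem he hf⟩)
    (e := LieAlgebra.ad K (S.F n) ⟨e, he⟩) (f := LieAlgebra.ad K (S.F n) ⟨f, hf⟩)
    (v := (⟨v, hv⟩ : S.F n)) ?_ ?_ ?_ (Subtype.ext h) (fun h => hv0 (congrArg Subtype.val h))
  · intro v
    refine Subtype.ext (?_ : ⁅e, ⁅f, (v : g)⁆⁆ = ⁅f, ⁅e, (v : g)⁆⁆ + ⁅(t : g), (v : g)⁆)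
    rw [leibniz_lie, T.lie, add_comm]
  · intro v
    refine Subtype.ext (?_ : ⁅(t : g), ⁅f, (v : g)⁆⁆ = ⁅f, ⁅(t : g), (v : g)⁆⁆ - (2 : K) • ⁅f, (v : g)⁆)
    rw [leibniz_lie, T.lie_f, neg_lie, smul_lie]
    abel
  · intro v
    refine Subtype.ext (?_ : ⁅(t : g), ⁅e, (v : g)⁆⁆ = ⁅e, ⁅(t : g), (v : g)⁆⁆ + (2 : K) • ⁅e, (v : g)⁆)
    rw [leibniz_lie, T.lie_e, smul_lie]
    abel

lemma exists_nat (T : IsTriple S α e f t) {v : g} (hv0 : v ≠ 0) {c : K} (h : ⁅(t : g), v⁆ = c • v)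
    (hev : ⁅e, v⁆ = 0) : ∃ z : ℕ, c = z := by
  obtain ⟨n, he, hf, hv⟩ := ((ev_mem S e).and ((ev_mem S f).and (ev_mem S v))).exists
  obtain ⟨k, hk, -⟩ := sl2_exists_nat (h := LieAlgebra.ad K (S.F n) ⟨t, T.mem he hf⟩)
    (e := LieAlgebra.ad K (S.F n) ⟨e, he⟩) (f := LieAlgebra.ad K (S.F n) ⟨f, hf⟩)
    (v := (⟨v, hv⟩ : S.F n)) (by
      intro v
      refine Subtype.ext (?_ : ⁅e, ⁅f, (v : g)⁆⁆ = ⁅f, ⁅e, (v : g)⁆⁆ + ⁅(t : g), (v : g)⁆)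
      rw [leibniz_lie, T.lie, add_comm]) (by
      intro v
      refine Subtype.ext (?_ : ⁅(t : g), ⁅f, (v : g)⁆⁆ = ⁅f, ⁅(t : g), (v : g)⁆⁆ - (2 : K) • ⁅f, (v : g)⁆)
      rw [leibniz_lie, T.lie_f, neg_lie, smul_lie]
      abel) (Subtype.ext h) (Subtype.ext hev) (fun h => hv0 (congrArg Subtype.val h))
  exact ⟨k, hk⟩

lemma root_int (T : IsTriple S α e f t) {β : Module.Dual K S.h} (hβ : IsRt S β) : ∃ z : ℤ, β t = z := by
  obtain ⟨v, hv, hv0⟩ := Submodule.exists_mem_ne_zero_of_ne_bot hβ.2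
  obtain ⟨n, he, hf, hvn⟩ := ((ev_mem S e).and ((ev_mem S f).and (ev_mem S v))).exists
  exact T.exists_int he hf hvn hv0 (hv t)

/-- If `β t` is a negative integer, then `β + α` is a weight. -/
lemma add_ne_bot (T : IsTriple S α e f t) {β : Module.Dual K S.h} (hβ : IsRt S β) {z : ℤ} (hz : z < 0)
    (h : β t = z) : wt S (β + α) ≠ ⊥ := by
  intro hbot
  obtain ⟨v, hv, hv0⟩ := Submodule.exists_mem_ne_zero_of_ne_bot hβ.2
  have h1 : ⁅e, v⁆ ∈ wt S (α + β) := wt_lie T.he hv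
  rw [add_comm, hbot, Submodule.mem_bot] at h1
  obtain ⟨k, hk⟩ := T.exists_nat hv0 (hv t) h1
  rw [h] at hk
  have : z = (k : ℤ) := by exact_mod_cast hk
  lia

lemma simple_nonpos (T : IsTriple S α e f t) (hα : S.IsSimpleRoot α) {β : Module.Dual K S.h}
    (hβ : S.IsSimpleRoot β) (hαβ : α ≠ β) : ∃ k : ℕ, β t = -(k : K) := by
  obtain ⟨v, hv, hv0⟩ := Submodule.exists_mem_ne_zero_of_ne_bot (neg_isRt S (S.pos_root β hβ.1)).2
  obtain ⟨k, hk⟩ := T.exists_nat hv0 (hv t) (lie_eq_zero_of_simple hα hβ hαβ T.he hv)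
  exact ⟨k, by rw [← hk, LinearMap.neg_apply, neg_neg]⟩

lemma kap_t (T : IsTriple S α e f t) (he : e ∈ S.F n) (hf : f ∈ S.F n) {H : S.h} (hH : (H : g) ∈ S.F n) :
    kap S n t H = α H * kap S n e f := by
  rw [← T.lie, kap_lie S he hf hH, ← lie_skew, T.hf H, LinearMap.neg_apply, neg_smul, neg_neg, map_smul,
    smul_eq_mul]

end IsTriple

/-- Elements of `h` with rational eigenvalues have nonnegative Killing norm. -/
lemma kap_self {n : ℕ} {x : S.h} (hx : (x : g) ∈ S.F n)
    (hq : ∀ v : g, v ∈ S.F n → v ≠ 0 → (∀ H : S.h, (H : g) ∈ S.F n → ∃ c : K, ⁅(H : g), v⁆ = c • v) →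
      ∃ q : ℚ, ⁅(x : g), v⁆ = (q : K) • v) :
    ∃ r : ℚ, 0 ≤ r ∧ kap S n x x = r ∧
      (r = 0 → (∀ y ∈ S.F n, ⁅(x : g), y⁆ = 0) ∧ ∀ y ∈ S.F n, kap S n x y = 0) := by
  obtain ⟨r, h0, h1, h2⟩ := trace_sq_of_rat (T := LieAlgebra.ad K (S.F n) ⟨x, hx⟩) (by
    refine (iSup_jointWt S n).trans (iSup_le fun χ => ?_)
    by_cases hb : jointWt K {t : S.F n | (t : g) ∈ S.h} χ = ⊥
    · rw [hb]; exact bot_le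
    obtain ⟨v, hv, hv0⟩ := Submodule.exists_mem_ne_zero_of_ne_bot hb
    rw [mem_jointWt] at hv
    obtain ⟨q, hq⟩ := hq v v.2 (fun h => hv0 (Subtype.ext h)) (fun H hH =>
      ⟨_, congrArg Subtype.val (hv ⟨⟨H, hH⟩, H.2⟩)⟩)
    have h3 : ⁅(x : g), (v : g)⁆ = χ ⟨⟨x, hx⟩, x.2⟩ • (v : g) :=
      congrArg Subtype.val (hv ⟨⟨x, hx⟩, x.2⟩)
    have h4 : χ ⟨⟨x, hx⟩, x.2⟩ = q := smul_left_injective K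
      (fun h => hv0 (Subtype.ext h) : (v : g) ≠ 0) (h3.symm.trans hq)
    refine le_iSup_of_le q ?_
    rw [← h4]
    intro u hu
    exact Module.End.mem_eigenspace_iff.2 (mem_jointWt.1 hu ⟨⟨x, hx⟩, x.2⟩))
  refine ⟨r, h0, ?_, fun h => ⟨fun y hy => ?_, fun y hy => ?_⟩⟩
  · rw [kap_apply S hx hx, killingForm_apply_apply, ← h1]
    rfl
  · exact congrArg Subtype.val (LinearMap.congr_fun (h2 h) ⟨y, hy⟩)
  · rw [kap_apply S hx hy, killingForm_apply_apply, h2 h, LinearMap.zero_comp, _root_.map_zero]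

lemma IsTriple.kap_pos (T : IsTriple S α e f t) {n : ℕ} (he : e ∈ S.F n) (hf : f ∈ S.F n) :
    ∃ r : ℚ, 0 < r ∧ kap S n e f = r := by
  have ht := T.mem he hf
  obtain ⟨r, h0, h1, h2⟩ := kap_self (x := t) ht (fun v hv hv0 hH => by
    obtain ⟨c, hc⟩ := hH t ht
    obtain ⟨z, rfl⟩ := T.exists_int he hf hv hv0 hc
    exact ⟨z, by simpa using hc⟩)
  rw [T.kap_t he hf ht, T.two] at h1
  refine ⟨r / 2, ?_, ?_⟩
  · rcases h0.lt_or_eq with h | h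
    · positivity
    · have := (h2 h.symm).1 e he
      rw [T.lie_e] at this
      exact absurd this (smul_ne_zero two_ne_zero T.e_ne)
  · push_cast
    rw [← h1]
    ring

end Triples
end Str

namespace Str
attribute [local instance] LieRing.ofAssociativeRing
open Filter

section Decomp
variable {K g : Type} [Field K] [IsAlgClosed K] [CharZero K] [LieRing g] [LieAlgebra K g]
variable {S : Setup K g}
variable {e f : Module.Dual K S.h → g} {t : Module.Dual K S.h → S.h}

lemma sum_eq_zero_of_nonpos (hT : ∀ α, S.IsSimpleRoot α → IsTriple S α (e α) (f α) (t α))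
    {a : Multiset (Module.Dual K S.h)} (ha : ∀ α ∈ a, S.IsSimpleRoot α)
    (h : ∀ α ∈ a, ∃ q : ℚ, q ≤ 0 ∧ a.sum (t α) = q) : a.sum = 0 := by
  classical
  refine LinearMap.ext fun H => ?_
  have hev : ∀ᶠ n in atTop, ∀ α ∈ a.toFinset, e α ∈ S.F n ∧ f α ∈ S.F n := by
    rw [eventually_all_finset]
    exact fun α _ => (ev_mem S _).and (ev_mem S _)
  obtain ⟨n, hn, hH⟩ := (hev.and (ev_mem S (H : g))).exists
  replace hn : ∀ α ∈ a, e α ∈ S.F n ∧ f α ∈ S.F n := fun α hα => hn α (Multiset.mem_toFinset.2 hα)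
  have hd : ∀ α, ∃ r : ℚ, α ∈ a → 0 < r ∧ kap S n (e α) (f α) = r := fun α => by
    by_cases hα : α ∈ a
    · obtain ⟨r, hr⟩ := (hT α (ha α hα)).kap_pos (hn α hα).1 (hn α hα).2
      exact ⟨r, fun _ => hr⟩
    · exact ⟨0, fun h => absurd h hα⟩
  choose d hd using hd
  let X : Multiset (Module.Dual K S.h) → S.h := fun s => (s.map fun α => ((d α)⁻¹ : K) • t α).sum
  have hX0 : X 0 = 0 := rfl
  have hXc : ∀ α s, X (α ::ₘ s) = ((d α)⁻¹ : K) • t α + X s := fun α s => by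
    simp only [X, Multiset.map_cons, Multiset.sum_cons]
  have hXF : ∀ s ≤ a, (X s : g) ∈ S.F n := by
    intro s
    induction s using Multiset.induction_on with
    | empty => intro _; rw [hX0]; exact (S.F n).zero_mem
    | cons α s ih =>
      intro hs
      have hα := Multiset.mem_of_le hs (Multiset.mem_cons_self α s)
      rw [hXc]
      exact (S.F n).add_mem ((S.F n).smul_mem _ ((hT α (ha α hα)).mem (hn α hα).1 (hn α hα).2))
        (ih ((Multiset.le_cons_self s α).trans hs))
  have hκ : ∀ s ≤ a, ∀ H : S.h, (H : g) ∈ S.F n → kap S n (X s) H = s.sum H := by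
    intro s
    induction s using Multiset.induction_on with
    | empty => intro _ H _; rw [hX0]; simp
    | cons α s ih =>
      intro hs H hH
      have hα := Multiset.mem_of_le hs (Multiset.mem_cons_self α s)
      obtain ⟨h1, h2⟩ := hd α hα
      have h3 : ((d α : ℚ) : K) ≠ 0 := by exact_mod_cast h1.ne'
      have h4 : ((((d α)⁻¹ : K) • t α + X s : S.h) : g) = ((d α)⁻¹ : K) • (t α : g) + (X s : g) := rfl
      rw [hXc, h4, map_add, LinearMap.add_apply, ih ((Multiset.le_cons_self s α).trans hs) H hH, map_smul,
        LinearMap.smul_apply, (hT α (ha α hα)).kap_t (hn α hα).1 (hn α hα).2 hH, h2,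
        Multiset.sum_cons, LinearMap.add_apply, smul_eq_mul, mul_comm (α H), inv_mul_cancel_left₀ h3]
  have hval : ∀ s ≤ a, ∃ q : ℚ, q ≤ 0 ∧ a.sum (X s) = q := by
    intro s
    induction s using Multiset.induction_on with
    | empty => exact fun _ => ⟨0, le_rfl, by rw [hX0]; simp⟩
    | cons α s ih =>
      intro hs
      have hα := Multiset.mem_of_le hs (Multiset.mem_cons_self α s)
      obtain ⟨q, hq, hq'⟩ := ih ((Multiset.le_cons_self s α).trans hs)
      obtain ⟨p, hp, hp'⟩ := h α hα
      refine ⟨(d α)⁻¹ * p + q, add_nonpos (mul_nonpos_of_nonneg_of_nonpos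
        (inv_nonneg.2 (hd α hα).1.le) hp) hq, ?_⟩
      rw [hXc, map_add, map_smul, hp', hq', smul_eq_mul]
      push_cast
      rfl
  have hrat : ∀ v : g, v ∈ S.F n → v ≠ 0 → (∀ H : S.h, (H : g) ∈ S.F n → ∃ c : K, ⁅(H : g), v⁆ = c • v) →
      ∀ s ≤ a, ∃ q : ℚ, ⁅(X s : g), v⁆ = (q : K) • v := by
    intro v hv hv0 hH s
    induction s using Multiset.induction_on with
    | empty => exact fun _ => ⟨0, by rw [hX0]; simp⟩
    | cons α s ih =>
      intro hs
      have hα := Multiset.mem_of_le hs (Multiset.mem_cons_self α s)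
      obtain ⟨q, hq⟩ := ih ((Multiset.le_cons_self s α).trans hs)
      have hTα := hT α (ha α hα)
      obtain ⟨c, hc⟩ := hH (t α) (hTα.mem (hn α hα).1 (hn α hα).2)
      obtain ⟨z, rfl⟩ := hTα.exists_int (hn α hα).1 (hn α hα).2 hv hv0 hc
      have h4 : ((((d α)⁻¹ : K) • t α + X s : S.h) : g) = ((d α)⁻¹ : K) • (t α : g) + (X s : g) := rfl
      refine ⟨(d α)⁻¹ * z + q, ?_⟩
      rw [hXc, h4, add_lie, smul_lie, hc, hq, smul_smul, ← add_smul]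
      push_cast
      rfl
  obtain ⟨r, h0, h1, h2⟩ := kap_self (hXF a le_rfl) fun v hv hv0 hH => hrat v hv hv0 hH a le_rfl
  obtain ⟨q, hq, hq'⟩ := hval a le_rfl
  rw [hκ a le_rfl (X a) (hXF a le_rfl), hq'] at h1
  have h3 : q = r := by exact_mod_cast h1
  have h4 := (h2 (le_antisymm (h3 ▸ hq) h0)).2 H hH
  rw [hκ a le_rfl H hH] at h4
  exact h4

lemma sum_add_pos_ne_zero (hT : ∀ α, S.IsSimpleRoot α → IsTriple S α (e α) (f α) (t α)) (k : ℕ) :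
    ∀ (a : Multiset (Module.Dual K S.h)), Multiset.card a = k → (∀ α ∈ a, S.IsSimpleRoot α) →
      ∀ β ∈ S.pos, β + a.sum ≠ 0 := by
  induction k with
  | zero =>
    intro a ha _ β hβ h
    rw [Multiset.card_eq_zero.1 ha, Multiset.sum_zero, add_zero] at h
    exact (S.pos_root β hβ).1 h
  | succ k ih =>
    intro a hk ha β hβ h
    have hsum : a.sum = -β := eq_neg_of_add_eq_zero_right h
    by_cases hneg : ∃ α ∈ a, ∃ z : ℤ, z < 0 ∧ β (t α) = z
    · obtain ⟨α, hα, z, hz, hz'⟩ := hneg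
      have h1 := (hT α (ha α hα)).add_ne_bot (S.pos_root β hβ) hz hz'
      obtain ⟨a', rfl⟩ := Multiset.exists_cons_of_mem hα
      by_cases h0 : β + α = 0
      · rw [eq_neg_of_add_eq_zero_left h0] at hβ
        exact neg_notMem_pos (ha α hα).1 hβ
      · refine ih a' (by simpa using hk) (fun γ hγ => ha γ (Multiset.mem_cons_of_mem hγ)) (β + α)
          (S.pos_add β hβ α (ha α hα).1 ⟨h0, h1⟩) ?_
        rw [← h, Multiset.sum_cons, add_assoc]
    · push Not at hneg
      have := sum_eq_zero_of_nonpos hT ha fun α hα => by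
        obtain ⟨z, hz⟩ := (hT α (ha α hα)).root_int (S.pos_root β hβ)
        refine ⟨-z, ?_, by rw [hsum, LinearMap.neg_apply, hz]; push_cast; rfl⟩
        by_contra! hlt
        exact hneg α hα z (by have : (0 : ℚ) < -(z : ℚ) := hlt
                              have : (z : ℚ) < 0 := by linarith
                              exact_mod_cast this) hz
      rw [this, add_zero] at h
      exact (S.pos_root β hβ).1 h

lemma eq_zero_of_sum_eq_zero (hT : ∀ α, S.IsSimpleRoot α → IsTriple S α (e α) (f α) (t α))
    {a : Multiset (Module.Dual K S.h)} (ha : ∀ α ∈ a, S.IsSimpleRoot α) (h : a.sum = 0) : a = 0 := by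
  by_contra h0
  obtain ⟨α, hα⟩ := Multiset.exists_mem_of_ne_zero h0
  obtain ⟨a', rfl⟩ := Multiset.exists_cons_of_mem hα
  rw [Multiset.sum_cons] at h
  exact sum_add_pos_ne_zero hT _ a' rfl (fun γ hγ => ha γ (Multiset.mem_cons_of_mem hγ)) α (ha α hα).1 h

/-- Decompositions into simple roots are unique. -/
lemma eq_of_sum_eq (hD : S.IsDynkin) {a b : Multiset (Module.Dual K S.h)}
    (ha : ∀ α ∈ a, S.IsSimpleRoot α) (hb : ∀ α ∈ b, S.IsSimpleRoot α) (h : a.sum = b.sum) : a = b := by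
  classical
  have hex : ∀ α, ∃ p : g × g × S.h, S.IsSimpleRoot α → IsTriple S α p.1 p.2.1 p.2.2 := fun α => by
    by_cases hα : S.IsSimpleRoot α
    · obtain ⟨e, he, f, hf, t, ht, h2⟩ := exists_triple hD hα
      exact ⟨⟨e, f, t⟩, fun _ => ⟨he, hf, ht.symm, h2⟩⟩
    · exact ⟨0, fun h => absurd h hα⟩
  choose p hT using hex
  have hdis : ∀ γ, γ ∈ a - b → γ ∉ b - a := fun γ h1 h2 => by
    rw [← Multiset.count_pos, Multiset.count_sub] at h1 h2
    lia
  have ha' : ∀ γ ∈ a - b, S.IsSimpleRoot γ := fun γ hγ => ha γ (Multiset.mem_of_le (Multiset.sub_le_self _ _) hγ)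
  have hb' : ∀ γ ∈ b - a, S.IsSimpleRoot γ := fun γ hγ => hb γ (Multiset.mem_of_le (Multiset.sub_le_self _ _) hγ)
  have hsum : (a - b).sum = (b - a).sum := by
    have h1 : a - b + b = b - a + a := by
      ext γ
      rw [Multiset.count_add, Multiset.count_add, Multiset.count_sub, Multiset.count_sub]
      lia
    have h2 := congrArg Multiset.sum h1
    rw [Multiset.sum_add, Multiset.sum_add, h] at h2
    exact add_right_cancel h2
  have hval : ∀ γ ∈ a - b, ∀ s ≤ b - a, ∃ q : ℚ, q ≤ 0 ∧ s.sum (p γ).2.2 = q := by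
    intro γ hγ s
    induction s using Multiset.induction_on with
    | empty => exact fun _ => ⟨0, le_rfl, by simp⟩
    | cons δ s ih =>
      intro hs
      have hδ := Multiset.mem_of_le hs (Multiset.mem_cons_self δ s)
      obtain ⟨q, hq, hq'⟩ := ih ((Multiset.le_cons_self s δ).trans hs)
      obtain ⟨k, hk⟩ := (hT γ (ha' γ hγ)).simple_nonpos (ha' γ hγ) (hb' δ hδ)
        (fun h => hdis γ hγ (h ▸ hδ))
      refine ⟨-k + q, ?_, ?_⟩
      · have : (0 : ℚ) ≤ k := Nat.cast_nonneg k
        linarith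
      · rw [Multiset.sum_cons, LinearMap.add_apply, hk, hq']
        push_cast
        rfl
  have h0 : (a - b).sum = 0 := sum_eq_zero_of_nonpos (S := S) hT ha' fun γ hγ => by
    rw [hsum]
    exact hval γ hγ _ le_rfl
  have h1 := eq_zero_of_sum_eq_zero (S := S) hT ha' h0
  have h2 := eq_zero_of_sum_eq_zero (S := S) hT hb' (hsum ▸ h0)
  exact le_antisymm (tsub_eq_zero_iff_le.1 h1) (tsub_eq_zero_iff_le.1 h2)

/-- Every positive root is a sum of simple roots. -/
lemma exists_decomp (hD : S.IsDynkin) {α : Module.Dual K S.h} (hα : α ∈ S.pos) :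
    ∃ a : Multiset (Module.Dual K S.h), (∀ β ∈ a, S.IsSimpleRoot β) ∧ a.sum = α := by
  let G : AddSubmonoid (Module.Dual K S.h) := AddSubmonoid.closure {β | S.IsSimpleRoot β}
  have hG : α ∈ G := by
    by_contra hG
    let N : Submodule K g := ⨆ β : G, wt S β
    have hle : ∀ β ∈ G, wt S β ≤ N := fun β hβ => le_iSup (fun β : G => wt S β) ⟨β, hβ⟩
    let T : LieSubalgebra K g :=
      { N with
        lie_mem' := fun {x y} hx hy => by
          replace hx : x ∈ N := hx
          replace hy : y ∈ N := hy
          have key : ∀ β ∈ G, ∀ x ∈ wt S β, ⁅x, y⁆ ∈ N := by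
            intro β hβ x hx
            induction hy using Submodule.iSup_induction' with
            | mem γ y hy => exact hle (β + γ) (add_mem hβ γ.2) (wt_lie hx hy)
            | zero => rw [lie_zero]; exact zero_mem _
            | add a b _ _ ha hb => rw [lie_add]; exact add_mem ha hb
          change ⁅x, y⁆ ∈ N
          induction hx using Submodule.iSup_induction' with
          | mem γ x hx => exact key γ γ.2 x hx
          | zero => rw [zero_lie]; exact zero_mem _
          | add a b _ _ ha hb => rw [add_lie]; exact add_mem ha hb }
    have hb : S.b ≤ T := by
      rw [hD, LieSubalgebra.lieSpan_le]
      refine Set.union_subset (fun x hx => hle 0 (zero_mem _) (mem_wt_zero.2 hx))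
        (Set.iUnion₂_subset fun β hβ => hle β (AddSubmonoid.subset_closure hβ))
    refine (S.pos_root α hα).2 ((Submodule.eq_bot_iff _).2 fun x hx => ?_)
    have h1 : x ∈ N := hb (wt_le_of_pos hα hx)
    refine Submodule.disjoint_def.1 (S.h_indep α) x hx ((iSup_le fun β => ?_ : N ≤ _) h1)
    exact le_iSup₂_of_le β.1 (fun h => hG (h ▸ β.2)) le_rfl
  obtain ⟨a, ha, hs⟩ := AddSubmonoid.exists_multiset_of_mem_closure hG
  exact ⟨a, ha, hs⟩

end Decomp
end Str

namespace Str
attribute [local instance] LieRing.ofAssociativeRing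
open PBW

section Verma
variable {K g : Type} [Field K] [IsAlgClosed K] [CharZero K] [LieRing g] [LieAlgebra K g]
variable {S : Setup K g}

local notation "U" => UniversalEnvelopingAlgebra K g
local notation "ιU" => UniversalEnvelopingAlgebra.ι K (L := g)

lemma ι_mul_ι_mul (x y : g) (u : U) : ιU x * (ιU y * u) = ιU ⁅x, y⁆ * u + ιU y * (ιU x * u) := by
  rw [LieHom.map_lie, LieRing.of_associative_ring_bracket, sub_mul, mul_assoc, mul_assoc, sub_add_cancel]

/-- The sum of the nonzero weight spaces. -/
def offDiag (S : Setup K g) : Submodule K g := ⨆ μ, ⨆ _ : μ ≠ (0 : Module.Dual K S.h), wt S μ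

lemma wt_le_offDiag {μ : Module.Dual K S.h} (h : μ ≠ 0) : wt S μ ≤ offDiag S := le_iSup₂_of_le μ h le_rfl

lemma isCompl_offDiag (S : Setup K g) : IsCompl S.h.toSubmodule (offDiag S) := by
  have h0 : wt S 0 = S.h.toSubmodule := Submodule.ext fun x => mem_wt_zero
  rw [← h0]
  refine ⟨S.h_indep 0, codisjoint_iff.2 (top_le_iff.1 ?_)⟩
  rw [← S.h_span]
  refine iSup_le fun μ => ?_
  by_cases h : μ = 0
  · rw [h]; exact le_sup_left
  · exact (wt_le_offDiag h).trans le_sup_right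

/-- The extension of a weight by zero on the root spaces. -/
def extend (lam : Module.Dual K S.h) : g →ₗ[K] K := LinearMap.ofIsCompl (isCompl_offDiag S) lam 0

lemma extend_h (lam : Module.Dual K S.h) (H : S.h) : extend lam H = lam H :=
  LinearMap.ofIsCompl_apply_left (isCompl_offDiag S) (φ := lam) H

lemma extend_offDiag (lam : Module.Dual K S.h) {x : g} (hx : x ∈ offDiag S) : extend lam x = 0 :=
  LinearMap.ofIsCompl_apply_right (isCompl_offDiag S) (φ := lam) ⟨x, hx⟩

lemma nplus_le_offDiag : S.nplus ≤ offDiag S :=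
  iSup₂_le fun _ hα => wt_le_offDiag (S.pos_root _ hα).1

lemma extend_nplus (lam : Module.Dual K S.h) {x : g} (hx : x ∈ S.nplus) : extend lam x = 0 :=
  extend_offDiag lam (nplus_le_offDiag hx)

lemma mem_b_iff {y : g} : y ∈ S.b ↔ ∃ H : S.h, ∃ x ∈ S.nplus, (H : g) + x = y := by
  rw [← LieSubalgebra.mem_toSubmodule, S.b_eq]
  constructor
  · intro h
    obtain ⟨H, hH, x, hx, rfl⟩ := Submodule.mem_sup.1 h
    exact ⟨⟨H, hH⟩, x, hx, rfl⟩
  · rintro ⟨H, x, hx, rfl⟩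
    exact add_mem (Submodule.mem_sup_left H.2) (Submodule.mem_sup_right hx)

lemma h_lie_nplus (H : S.h) {x : g} (hx : x ∈ S.nplus) : ⁅(H : g), x⁆ ∈ offDiag S := by
  have : S.nplus ≤ (offDiag S).comap (LieAlgebra.ad K g (H : g)) := by
    refine iSup₂_le fun α hα x hx => ?_
    rw [Submodule.mem_comap, LieAlgebra.ad_apply, hx H]
    exact Submodule.smul_mem _ _ (wt_le_offDiag (S.pos_root _ hα).1 hx)
  exact this hx

lemma nplus_lie {x y : g} (hx : x ∈ S.nplus) (hy : y ∈ S.nplus) : ⁅x, y⁆ ∈ offDiag S := by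
  have h1 : ∀ α ∈ S.pos, ∀ x ∈ wt S α, ∀ y ∈ S.nplus, ⁅x, y⁆ ∈ offDiag S := by
    intro α hα x hx y hy
    have : S.nplus ≤ (offDiag S).comap (LieAlgebra.ad K g x) := by
      refine iSup₂_le fun β hβ y hy => ?_
      refine wt_le_offDiag (fun h => ?_) (wt_lie hx hy)
      rw [eq_neg_of_add_eq_zero_right h] at hβ
      exact neg_notMem_pos hα hβ
    exact this hy
  have : S.nplus ≤ (offDiag S).comap (LieAlgebra.ad K g y) := by
    refine iSup₂_le fun α hα x hx => ?_
    rw [Submodule.mem_comap, LieAlgebra.ad_apply, ← lie_skew]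
    exact neg_mem (h1 α hα x hx y hy)
  have := this hx
  rw [Submodule.mem_comap, LieAlgebra.ad_apply, ← lie_skew] at this
  exact neg_mem_iff.1 this

lemma extend_lie (lam : Module.Dual K S.h) : ∀ y ∈ S.b, ∀ y' ∈ S.b, extend lam ⁅y, y'⁆ = 0 := by
  intro y hy y' hy'
  obtain ⟨H, x, hx, rfl⟩ := mem_b_iff.1 hy
  obtain ⟨H', x', hx', rfl⟩ := mem_b_iff.1 hy'
  refine extend_offDiag lam ?_
  rw [add_lie, lie_add, lie_add, h_lie S H.2 H'.2, zero_add, ← lie_skew x (H' : g)]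
  exact add_mem (h_lie_nplus H hx') (add_mem (neg_mem (h_lie_nplus H' hx)) (nplus_lie hx hx'))

lemma vermaIdeal_eq (lam : Module.Dual K S.h) : S.vermaIdeal lam = charIdeal S.b (extend lam) := by
  refine le_antisymm (Submodule.span_le.2 ?_) (Submodule.span_le.2 ?_)
  · rintro _ (⟨x, hx, rfl⟩ | ⟨H, rfl⟩)
    · refine Submodule.subset_span ⟨x, mem_b_iff.2 ⟨0, x, hx, by simp⟩, ?_⟩
      rw [extend_nplus lam hx, _root_.map_zero, sub_zero]
    · refine Submodule.subset_span ⟨H, mem_b_iff.2 ⟨H, 0, zero_mem _, by simp⟩, ?_⟩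
      rw [extend_h]
  · rintro _ ⟨y, hy, rfl⟩
    obtain ⟨H, x, hx, rfl⟩ := mem_b_iff.1 hy
    rw [map_add, map_add, extend_h, extend_nplus lam hx, add_zero, add_sub_right_comm]
    exact add_mem (Submodule.subset_span (Or.inr ⟨H, rfl⟩)) (Submodule.subset_span (Or.inl ⟨x, hx, rfl⟩))

lemma verma_inf_ne_bot {lam : Module.Dual K S.h} {I : Submodule U U} (hI : I = charIdeal S.b (extend lam))
    {N₁ N₂ : Submodule U (U ⧸ I)} (h₁ : N₁ ≠ ⊥) (h₂ : N₂ ≠ ⊥) : N₁ ⊓ N₂ ≠ ⊥ := by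
  subst hI
  exact inf_ne_bot S.F_mono S.F_exhaust S.F_findim (extend_lie lam) h₁ h₂

/-- The elements of weight `μ` modulo a left ideal. -/
def Wt (I : Submodule U U) (μ : Module.Dual K S.h) : Submodule K U where
  carrier := {u | ∀ H : S.h, ιU (H : g) * u - μ H • u ∈ I}
  add_mem' := fun {a b} ha hb H => by
    rw [mul_add, smul_add, add_sub_add_comm]
    exact add_mem (ha H) (hb H)
  zero_mem' := fun H => by rw [mul_zero, smul_zero, sub_zero]; exact zero_mem _
  smul_mem' := fun c u hu H => by
    rw [mul_smul_comm, smul_comm, ← smul_sub]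
    exact I.smul_of_tower_mem c (hu H)

lemma mem_Wt {I : Submodule U U} {μ : Module.Dual K S.h} {u : U} :
    u ∈ Wt I μ ↔ ∀ H : S.h, ιU (H : g) * u - μ H • u ∈ I := Iff.rfl

lemma mem_Wt_of_mem {I : Submodule U U} (μ : Module.Dual K S.h) {u : U} (hu : u ∈ I) : u ∈ Wt I μ := fun _ =>
  sub_mem (I.smul_mem _ hu) (I.smul_of_tower_mem _ hu)

lemma ι_mul_mem_Wt {I : Submodule U U} {μ α : Module.Dual K S.h} {x : g}
    (hx : x ∈ wt S α) {u : U} (hu : u ∈ Wt I μ) :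
    ιU x * u ∈ Wt I (μ + α) := by
  intro H
  rw [ι_mul_ι_mul, hx H, map_smul, smul_mul_assoc, LinearMap.add_apply, add_smul]
  have h1 := I.smul_mem (ιU x) (hu H)
  rw [smul_eq_mul, mul_sub, mul_smul_comm] at h1
  convert h1 using 1
  abel

/-- The multisets of simple roots. -/
abbrev SimpleSum (S : Setup K g) : Type :=
  {a : Multiset (Module.Dual K S.h) // ∀ β ∈ a, S.IsSimpleRoot β}

/-- The subspace spanned by the elements of weight `lam - a.sum`. -/
def wtSpan (I : Submodule U U) (lam : Module.Dual K S.h) : Submodule K U :=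
  ⨆ a : SimpleSum S, Wt I (lam - a.1.sum)

/-- A subspace that is stable under `h` and contains an element outside of `I` contains a weight element
outside of `I`. -/
lemma exists_weight {I : Submodule U U} {lam : Module.Dual K S.h} {Q : Submodule K U}
    (hQ : ∀ H : S.h, ∀ u ∈ Q, ιU (H : g) * u ∈ Q)
    (hIQ : ∀ u ∈ I, u ∈ Q) {u : U} (hu : u ∈ wtSpan I lam) (huQ : u ∈ Q) (huI : u ∉ I) :
    ∃ a : SimpleSum S, ∃ w ∈ Wt I (lam - a.1.sum), w ∈ Q ∧ w ∉ I := by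
  classical
  obtain ⟨c, hc, rfl⟩ := (Submodule.mem_iSup_iff_exists_finsupp _ _).1 hu
  have key : ∀ (s : Finset (SimpleSum S)) (c : SimpleSum S → U), (∀ i, c i ∈ Wt I (lam - i.1.sum)) →
      ∑ i ∈ s, c i ∈ Q → ∑ i ∈ s, c i ∉ I →
      ∃ a : SimpleSum S, ∃ w ∈ Wt I (lam - a.1.sum), w ∈ Q ∧ w ∉ I := by
    intro s
    induction s using Finset.induction_on with
    | empty => exact fun c _ _ h => absurd (zero_mem I) h
    | insert a s ha ih =>
      intro c hc hcQ hcI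
      by_cases hall : ∑ i ∈ insert a s, c i ∈ Wt I (lam - a.1.sum)
      · exact ⟨a, _, hall, hcQ, hcI⟩
      rw [mem_Wt] at hall
      push Not at hall
      obtain ⟨H, hH⟩ := hall
      set D : U →ₗ[K] U := LinearMap.mulLeft K (ιU (H : g)) - (lam - a.1.sum) H • LinearMap.id with hD
      have hDa : ∀ u, D u = ιU (H : g) * u - (lam - a.1.sum) H • u := fun u => rfl
      have h1 : D (∑ i ∈ insert a s, c i) = D (c a) + ∑ i ∈ s, D (c i) := by
        rw [map_sum, Finset.sum_insert ha]
      have h2 : D (c a) ∈ I := hc a H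
      have h3 : D (∑ i ∈ insert a s, c i) ∈ Q := sub_mem (hQ H _ hcQ) (Q.smul_mem _ hcQ)
      rw [← hDa, h1] at hH
      rw [h1] at h3
      refine ih (fun i => D (c i)) (fun i => ?_) ((Q.add_mem_iff_right (hIQ _ h2)).1 h3)
        (fun h => hH (add_mem h2 h))
      refine sub_mem ?_ (Submodule.smul_mem _ _ (hc i))
      have := ι_mul_mem_Wt (mem_wt_zero.2 H.2) (hc i)
      rwa [add_zero] at this
  exact key c.support c hc huQ huI

lemma mem_of_closed_wt {P : Submodule K U} (hh : ∀ H : S.h, ∀ u ∈ P, ιU (H : g) * u ∈ P)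
    (hp : ∀ α, IsRt S α → ∀ x ∈ wt S α, ∀ u ∈ P, ιU x * u ∈ P) (h1 : 1 ∈ P) (u : U) : u ∈ P := by
  have hz : ∀ z : g, ∀ u ∈ P, ιU z * u ∈ P := by
    intro z u hu
    have : (⊤ : Submodule K g) ≤ P.comap ((LinearMap.mulRight K u).comp (ιU : g →ₗ[K] U)) := by
      rw [← S.h_span]
      refine iSup_le fun μ x hx => ?_
      change ιU x * u ∈ P
      by_cases h0 : μ = 0
      · subst h0
        exact hh ⟨x, mem_wt_zero.1 hx⟩ u hu
      by_cases hr : IsRt S μ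
      · exact hp μ hr x hx u hu
      · rw [eq_zero_of_not_root h0 hr hx, _root_.map_zero, zero_mul]
        exact zero_mem _
    exact this (x := z) trivial
  let A : Subalgebra K U :=
    { carrier := {v | ∀ u ∈ P, v * u ∈ P}
      mul_mem' := fun ha hb u hu => by rw [mul_assoc]; exact ha _ (hb u hu)
      add_mem' := fun ha hb u hu => by rw [add_mul]; exact add_mem (ha u hu) (hb u hu)
      algebraMap_mem' := fun r u hu => by rw [← Algebra.smul_def]; exact P.smul_mem r hu }
  have := mem_of_ι_mem A (fun z => hz z) u 1 h1
  rwa [mul_one] at this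

/-- The smallest subspace containing `1` and `I`, stable under `h` and the negative root spaces. -/
def low (S : Setup K g) (I : Submodule U U) : Submodule K U :=
  sInf {P | 1 ∈ P ∧ (∀ u ∈ I, u ∈ P) ∧ (∀ H : S.h, ∀ u ∈ P, ιU (H : g) * u ∈ P) ∧
    ∀ α, IsRt S α → α ∉ S.pos → ∀ x ∈ wt S α, ∀ u ∈ P, ιU x * u ∈ P}

lemma low_eq_top {I : Submodule U U} (hn : ∀ α ∈ S.pos, ∀ x ∈ wt S α, ιU x ∈ I) (u : U) : u ∈ low S I := by
  have l1 : 1 ∈ low S I := Submodule.mem_sInf.2 fun P hP => hP.1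
  have l2 : ∀ u ∈ I, u ∈ low S I := fun u hu => Submodule.mem_sInf.2 fun P hP => hP.2.1 u hu
  have l3 : ∀ H : S.h, ∀ u ∈ low S I, ιU (H : g) * u ∈ low S I := fun H u hu =>
    Submodule.mem_sInf.2 fun P hP => hP.2.2.1 H u (Submodule.mem_sInf.1 hu P hP)
  have l4 : ∀ α, IsRt S α → α ∉ S.pos → ∀ x ∈ wt S α, ∀ u ∈ low S I, ιU x * u ∈ low S I :=
    fun α hr hp x hx u hu => Submodule.mem_sInf.2 fun P hP =>
      hP.2.2.2 α hr hp x hx u (Submodule.mem_sInf.1 hu P hP)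
  let P : Submodule K U :=
    { carrier := {u | u ∈ low S I ∧ ∀ β ∈ S.pos, ∀ e ∈ wt S β, ιU e * u ∈ low S I}
      add_mem' := fun ha hb => ⟨add_mem ha.1 hb.1, fun β hβ e he => by
        rw [mul_add]; exact add_mem (ha.2 β hβ e he) (hb.2 β hβ e he)⟩
      zero_mem' := ⟨zero_mem _, fun β hβ e he => by rw [mul_zero]; exact zero_mem _⟩
      smul_mem' := fun c x hx => ⟨Submodule.smul_mem _ c hx.1, fun β hβ e he => by
        rw [mul_smul_comm]; exact Submodule.smul_mem _ c (hx.2 β hβ e he)⟩ }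
  have hP : low S I ≤ P := by
    refine sInf_le ⟨?_, ?_, ?_, ?_⟩
    · exact ⟨l1, fun β hβ e he => by rw [mul_one]; exact l2 _ (hn β hβ e he)⟩
    · exact fun u hu => ⟨l2 u hu, fun β hβ e he => l2 _ (I.smul_mem _ hu)⟩
    · refine fun H u hu => ⟨l3 H u hu.1, fun β hβ e he => ?_⟩
      rw [ι_mul_ι_mul, ← lie_skew e (H : g), he H, ← neg_smul, map_smul, smul_mul_assoc]
      exact add_mem (Submodule.smul_mem _ _ (hu.2 β hβ e he)) (l3 H _ (hu.2 β hβ e he))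
    · refine fun α hr hp x hx u hu => ⟨l4 α hr hp x hx u hu.1, fun β hβ e he => ?_⟩
      rw [ι_mul_ι_mul]
      refine add_mem ?_ (l4 α hr hp x hx _ (hu.2 β hβ e he))
      have h1 := wt_lie he hx
      by_cases h0 : β + α = 0
      · rw [h0] at h1
        exact l3 ⟨_, mem_wt_zero.1 h1⟩ u hu.1
      by_cases hr' : IsRt S (β + α)
      · by_cases hp' : β + α ∈ S.pos
        · exact hu.2 _ hp' _ h1
        · exact l4 _ hr' hp' _ h1 u hu.1
      · rw [eq_zero_of_not_root h0 hr' h1, _root_.map_zero, zero_mul]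
        exact zero_mem _
  refine mem_of_closed_wt l3 (fun α hr x hx u hu => ?_) l1 u
  by_cases hp : α ∈ S.pos
  · exact (hP hu).2 α hp x hx
  · exact l4 α hr hp x hx u hu

lemma mem_wtSpan {I : Submodule U U} (hD : S.IsDynkin) {lam : Module.Dual K S.h}
    (hn : ∀ α ∈ S.pos, ∀ x ∈ wt S α, ιU x ∈ I)
    (h1 : 1 ∈ Wt I lam) (u : U) : u ∈ wtSpan I lam := by
  have hle : ∀ a : SimpleSum S, Wt I (lam - a.1.sum) ≤ wtSpan I lam := fun a =>
    le_iSup (fun a : SimpleSum S => Wt I (lam - a.1.sum)) a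
  have hz : Wt I lam ≤ wtSpan I lam := by
    have := hle ⟨0, by simp⟩
    rwa [Multiset.sum_zero, sub_zero] at this
  refine (sInf_le ⟨hz h1, fun u hu => hz (mem_Wt_of_mem _ hu), fun H u hu => ?_,
    fun α hr hp x hx u hu => ?_⟩ : low S I ≤ wtSpan I lam) (low_eq_top hn u)
  · induction hu using Submodule.iSup_induction' with
    | mem a u hu =>
      have := ι_mul_mem_Wt (mem_wt_zero.2 H.2) hu
      rw [add_zero] at this
      exact hle a this
    | zero => rw [mul_zero]; exact zero_mem _
    | add a b _ _ ha hb => rw [mul_add]; exact add_mem ha hb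
  · obtain ⟨s, hs, hsα⟩ := exists_decomp hD (neg_mem_pos hr hp)
    induction hu using Submodule.iSup_induction' with
    | mem a u hu =>
      have := ι_mul_mem_Wt hx hu
      refine hle ⟨a.1 + s, fun β hβ => (Multiset.mem_add.1 hβ).elim (a.2 β) (hs β)⟩ ?_
      rw [Multiset.sum_add, hsα]
      convert this using 1
      rw [sub_add_eq_sub_sub, sub_neg_eq_add]
    | zero => rw [mul_zero]; exact zero_mem _
    | add a b _ _ ha hb => rw [mul_add]; exact add_mem ha hb

/-- A left ideal strictly containing `I` contains a highest weight vector modulo `I`. -/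
lemma exists_highest {I : Submodule U U} (hD : S.IsDynkin) {lam : Module.Dual K S.h}
    (hn : ∀ α ∈ S.pos, ∀ x ∈ wt S α, ιU x ∈ I) (h1 : 1 ∈ Wt I lam) {Q : Submodule U U} (hIQ : I ≤ Q)
    {u : U} (huQ : u ∈ Q) (huI : u ∉ I) :
    ∃ μ : Module.Dual K S.h, ∃ w ∈ Wt I μ, w ∈ Q ∧ w ∉ I ∧ ∀ α ∈ S.pos, ∀ x ∈ wt S α, ιU x * w ∈ I := by
  classical
  have hex : ∃ n, ∃ a : SimpleSum S, Multiset.card a.1 = n ∧ ∃ w ∈ Wt I (lam - a.1.sum), w ∈ Q ∧ w ∉ I := by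
    obtain ⟨a, w, hw⟩ := exists_weight (Q := Q.restrictScalars K) (fun H u hu => Q.smul_mem _ hu)
      (fun u hu => hIQ hu) (mem_wtSpan hD hn h1 u) huQ huI
    exact ⟨_, a, rfl, w, hw⟩
  obtain ⟨a, ha, w, hw, hwQ, hwI⟩ := Nat.find_spec hex
  refine ⟨_, w, hw, hwQ, hwI, fun α hα x hx => ?_⟩
  by_contra hxw
  have h2 := ι_mul_mem_Wt hx hw
  obtain ⟨a', w', hw', hw'W, hw'I⟩ := exists_weight (Q := Wt I (lam - a.1.sum + α))
    (fun H u hu => by simpa using ι_mul_mem_Wt (mem_wt_zero.2 H.2) hu) (fun u hu => mem_Wt_of_mem _ hu)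
    (mem_wtSpan hD hn h1 (ιU x * w)) h2 hxw
  have heq : lam - a.1.sum + α = lam - a'.1.sum := by
    refine LinearMap.ext fun H => ?_
    by_contra hne
    have h3 := sub_mem (hw' H) (hw'W H)
    rw [sub_sub_sub_cancel_left, ← sub_smul] at h3
    refine hw'I ?_
    have := I.smul_of_tower_mem ((lam - a.1.sum + α) H - (lam - a'.1.sum) H)⁻¹ h3
    rwa [smul_smul, inv_mul_cancel₀ (sub_ne_zero.2 hne), one_smul] at this
  have hmin := Nat.find_min' hex ⟨a', rfl, ιU x * w, heq ▸ h2, Q.smul_mem _ hwQ, hxw⟩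
  rw [← ha] at hmin
  obtain ⟨s, hs, hsα⟩ := exists_decomp hD hα
  have h4 : a.1 = a'.1 + s := by
    refine eq_of_sum_eq hD a.2 (fun β hβ => (Multiset.mem_add.1 hβ).elim (a'.2 β) (hs β)) ?_
    rw [Multiset.sum_add, hsα, ← sub_eq_zero]
    have := sub_eq_zero.2 heq
    rw [← neg_eq_zero, ← this]
    abel
  rw [h4, Multiset.card_add] at hmin
  have h5 : s = 0 := Multiset.card_eq_zero.1 (by lia)
  rw [h5, Multiset.sum_zero] at hsα
  exact (S.pos_root α hα).1 hsα.symm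

lemma ι_nplus_mul {I : Submodule U U} {w : U}
    (hw : ∀ α ∈ S.pos, ∀ x ∈ wt S α, ιU x * w ∈ I) {x : g} (hx : x ∈ S.nplus) :
    ιU x * w ∈ I := by
  have : S.nplus ≤ (I.restrictScalars K).comap ((LinearMap.mulRight K w).comp (ιU : g →ₗ[K] U)) :=
    iSup₂_le fun α hα x hx => hw α hα x hx
  exact this hx

/-- A nonzero homomorphism from a Verma module onto a simple submodule of a Verma module is an
isomorphism. -/
lemma exists_equiv (hD : S.IsDynkin) (lam : Module.Dual K S.h)
    (N : Submodule U (U ⧸ S.vermaIdeal lam)) (hN : IsSimpleModule U N) :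
    ∃ mu : Module.Dual K S.h, Nonempty (N ≃ₗ[U] (U ⧸ S.vermaIdeal mu)) := by
  have hNb : N ≠ ⊥ := (Submodule.nontrivial_iff_ne_bot).1 (IsSimpleModule.nontrivial U N)
  obtain ⟨v, hv, hv0⟩ := N.ne_bot_iff.1 hNb
  obtain ⟨u, rfl⟩ := Submodule.Quotient.mk_surjective _ v
  have hn : ∀ α ∈ S.pos, ∀ x ∈ wt S α, ιU x ∈ S.vermaIdeal lam := fun α hα x hx =>
    Submodule.subset_span (Or.inl ⟨x, (le_iSup₂_of_le α hα le_rfl : wt S α ≤ S.nplus) hx, rfl⟩)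
  have h1 : 1 ∈ Wt (S.vermaIdeal lam) lam := fun H => by
    rw [mul_one, ← Algebra.algebraMap_eq_smul_one]
    exact Submodule.subset_span (Or.inr ⟨H, rfl⟩)
  obtain ⟨mu, w, hw, hwQ, hwI, hwn⟩ := exists_highest hD hn h1
    (Q := N.comap (S.vermaIdeal lam).mkQ) (fun x hx => by
      rw [Submodule.mem_comap, Submodule.mkQ_apply, (Submodule.Quotient.mk_eq_zero _).2 hx]
      exact zero_mem _) hv (fun h => hv0 ((Submodule.Quotient.mk_eq_zero _).2 h))
  let φ : U →ₗ[U] N := LinearMap.toSpanSingleton U N ⟨(S.vermaIdeal lam).mkQ w, hwQ⟩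
  have hφ : ∀ u, φ u = 0 ↔ u * w ∈ S.vermaIdeal lam := fun u => by
    rw [LinearMap.toSpanSingleton_apply, ← Submodule.Quotient.mk_eq_zero, ← Submodule.coe_eq_zero]
    rfl
  have hker : LinearMap.ker φ = S.vermaIdeal mu := by
    refine le_antisymm (fun u hu => ?_) (Submodule.span_le.2 ?_)
    · rw [LinearMap.mem_ker, hφ, vermaIdeal_eq] at hu
      rw [vermaIdeal_eq]
      rw [vermaIdeal_eq] at hwI
      refine mem_charIdeal_of_mul_mem (extend_lie lam) (extend_lie mu) hwI (fun y hy => ?_) hu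
      obtain ⟨H, x, hx, rfl⟩ := mem_b_iff.1 hy
      rw [← vermaIdeal_eq, map_add, map_add, extend_h, extend_nplus mu hx, add_zero, add_mul,
        add_sub_right_comm]
      exact add_mem (hw H) (ι_nplus_mul hwn hx)
    · rintro _ (⟨x, hx, rfl⟩ | ⟨H, rfl⟩)
      · exact (hφ _).2 (ι_nplus_mul hwn hx)
      · refine (hφ _).2 ?_
        rw [sub_mul, ← Algebra.smul_def]
        exact hw H
  have hsurj : Function.Surjective φ := by
    refine (LinearMap.surjective_or_eq_zero φ).resolve_right fun h => hwI ?_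
    have := (hφ 1).1 (by rw [h, LinearMap.zero_apply])
    rwa [one_mul] at this
  exact ⟨mu, ⟨(φ.quotKerEquivOfSurjective hsurj).symm.trans (Submodule.quotEquivOfEq _ _ hker)⟩⟩

lemma simple_unique (lam : Module.Dual K S.h) (N₁ N₂ : Submodule U (U ⧸ S.vermaIdeal lam))
    (h₁ : IsSimpleModule U N₁) (h₂ : IsSimpleModule U N₂) : N₁ = N₂ := by
  rw [isSimpleModule_iff_isAtom] at h₁ h₂
  by_contra hne
  exact verma_inf_ne_bot (vermaIdeal_eq lam) h₁.1 h₂.1 (h₁.disjoint_of_ne h₂ hne).eq_bot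

end Verma
end Str

/-- For every `lam ∈ h^*`, the Verma module `M(lam)` has at most one
simple submodule, and if a simple submodule exists it is itself a Verma module. -/
theorem verma_simple_submodule
    (K : Type) [Field K] [IsAlgClosed K] [CharZero K]
    (g : Type) [LieRing g] [LieAlgebra K g] (S : Setup K g) (hDynkin : S.IsDynkin)
    (lam : Module.Dual K S.h) :
    (∀ N₁ N₂ : Submodule (Env K g) (S.Verma lam),
        IsSimpleModule (Env K g) N₁ → IsSimpleModule (Env K g) N₂ → N₁ = N₂) ∧
    (∀ N : Submodule (Env K g) (S.Verma lam), IsSimpleModule (Env K g) N →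
        ∃ mu : Module.Dual K S.h, Nonempty (N ≃ₗ[Env K g] S.Verma mu)) := by
  exact ⟨Str.simple_unique lam, Str.exists_equiv hDynkin lam⟩

end Paper
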